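/- arXiv:1708.08820 — 3 statements merged into one kernel-verified Lean document; each statement's English description precedes it below -/
import Mathlib

section
/- Let V be a finite set and E a finite set of unordered pairs {u,v} of distinct elements of V. Let J : E → ℝ satisfy J_e > 0 for all e ∈ E. For J > 0 let V_J(θ) = Σ_{m∈ℤ} exp(−(J/2)(θ + 2πm)²). Then for every family (z_v)_{v∈V} of complex numbers with Re z_v > 0 for all v ∈ V, one has ∫_{(−π,π]^V} exp( Σ_{v∈V} z_v cos θ_v ) ∏_{{u,v}∈E} V_{J_{{u,v}}}(θ_u − θ_v) ∏_{v∈V} dθ_v ≠ 0. -/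
open MeasureTheory Real

/-- The periodized Gaussian `V_J(θ) = ∑_{m ∈ ℤ} exp(-(J/2)(θ + 2πm)²)`. -/
noncomputable def villainWeight (J θ : ℝ) : ℝ :=
  ∑' m : ℤ, Real.exp (-(J / 2) * (θ + 2 * π * m) ^ 2)

lemma villainWeight_neg (J x : ℝ) : villainWeight J (-x) = villainWeight J x := by
  unfold villainWeight
  rw [← (Equiv.neg ℤ).tsum_eq (fun m : ℤ => Real.exp (-(J / 2) * (-x + 2 * π * m) ^ 2))]
  apply tsum_congr
  intro m
  show Real.exp (-(J / 2) * (-x + 2 * π * ((-m : ℤ) : ℝ)) ^ 2) = _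
  congr 1
  push_cast
  ring

/-- For a configuration of angles `θ : V → ℝ` and couplings `J`, the symmetric function
sending an unordered pair `{u, v}` to `V_{J(e)}(θ u - θ v)`. -/
noncomputable def villainEdge {V : Type*} (J : Sym2 V → ℝ) (θ : V → ℝ) (e : Sym2 V) : ℝ :=
  Sym2.lift ⟨fun u v => villainWeight (J e) (θ u - θ v), fun u v => by
    show villainWeight (J e) (θ u - θ v) = villainWeight (J e) (θ v - θ u)
    rw [← villainWeight_neg, neg_sub]⟩ e

section Stability

open Polynomial in
/-- If `p` has no zeros in the open right half-plane, its logarithmic derivative has positive real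
part there, unless `p` is constant. -/
lemma re_logDeriv_pos_or_derivative_eq_zero {p : ℂ[X]} (hp : ∀ s : ℂ, 0 < s.re → p.eval s ≠ 0)
    {s : ℂ} (hs : 0 < s.re) :
    0 < (p.derivative.eval s / p.eval s).re ∨ p.derivative = 0 := by
  have hsplit : p.Splits := IsAlgClosed.splits p
  rw [hsplit.eval_derivative_div_eval_of_ne_zero (hp s hs)]
  rcases eq_or_ne p.roots 0 with h0 | h0
  · right
    have hdeg : p.natDegree = 0 := by
      rw [hsplit.natDegree_eq_card_roots, h0, Multiset.card_zero]
    exact derivative_of_natDegree_zero hdeg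
  · left
    have hterm : ∀ r ∈ p.roots, 0 < (1 / (s - r)).re := by
      intro r hr
      have hr0 : r.re ≤ 0 := by
        by_contra h
        exact hp r (not_le.mp h) (isRoot_of_mem_roots hr)
      have hre : 0 < (s - r).re := by rw [Complex.sub_re]; linarith
      rw [one_div, Complex.inv_re]
      refine div_pos hre (Complex.normSq_pos.mpr fun h => ?_)
      rw [h] at hre
      exact lt_irrefl _ hre
    have hsum : ∀ t : Multiset ℂ, (t.map fun r => 1 / (s - r)).sum.re =
        (t.map fun r => (1 / (s - r)).re).sum := by
      intro t
      induction t using Multiset.induction with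
      | empty => simp
      | cons a t ih => simp only [Multiset.map_cons, Multiset.sum_cons, Complex.add_re, ih]
    rw [hsum]
    obtain ⟨r, hr⟩ := Multiset.exists_mem_of_ne_zero h0
    obtain ⟨t, ht⟩ := Multiset.exists_cons_of_mem hr
    rw [ht] at hterm ⊢
    rw [Multiset.map_cons, Multiset.sum_cons]
    refine add_pos_of_pos_of_nonneg (hterm _ (Multiset.mem_cons_self _ _))
      (Multiset.sum_nonneg fun a ha => ?_)
    obtain ⟨b, hb, rfl⟩ := Multiset.mem_map.mp ha
    exact (hterm b (Multiset.mem_cons_of_mem hb)).le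

open Polynomial in
lemma re_logDeriv_nonneg {p : ℂ[X]} (hp : ∀ s : ℂ, 0 < s.re → p.eval s ≠ 0)
    {s : ℂ} (hs : 0 < s.re) : 0 ≤ (p.derivative.eval s / p.eval s).re := by
  rcases re_logDeriv_pos_or_derivative_eq_zero hp hs with h | h
  · exact h.le
  · simp [h]

/-- A complex polynomial is Hurwitz stable if it has no zeros with all coordinates in the open
right half-plane. -/
def HurwitzStable {ι : Type*} (f : MvPolynomial ι ℂ) : Prop :=
  ∀ x : ι → ℂ, (∀ i, 0 < (x i).re) → MvPolynomial.eval x f ≠ 0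

variable {ι : Type*} [DecidableEq ι]

/-- The univariate polynomial obtained from `f` by freezing all variables but the `i`-th. -/
noncomputable def MvPolynomial.slice (f : MvPolynomial ι ℂ) (x : ι → ℂ) (i : ι) : Polynomial ℂ :=
  MvPolynomial.aeval (Function.update (fun k => Polynomial.C (x k)) i Polynomial.X) f

lemma MvPolynomial.eval_slice (f : MvPolynomial ι ℂ) (x : ι → ℂ) (i : ι) (s : ℂ) :
    (f.slice x i).eval s = MvPolynomial.eval (Function.update x i s) f := by
  rw [slice, MvPolynomial.aeval_def, ← Polynomial.coe_evalRingHom, MvPolynomial.hom_eval₂]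
  congr 1
  · ext; simp
  · ext k
    rcases eq_or_ne k i with rfl | h
    · simp
    · simp [h]

lemma MvPolynomial.derivative_slice (f : MvPolynomial ι ℂ) (x : ι → ℂ) (i : ι) :
    Polynomial.derivative (f.slice x i) = (MvPolynomial.pderiv i f).slice x i := by
  unfold slice
  induction f using MvPolynomial.induction_on with
  | C a => simp
  | add p q hp hq => simp [hp, hq]
  | mul_X p k hp =>
    rcases eq_or_ne k i with rfl | h
    · simp [Derivation.leibniz, hp, mul_comm]
    · simp [Derivation.leibniz, hp, h, MvPolynomial.pderiv_X_of_ne h, mul_comm]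

lemma HurwitzStable.eval_slice_ne_zero {f : MvPolynomial ι ℂ} (hf : HurwitzStable f) {x : ι → ℂ}
    (hx : ∀ i, 0 < (x i).re) (i : ι) (s : ℂ) (hs : 0 < s.re) : (f.slice x i).eval s ≠ 0 := by
  rw [MvPolynomial.eval_slice]
  refine hf _ fun k => ?_
  rcases eq_or_ne k i with rfl | h
  · simpa using hs
  · simpa [h] using hx k

/-- A Lieb–Sokal type lemma: the operator `1 + c ∂ᵢ∂ⱼ` preserves Hurwitz stability. -/
lemma HurwitzStable.add_pderiv_pderiv {f : MvPolynomial ι ℂ} (hf : HurwitzStable f) {i j : ι}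
    (hij : i ≠ j) {c : ℝ} (hc : 0 < c) :
    HurwitzStable (f + MvPolynomial.C (c : ℂ) *
      MvPolynomial.pderiv j (MvPolynomial.pderiv i f)) := by
  intro x hx h0
  set Q := MvPolynomial.pderiv i f with hQ
  set q := Q.slice x j with hq
  set p := f.slice x j with hp
  have hpne : ∀ t : ℂ, 0 < t.re → p.eval t ≠ 0 := fun t ht => hf.eval_slice_ne_zero hx j t ht
  have hupd : ∀ t : ℂ, 0 < t.re → ∀ k, 0 < (Function.update x j t k).re := by
    intro t ht k
    rcases eq_or_ne k j with rfl | h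
    · simpa using ht
    · simpa [h] using hx k
  -- the logarithmic derivative in direction `i`, as a function of the `j`-th variable
  have key : ∀ t : ℂ, 0 < t.re → 0 < (q.eval t / p.eval t).re ∨ q.eval t = 0 := by
    intro t ht
    have hy := hupd t ht
    have hyi : Function.update (Function.update x j t) i (x i) = Function.update x j t := by
      conv_lhs => rw [← Function.update_of_ne hij t x]
      exact Function.update_eq_self _ _
    have h := re_logDeriv_pos_or_derivative_eq_zero
      (fun s hs => hf.eval_slice_ne_zero hy i s hs) (hx i)
    rw [MvPolynomial.derivative_slice] at h
    have h1 : ((MvPolynomial.pderiv i f).slice (Function.update x j t) i).eval (x i) =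
        q.eval t := by
      rw [MvPolynomial.eval_slice, hyi, hq, MvPolynomial.eval_slice]
    have h2 : (f.slice (Function.update x j t) i).eval (x i) = p.eval t := by
      rw [MvPolynomial.eval_slice, hyi, hp, MvPolynomial.eval_slice]
    rcases h with h | h
    · left; rwa [h1, h2] at h
    · right; rw [← h1, h]; simp
  have hsum : p.eval (x j) + c * q.derivative.eval (x j) = 0 := by
    rw [hp, hq, MvPolynomial.derivative_slice, MvPolynomial.eval_slice, MvPolynomial.eval_slice,
      Function.update_eq_self]
    simpa using h0
  by_cases hz : ∃ t : ℂ, 0 < t.re ∧ q.eval t = 0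
  · obtain ⟨t₀, ht₀, hqt₀⟩ := hz
    set U : Set ℂ := {t | 0 < t.re} with hU
    have hUo : IsOpen U := isOpen_lt continuous_const Complex.continuous_re
    have hUc : IsPreconnected U := (convex_halfSpace_re_gt 0).isPreconnected
    have hg : AnalyticOnNhd ℂ (fun t => q.eval t / p.eval t) U := by
      refine DifferentiableOn.analyticOnNhd ?_ hUo
      exact q.differentiable.differentiableOn.div p.differentiable.differentiableOn hpne
    have hzero : ∀ t ∈ U, q.eval t = 0 := by
      rcases hg.is_constant_or_isOpen hUc with ⟨w, hw⟩ | hopen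
      · have hw0 : w = 0 := by rw [← hw t₀ ht₀, hqt₀, zero_div]
        intro t ht
        have := hw t ht
        rw [hw0] at this
        exact (div_eq_zero_iff.mp this).resolve_right (hpne t ht)
      · exfalso
        have hmem : (0 : ℂ) ∈ (fun t => q.eval t / p.eval t) '' U :=
          ⟨t₀, ht₀, by simp [hqt₀]⟩
        obtain ⟨ε, hε, hball⟩ := Metric.isOpen_iff.mp (hopen U subset_rfl hUo) 0 hmem
        have : (-(ε / 2 : ℝ) : ℂ) ∈ Metric.ball (0 : ℂ) ε := by
          rw [mem_ball_zero_iff, norm_neg, Complex.norm_real, Real.norm_eq_abs,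
            abs_of_pos (half_pos hε)]
          exact half_lt_self hε
        obtain ⟨t, ht, hte⟩ := hball this
        dsimp only at hte
        rcases key t ht with h | h
        · rw [hte, Complex.neg_re, Complex.ofReal_re] at h
          linarith
        · rw [h, zero_div] at hte
          have := congrArg Complex.re hte
          rw [Complex.neg_re, Complex.ofReal_re, Complex.zero_re] at this
          linarith
    have hq0 : q = 0 := by
      refine Polynomial.eq_zero_of_infinite_isRoot q (Set.Infinite.mono (s := U) hzero ?_)
      exact infinite_of_mem_nhds 1 (hUo.mem_nhds (by simp [hU]))
    rw [hq0] at hsum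
    exact hpne _ (hx j) (by simpa using hsum)
  · push Not at hz
    have h1 : 0 < (q.eval (x j) / p.eval (x j)).re :=
      (key _ (hx j)).resolve_right (hz _ (hx j))
    have h2 := re_logDeriv_nonneg hz (hx j)
    have hq0 := hz _ (hx j)
    have h3 : (q.eval (x j) / p.eval (x j))⁻¹ +
        c * (q.derivative.eval (x j) / q.eval (x j)) = 0 := by
      rw [inv_div, mul_div_assoc', ← add_div, hsum, zero_div]
    have h4 := congrArg Complex.re h3
    rw [Complex.add_re, Complex.re_ofReal_mul, Complex.inv_re, Complex.zero_re] at h4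
    have h5 : 0 < (q.eval (x j) / p.eval (x j)).re /
        Complex.normSq (q.eval (x j) / p.eval (x j)) :=
      div_pos h1 (Complex.normSq_pos.mpr (div_ne_zero hq0 (hpne _ (hx j))))
    have h6 := mul_nonneg hc.le h2
    linarith

end Stability

section SingleSite

open Filter Topology
open scoped Nat

lemma laguerre_sum_ne_zero (n : ℕ) {u w : ℂ} (hu : 0 < u.re) (hw : 0 < w.re) :
    ∑ j ∈ Finset.range (n + 1), (n.choose j / j ! : ℂ) * (u * w) ^ j ≠ 0 := by
  have hu0 : u ≠ 0 := by rintro rfl; simp at hu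
  have huinv : 0 < (u⁻¹).re := by
    rw [Complex.inv_re]; exact div_pos hu (Complex.normSq_pos.mpr hu0)
  set T : Module.End ℂ (Polynomial ℂ) := 1 + u⁻¹ • Polynomial.derivative with hT
  have hstep : ∀ k : ℕ, ∀ s : ℂ, 0 < s.re → ((T ^ k) (Polynomial.X ^ n)).eval s ≠ 0 := by
    intro k
    induction k with
    | zero =>
      intro s hs h
      have hs0 : s ≠ 0 := by rintro rfl; simp at hs
      exact pow_ne_zero n hs0 (by simpa using h)
    | succ k ih =>
      intro s hs h
      rw [pow_succ', Module.End.mul_apply] at h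
      set p := (T ^ k) (Polynomial.X ^ n)
      have h1 := re_logDeriv_nonneg ih hs
      have h2 : p.derivative.eval s / p.eval s = -u := by
        have h3 : p.eval s + u⁻¹ * p.derivative.eval s = 0 := by simpa [hT] using h
        rw [div_eq_iff (ih s hs)]
        field_simp at h3
        linear_combination h3
      rw [h2, Complex.neg_re] at h1
      linarith
  have hexp : ((T ^ n) (Polynomial.X ^ n)).eval w =
      (n ! / u ^ n : ℂ) * ∑ j ∈ Finset.range (n + 1), (n.choose j / j ! : ℂ) * (u * w) ^ j := by
    rw [hT, add_comm, (Commute.one_right _).add_pow, ← Finset.sum_range_reflect, Finset.mul_sum,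
      LinearMap.sum_apply, Polynomial.eval_finsetSum]
    refine Finset.sum_congr rfl fun j hj => ?_
    have hjn : j ≤ n := Nat.lt_succ_iff.mp (Finset.mem_range.mp hj)
    have e1 : n + 1 - 1 - j = n - j := by omega
    rw [e1, Nat.choose_symm hjn, one_pow, mul_one, smul_pow, Module.End.mul_apply,
      Module.End.natCast_apply]
    rw [map_nsmul, LinearMap.smul_apply, Module.End.pow_apply,
      Polynomial.iterate_derivative_X_pow_eq_smul]
    have e2 : ((n.descFactorial (n - j) : ℕ) : ℂ) * (j ! : ℂ) = n ! := by
      have := Nat.factorial_mul_descFactorial (Nat.sub_le n j)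
      rw [Nat.sub_sub_self hjn] at this
      exact_mod_cast (mul_comm _ _).trans this
    have hj0 : (j ! : ℂ) ≠ 0 := by exact_mod_cast Nat.factorial_ne_zero j
    have e3 : u ^ n = u ^ j * u ^ (n - j) := by rw [← pow_add, Nat.add_sub_cancel' hjn]
    simp only [Polynomial.eval_smul, Polynomial.eval_pow, Polynomial.eval_X, nsmul_eq_mul,
      smul_eq_mul, Nat.sub_sub_self hjn, inv_pow, Polynomial.eval_mul, Polynomial.eval_natCast]
    rw [e3, ← e2, mul_pow]
    field_simp
  intro h
  rw [h, mul_zero] at hexp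
  exact hstep n w hw hexp

/-- The power series `∑ⱼ xʲ / (j!)²`, that is, `I₀(2√x)`. -/
noncomputable def besselSeries (x : ℂ) : ℂ := ∑' j : ℕ, x ^ j / (j ! : ℂ) ^ 2

lemma tendsto_choose_div_pow (j : ℕ) :
    Tendsto (fun n : ℕ => ((n.choose j : ℝ) / (j ! * n ^ j))) atTop (𝓝 (1 / (j ! : ℝ) ^ 2)) := by
  have h := (isEquivalent_choose j)
  have h2 := h.div (Asymptotics.IsEquivalent.refl (u := fun n : ℕ => ((j ! : ℝ) * (n : ℝ) ^ j))
    (l := atTop))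
  refine (h2.symm.tendsto_nhds ?_)
  refine tendsto_const_nhds.congr' ?_
  filter_upwards [eventually_gt_atTop 0] with n hn
  have : (n : ℝ) ≠ 0 := by positivity
  simp only [Pi.div_apply]
  field_simp

lemma choose_div_pow_le (n j : ℕ) : (n.choose j : ℝ) / (j ! * n ^ j) ≤ 1 / j ! := by
  rcases Nat.eq_zero_or_pos n with rfl | hn
  · rcases Nat.eq_zero_or_pos j with rfl | hj
    · simp
    · rw [Nat.choose_eq_zero_of_lt hj]; simp
  · have h := Nat.choose_le_pow_div (α := ℝ) j n
    have h1 : (1 : ℝ) ≤ j ! := by exact_mod_cast Nat.succ_le_of_lt (Nat.factorial_pos j)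
    have h2 : (n.choose j : ℝ) ≤ n ^ j := h.trans (div_le_self (by positivity) h1)
    rw [div_le_div_iff₀ (by positivity) (by positivity)]
    calc (n.choose j : ℝ) * j ! ≤ n ^ j * j ! := by gcongr
      _ = 1 * (j ! * n ^ j) := by ring

lemma tendsto_laguerre_sum (x₀ : ℂ) :
    Tendsto (fun p : ℕ × ℂ => ∑ j ∈ Finset.range (p.1 + 1),
      (p.1.choose j / (j ! * p.1 ^ j) : ℂ) * p.2 ^ j) (atTop ×ˢ 𝓝 x₀) (𝓝 (besselSeries x₀)) := by
  have heq : ∀ p : ℕ × ℂ, ∑ j ∈ Finset.range (p.1 + 1),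
      (p.1.choose j / (j ! * p.1 ^ j) : ℂ) * p.2 ^ j =
      ∑' j : ℕ, (p.1.choose j / (j ! * p.1 ^ j) : ℂ) * p.2 ^ j := by
    intro p
    refine (tsum_eq_sum fun j hj => ?_).symm
    rw [Nat.choose_eq_zero_of_lt (by simpa using hj)]
    simp
  simp_rw [heq]
  refine tendsto_tsum_of_dominated_convergence
    (bound := fun j : ℕ => (‖x₀‖ + 1) ^ j / (j ! : ℝ)) (Real.summable_pow_div_factorial _) ?_ ?_
  · intro j
    have h1 : Tendsto (fun p : ℕ × ℂ => (((p.1.choose j : ℝ) / (j ! * (p.1 : ℝ) ^ j) : ℝ) : ℂ))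
        (atTop ×ˢ 𝓝 x₀) (𝓝 ((1 / (j ! : ℝ) ^ 2 : ℝ) : ℂ)) :=
      (Complex.continuous_ofReal.tendsto _).comp ((tendsto_choose_div_pow j).comp tendsto_fst)
    have h2 : Tendsto (fun p : ℕ × ℂ => p.2 ^ j) (atTop ×ˢ 𝓝 x₀) (𝓝 (x₀ ^ j)) :=
      tendsto_snd.pow j
    convert! h1.mul h2 using 2
    · push_cast; ring
    · push_cast; ring
  · have : ∀ᶠ p : ℕ × ℂ in atTop ×ˢ 𝓝 x₀, ‖p.2‖ < ‖x₀‖ + 1 :=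
      (tendsto_snd.norm).eventually_lt_const (lt_add_one _)
    filter_upwards [this] with p hp j
    have h1 : ‖(p.1.choose j / (j ! * p.1 ^ j) : ℂ)‖ ≤ 1 / j ! := by
      have := choose_div_pow_le p.1 j
      rw [show (p.1.choose j / (j ! * p.1 ^ j) : ℂ) =
        (((p.1.choose j : ℝ) / (j ! * (p.1 : ℝ) ^ j) : ℝ) : ℂ) by push_cast; rfl,
        Complex.norm_real, Real.norm_of_nonneg (by positivity)]
      exact this
    rw [norm_mul, norm_pow, mul_comm, div_eq_mul_one_div ((‖x₀‖ + 1) ^ j)]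
    exact mul_le_mul (pow_le_pow_left₀ (norm_nonneg _) hp.le j) h1 (norm_nonneg _) (by positivity)

lemma integral_exp_int_mul (m : ℤ) :
    ∫ θ : ℝ in Set.Ioc (-π) π, Complex.exp (m * (θ * Complex.I)) =
      if m = 0 then 2 * (π : ℂ) else 0 := by
  rw [← intervalIntegral.integral_of_le (by linarith [Real.pi_pos])]
  split_ifs with h
  · subst h
    simp
    ring
  · have hm : (m * Complex.I : ℂ) ≠ 0 := by simp [h]
    have : ∀ θ : ℝ, Complex.exp (m * (θ * Complex.I)) = Complex.exp (m * Complex.I * θ) := by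
      intro θ; congr 1; ring
    simp_rw [this]
    rw [integral_exp_mul_complex hm]
    have hper : Complex.exp (m * Complex.I * π) = Complex.exp (m * Complex.I * (-π : ℝ)) := by
      rw [Complex.exp_eq_exp_iff_exists_int]
      exact ⟨m, by push_cast; ring⟩
    rw [hper, sub_self, zero_div]

lemma integral_exp_add_conj (u w : ℂ) :
    ∫ θ : ℝ in Set.Ioc (-π) π, Complex.exp (u * Complex.exp (θ * Complex.I) +
      w * Complex.exp (-(θ * Complex.I))) = 2 * π * besselSeries (u * w) := by
  set F : ℕ × ℕ → ℝ → ℂ := fun k θ => (u ^ k.1 / (k.1 ! : ℂ) * (w ^ k.2 / (k.2 ! : ℂ))) *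
    Complex.exp (((k.1 : ℤ) - (k.2 : ℤ) : ℤ) * (θ * Complex.I)) with hF
  have hnorm : ∀ k θ, ‖F k θ‖ = ‖u‖ ^ k.1 / (k.1 ! : ℝ) * (‖w‖ ^ k.2 / (k.2 ! : ℝ)) := by
    intro k θ
    rw [hF]
    dsimp only
    rw [norm_mul, show (((k.1 : ℤ) - (k.2 : ℤ) : ℤ) : ℂ) * (θ * Complex.I) =
      ((((k.1 : ℤ) - (k.2 : ℤ) : ℤ) : ℝ) * θ : ℝ) * Complex.I by push_cast; ring,
      Complex.norm_exp_ofReal_mul_I]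
    simp
  have hsum : ∀ a b : ℂ, Summable fun k : ℕ × ℕ =>
      ‖a‖ ^ k.1 / (k.1 ! : ℝ) * (‖b‖ ^ k.2 / (k.2 ! : ℝ)) :=
    fun a b => (Real.summable_pow_div_factorial ‖a‖).mul_of_nonneg
      (Real.summable_pow_div_factorial ‖b‖) (fun _ => by positivity) (fun _ => by positivity)
  have hpt : ∀ θ : ℝ, Complex.exp (u * Complex.exp (θ * Complex.I) +
      w * Complex.exp (-(θ * Complex.I))) = ∑' k, F k θ := by
    intro θ
    have hexp : ∀ a : ℂ, HasSum (fun k : ℕ => a ^ k / (k ! : ℂ)) (Complex.exp a) := fun a => by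
      rw [Complex.exp_eq_exp_ℂ]; exact NormedSpace.expSeries_div_hasSum_exp a
    have hsummable : ∀ a : ℂ, Summable fun k : ℕ => ‖a ^ k / (k ! : ℂ)‖ := fun a => by
      simpa using Real.summable_pow_div_factorial ‖a‖
    rw [Complex.exp_add, ← (hexp (u * Complex.exp (θ * Complex.I))).tsum_eq,
      ← (hexp (w * Complex.exp (-(θ * Complex.I)))).tsum_eq,
      tsum_mul_tsum_of_summable_norm (hsummable _) (hsummable _)]
    refine tsum_congr fun k => ?_
    rw [mul_pow, mul_pow, ← Complex.exp_nat_mul, ← Complex.exp_nat_mul]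
    have : Complex.exp (((k.1 : ℤ) - (k.2 : ℤ) : ℤ) * (θ * Complex.I)) =
        Complex.exp (k.1 * (θ * Complex.I)) * Complex.exp (k.2 * (-(θ * Complex.I))) := by
      rw [← Complex.exp_add]; congr 1; push_cast; ring
    rw [hF]
    dsimp only
    rw [this]; ring
  have hinteg : ∀ k, Integrable (F k) (volume.restrict (Set.Ioc (-π) π)) := by
    intro k
    have : Continuous (F k) := by rw [hF]; fun_prop
    exact (this.integrableOn_Icc (a := -π) (b := π)).mono_set Set.Ioc_subset_Icc_self
  have hS : Summable fun k => ∫ θ in Set.Ioc (-π) π, ‖F k θ‖ := by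
    simp_rw [hnorm, integral_const, smul_eq_mul]
    exact (hsum u w).mul_left _
  simp_rw [hpt]
  rw [← integral_tsum_of_summable_integral_norm hinteg hS]
  have hval : ∀ k : ℕ × ℕ, ∫ θ in Set.Ioc (-π) π, F k θ =
      (u ^ k.1 / (k.1 ! : ℂ) * (w ^ k.2 / (k.2 ! : ℂ))) *
        (if k.2 = k.1 then 2 * (π : ℂ) else 0) := by
    intro k
    rw [hF]
    dsimp only
    rw [integral_const_mul, integral_exp_int_mul]
    congr 2
    rw [sub_eq_zero, Nat.cast_inj]
    exact propext eq_comm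
  simp_rw [hval]
  rw [Summable.tsum_prod]
  · simp only [mul_ite, mul_zero, tsum_ite_eq]
    rw [besselSeries, ← tsum_mul_left]
    refine tsum_congr fun j => ?_
    rw [mul_pow]; ring
  · refine Summable.of_norm_bounded (hg := (hsum u w).mul_right (2 * π)) fun k => ?_
    rw [norm_mul]
    gcongr
    · simp
    · split_ifs
      · simp [abs_of_pos Real.pi_pos]
      · simp [Real.pi_pos.le]

end SingleSite

section Limits

open Filter Topology

/-- **Hurwitz's theorem**: a locally uniform limit of nonvanishing holomorphic functions on a
preconnected open set is nonvanishing unless it vanishes identically. -/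
lemma ne_zero_of_tendstoLocallyUniformlyOn {U : Set ℂ} (hUo : IsOpen U) (hUc : IsPreconnected U)
    {f : ℕ → ℂ → ℂ} {g : ℂ → ℂ} (hf : ∀ n, DifferentiableOn ℂ (f n) U)
    (hfne : ∀ n, ∀ t ∈ U, f n t ≠ 0) (hlim : TendstoLocallyUniformlyOn f g atTop U)
    {t₀ : ℂ} (ht₀ : t₀ ∈ U) (hg₀ : g t₀ ≠ 0) {t : ℂ} (ht : t ∈ U) : g t ≠ 0 := by
  intro hgt
  have hgd : DifferentiableOn ℂ g U := hlim.differentiableOn (Eventually.of_forall hf) hUo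
  have hga : AnalyticOnNhd ℂ g U := hgd.analyticOnNhd hUo
  have hne : ∀ᶠ s in 𝓝[≠] t, g s ≠ 0 := by
    by_contra h
    exact hg₀ (hga.eqOn_zero_of_preconnected_of_frequently_eq_zero hUc ht
      (by simpa [Filter.not_eventually] using h) ht₀)
  rw [eventually_nhdsWithin_iff, Metric.eventually_nhds_iff_ball] at hne
  obtain ⟨r₁, hr₁, hball₁⟩ := hne
  obtain ⟨r₂, hr₂, hball₂⟩ := Metric.isOpen_iff.mp hUo t ht
  set r := min r₁ r₂ / 2 with hr
  have hr0 : 0 < r := half_pos (lt_min hr₁ hr₂)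
  have hrr₁ : r < r₁ := (half_lt_self (lt_min hr₁ hr₂)).trans_le (min_le_left _ _)
  have hrr₂ : r < r₂ := (half_lt_self (lt_min hr₁ hr₂)).trans_le (min_le_right _ _)
  have hcU : Metric.closedBall t r ⊆ U := (Metric.closedBall_subset_ball hrr₂).trans hball₂
  have hsU : Metric.sphere t r ⊆ U := Metric.sphere_subset_closedBall.trans hcU
  obtain ⟨s₀, hs₀, hmin⟩ := (isCompact_sphere t r).exists_isMinOn
    (NormedSpace.sphere_nonempty.mpr hr0.le) ((hgd.continuousOn.mono hsU).norm)
  have hδ : 0 < ‖g s₀‖ := by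
    refine norm_pos_iff.mpr (hball₁ s₀ ?_ ?_)
    · rw [Metric.mem_ball, Metric.mem_sphere.mp hs₀]; exact hrr₁
    · exact Metric.ne_of_mem_sphere hs₀ hr0.ne'
  have hunif := (tendstoLocallyUniformlyOn_iff_forall_isCompact hUo).mp hlim _ hcU
    (isCompact_closedBall t r)
  obtain ⟨n, hn⟩ := (Metric.tendstoUniformlyOn_iff.mp hunif (‖g s₀‖ / 2) (half_pos hδ)).exists
  have hinv : ‖(f n t)⁻¹‖ ≤ (‖g s₀‖ / 2)⁻¹ := by
    refine Complex.norm_le_of_forall_mem_frontier_norm_le (U := Metric.ball t r)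
      (f := fun s => (f n s)⁻¹) Metric.isBounded_ball ?_ ?_
      (subset_closure (Metric.mem_ball_self hr0))
    · refine DifferentiableOn.diffContOnCl ?_
      rw [closure_ball t hr0.ne']
      exact ((hf n).mono hcU).inv fun s hs => hfne n s (hcU hs)
    · rw [frontier_ball t hr0.ne']
      intro s hs
      rw [norm_inv]
      refine inv_anti₀ (half_pos hδ) ?_
      have h1 : ‖g s₀‖ ≤ ‖g s‖ := hmin hs
      have h2 := hn s (Metric.sphere_subset_closedBall hs)
      rw [dist_eq_norm] at h2
      have h3 := norm_sub_norm_le (g s) (f n s)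
      linarith
  have h2 := hn t (Metric.mem_closedBall_self hr0.le)
  rw [hgt, dist_zero_left] at h2
  rw [norm_inv] at hinv
  have h3 := (inv_le_inv₀ (norm_pos_iff.mpr (hfne n t ht)) (half_pos hδ)).mp hinv
  linarith

/-- A multivariate version of Hurwitz's theorem on the product of right half-planes. -/
lemma ne_zero_of_tendstoLocallyUniformly {V : Type*} [Fintype V] {F : ℕ → (V → ℂ) → ℂ}
    {G : (V → ℂ) → ℂ}
    (hF : ∀ n, ∀ a b : V → ℂ, Differentiable ℂ fun t : ℂ => F n fun v => a v + t * b v)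
    (hFne : ∀ n, ∀ z : V → ℂ, (∀ v, 0 < (z v).re) → F n z ≠ 0)
    (hlim : TendstoLocallyUniformly F G atTop)
    (hG : ∀ x : V → ℝ, (∀ v, 0 < x v) → G (fun v => (x v : ℂ)) ≠ 0)
    {z : V → ℂ} (hz : ∀ v, 0 < (z v).re) : G z ≠ 0 := by
  set ℓ : ℂ → V → ℂ := fun t v => ((z v).re : ℂ) + t * (Complex.I * (z v).im) with hℓ
  have hℓd : Differentiable ℂ ℓ := by rw [hℓ]; fun_prop
  have hre : ∀ t v, (ℓ t v).re = (z v).re - t.im * (z v).im := by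
    intro t v; simp [hℓ]; ring
  set U : Set ℂ := {t | ∀ v, 0 < (ℓ t v).re} with hU
  have hUo : IsOpen U := by
    have : U = ⋂ v, {t | 0 < (ℓ t v).re} := by ext; simp [hU]
    rw [this]
    refine isOpen_iInter_of_finite fun v => isOpen_lt continuous_const ?_
    exact Complex.continuous_re.comp ((continuous_apply v).comp hℓd.continuous)
  have hUc : Convex ℝ U := by
    intro a ha b hb p q hp hq hpq v
    have h1 := ha v
    have h2 := hb v
    rw [hre] at h1 h2 ⊢
    have h3 : (p • a + q • b).im = p * a.im + q * b.im := by simp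
    rw [h3]
    have h4 : (z v).re - (p * a.im + q * b.im) * (z v).im =
        p * ((z v).re - a.im * (z v).im) + q * ((z v).re - b.im * (z v).im) := by
      linear_combination -(z v).re * hpq
    rw [h4]
    rcases hp.eq_or_lt with rfl | hp
    · have : q = 1 := by linarith
      subst this; simpa using h2
    · exact add_pos_of_pos_of_nonneg (mul_pos hp h1) (mul_nonneg hq h2.le)
  have h1 : ℓ 1 = z := by
    ext v; simp only [hℓ, one_mul]; rw [mul_comm]; exact Complex.re_add_im _
  have h0 : ℓ 0 = fun v => ((z v).re : ℂ) := by ext v; simp [hℓ]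
  have key := ne_zero_of_tendstoLocallyUniformlyOn hUo hUc.isPreconnected
    (f := fun n t => F n (ℓ t)) (g := fun t => G (ℓ t)) (t₀ := 0) (t := 1)
    (fun n => (hF n _ _).differentiableOn) (fun n t ht => hFne n _ ht)
    (hlim.comp ℓ hℓd.continuous).tendstoLocallyUniformlyOn
    (by intro v; rw [h0]; simpa using hz v) (by rw [h0]; exact hG _ hz)
    (by intro v; rw [h1]; exact hz v)
  rwa [h1] at key

/-- Locally uniform limits of Hurwitz stable polynomials. -/
def IsLimitOfStable {ι : Type*} (F : (ι → ℂ) → ℂ) : Prop :=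
  ∃ f : ℕ → MvPolynomial ι ℂ, (∀ n, HurwitzStable (f n)) ∧
    TendstoLocallyUniformly (fun n x => MvPolynomial.eval x (f n)) F atTop

/-- The complex partial derivative of `F` in the `i`-th variable. -/
noncomputable def partialDeriv {ι : Type*} [DecidableEq ι] (i : ι) (F : (ι → ℂ) → ℂ)
    (x : ι → ℂ) : ℂ :=
  deriv (fun t => F (Function.update x i t)) (x i)

lemma MvPolynomial.differentiable_eval {ι : Type*} [Fintype ι] (f : MvPolynomial ι ℂ) :
    Differentiable ℂ fun x : ι → ℂ => MvPolynomial.eval x f := by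
  induction f using MvPolynomial.induction_on with
  | C a => simp
  | add p q hp hq => simp only [map_add]; exact hp.fun_add hq
  | mul_X p i hp =>
    simp only [map_mul, MvPolynomial.eval_X]
    exact hp.fun_mul (differentiable_apply i)

lemma IsLimitOfStable.differentiable_comp {ι : Type*} [Fintype ι] {F : (ι → ℂ) → ℂ}
    (hF : IsLimitOfStable F) {g : ℂ → ι → ℂ} (hg : Differentiable ℂ g) :
    Differentiable ℂ fun t => F (g t) := by
  obtain ⟨f, -, hlim⟩ := hF
  have h := (hlim.comp g hg.continuous).tendstoLocallyUniformlyOn (s := Set.univ)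
  exact differentiableOn_univ.mp (h.differentiableOn (Eventually.of_forall fun n =>
    ((MvPolynomial.differentiable_eval (f n)).comp hg).differentiableOn) isOpen_univ)

lemma MvPolynomial.deriv_eval_update {ι : Type*} [DecidableEq ι] (f : MvPolynomial ι ℂ) (i : ι)
    (x : ι → ℂ) :
    deriv (fun t => MvPolynomial.eval (Function.update x i t) f) (x i) =
      MvPolynomial.eval x (MvPolynomial.pderiv i f) := by
  simp_rw [← MvPolynomial.eval_slice]
  rw [Polynomial.deriv, MvPolynomial.derivative_slice, MvPolynomial.eval_slice,
    Function.update_eq_self]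

lemma differentiable_update {ι : Type*} [DecidableEq ι] (x : ι → ℂ) (i : ι) :
    Differentiable ℂ fun t : ℂ => Function.update x i t := by
  rw [differentiable_pi]
  intro k
  rcases eq_or_ne k i with rfl | h
  · simp
  · simp [h]

variable {ι : Type*} [Fintype ι] [DecidableEq ι]

lemma TendstoLocallyUniformly.partialDeriv {f : ℕ → MvPolynomial ι ℂ} {F : (ι → ℂ) → ℂ}
    (h : TendstoLocallyUniformly (fun n x => MvPolynomial.eval x (f n)) F atTop) (i : ι) :
    TendstoLocallyUniformly (fun n x => MvPolynomial.eval x (MvPolynomial.pderiv i (f n)))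
      (partialDeriv i F) atTop := by
  rw [Metric.tendstoLocallyUniformly_iff]
  intro ε hε x
  have hpoly : ∀ n (y : ι → ℂ), Differentiable ℂ
      fun t => MvPolynomial.eval (Function.update y i t) (f n) := fun n y =>
    (MvPolynomial.differentiable_eval (f n)).comp (differentiable_update y i)
  have hFd : ∀ y : ι → ℂ, Differentiable ℂ fun t => F (Function.update y i t) := by
    intro y
    have h1 := (h.comp _ (differentiable_update y i).continuous).tendstoLocallyUniformlyOn
      (s := Set.univ)
    exact differentiableOn_univ.mp (h1.differentiableOn
      (Eventually.of_forall fun n => (hpoly n y).differentiableOn) isOpen_univ)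
  have hcb : TendstoUniformlyOn (fun n x => MvPolynomial.eval x (f n)) F atTop
      (Metric.closedBall x 2) :=
    tendstoLocallyUniformly_iff_forall_isCompact.mp h _ (isCompact_closedBall x 2)
  have hn := Metric.tendstoUniformlyOn_iff.mp hcb (ε / 2) (half_pos hε)
  refine ⟨Metric.ball x 1, Metric.ball_mem_nhds x one_pos, hn.mono fun n hn y hy => ?_⟩
  have hd : DifferentiableAt ℂ (fun t => F (Function.update y i t)) (y i) := hFd y _
  have hd' : DifferentiableAt ℂ
    (fun t => MvPolynomial.eval (Function.update y i t) (f n)) (y i) := hpoly n y _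
  rw [dist_eq_norm, ← MvPolynomial.deriv_eval_update, _root_.partialDeriv, ← deriv_fun_sub hd hd']
  have hb := Complex.norm_deriv_le_of_forall_mem_sphere_norm_le (c := y i) (R := 1) (C := ε / 2)
    (f := fun t => F (Function.update y i t) - MvPolynomial.eval (Function.update y i t) (f n))
    one_pos ((hFd y).sub (hpoly n y)).diffContOnCl (fun t ht => by
      rw [← dist_eq_norm]
      refine (hn _ ?_).le
      have h1 : dist (Function.update y i t) y ≤ 1 := by
        refine (dist_pi_le_iff zero_le_one).mpr fun k => ?_
        rcases eq_or_ne k i with rfl | hk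
        · rw [Function.update_self]; exact (Metric.mem_sphere.mp ht).le
        · rw [Function.update_of_ne hk, dist_self]; exact zero_le_one
      have h2 := dist_triangle (Function.update y i t) y x
      rw [Metric.mem_ball] at hy
      rw [Metric.mem_closedBall]
      linarith)
  linarith

lemma IsLimitOfStable.add_partialDeriv {F : (ι → ℂ) → ℂ} (hF : IsLimitOfStable F) {i j : ι}
    (hij : i ≠ j) {c : ℝ} (hc : 0 < c) :
    IsLimitOfStable fun x => F x + c * partialDeriv j (partialDeriv i F) x := by
  obtain ⟨f, hf, hlim⟩ := hF
  refine ⟨_, fun n => (hf n).add_pderiv_pderiv hij hc, ?_⟩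
  have h2 := TendstoLocallyUniformly.partialDeriv (TendstoLocallyUniformly.partialDeriv hlim i) j
  have h3 := (uniformContinuous_const_smul (c : ℂ)).comp_tendstoLocallyUniformly h2
  have h4 := hlim.add h3
  simpa using! h4

end Limits

section LaplaceTransform

open Filter Topology

variable {ι Ω : Type*} [Fintype ι] [DecidableEq ι] [MeasurableSpace Ω] {μ : Measure Ω}

lemma hasDerivAt_sum_update_mul (e x : ι → ℂ) (i : ι) (t : ℂ) :
    HasDerivAt (fun t => ∑ k, Function.update x i t k * e k) (e i) t := by
  have : ∀ t, ∑ k, Function.update x i t k * e k =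
      t * e i + ∑ k ∈ Finset.univ.erase i, x k * e k := by
    intro t
    rw [← Finset.add_sum_erase _ _ (Finset.mem_univ i), Function.update_self]
    congr 1
    refine Finset.sum_congr rfl fun k hk => ?_
    rw [Function.update_of_ne (Finset.ne_of_mem_erase hk)]
  simp_rw [this]
  simpa using! ((hasDerivAt_id t).mul_const (e i)).add_const
    (∑ k ∈ Finset.univ.erase i, x k * e k)

lemma norm_exp_sum_mul_le {ι : Type*} [Fintype ι] {e x : ι → ℂ} (he : ∀ i, ‖e i‖ ≤ 1) :
    ‖Complex.exp (∑ k, x k * e k)‖ ≤ Real.exp (∑ k, ‖x k‖) := by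
  rw [Complex.norm_exp]
  refine Real.exp_le_exp.mpr ((Complex.re_le_norm _).trans ((norm_sum_le _ _).trans ?_))
  refine Finset.sum_le_sum fun k _ => ?_
  rw [norm_mul]
  exact mul_le_of_le_one_right (norm_nonneg _) (he k)

lemma partialDeriv_integral_exp {e : ι → Ω → ℂ} (hem : ∀ i, Measurable (e i))
    (he : ∀ i ω, ‖e i ω‖ ≤ 1) {T : Ω → ℂ} (hT : Integrable T μ) (i : ι) :
    partialDeriv i (fun x => ∫ ω, Complex.exp (∑ k, x k * e k ω) * T ω ∂μ) =
      fun x => ∫ ω, Complex.exp (∑ k, x k * e k ω) * (e i ω * T ω) ∂μ := by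
  ext x
  have hmeas : ∀ y : ι → ℂ, AEStronglyMeasurable (fun ω => Complex.exp (∑ k, y k * e k ω)) μ := by
    intro y
    have : Measurable fun ω => Complex.exp (∑ k, y k * e k ω) :=
      (Finset.measurable_sum _ fun k _ => (hem k).const_mul (y k)).cexp
    exact this.aestronglyMeasurable
  have h := hasDerivAt_integral_of_dominated_loc_of_deriv_le (μ := μ) (x₀ := x i)
    (s := Metric.ball (x i) 1)
    (F := fun t ω => Complex.exp (∑ k, Function.update x i t k * e k ω) * T ω)
    (F' := fun t ω => Complex.exp (∑ k, Function.update x i t k * e k ω) * (e i ω * T ω))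
    (bound := fun ω => Real.exp (∑ k, (‖x k‖ + 1)) * ‖T ω‖)
    (Metric.ball_mem_nhds _ one_pos)
    (Eventually.of_forall fun t => (hmeas _).mul hT.aestronglyMeasurable)
    (hT.bdd_mul (hmeas _) (Eventually.of_forall fun ω => norm_exp_sum_mul_le (he · ω)))
    ((hmeas _).mul ((hem i).aestronglyMeasurable.mul hT.aestronglyMeasurable))
    (Eventually.of_forall fun ω t ht => by
      rw [norm_mul, norm_mul]
      refine mul_le_mul ((norm_exp_sum_mul_le (he · ω)).trans (Real.exp_le_exp.mpr ?_))
        (mul_le_of_le_one_left (norm_nonneg _) (he i ω)) (by positivity) (by positivity)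
      refine Finset.sum_le_sum fun k _ => ?_
      rcases eq_or_ne k i with rfl | hk
      · rw [Function.update_self]
        have h1 := norm_sub_norm_le t (x k)
        rw [mem_ball_iff_norm] at ht
        linarith
      · rw [Function.update_of_ne hk]; linarith)
    (hT.norm.const_mul _)
    (Eventually.of_forall fun ω t _ => by
      have := ((hasDerivAt_sum_update_mul (fun k => e k ω) x i t).cexp).mul_const (T ω)
      simpa [mul_assoc] using this)
  have := h.2.deriv
  rw [partialDeriv, this, Function.update_eq_self]

lemma IsLimitOfStable.integral_exp_mul_prod [IsFiniteMeasure μ] {e : ι → Ω → ℂ}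
    (hem : ∀ i, Measurable (e i)) (he : ∀ i ω, ‖e i ω‖ ≤ 1)
    (hbase : IsLimitOfStable fun x => ∫ ω, Complex.exp (∑ k, x k * e k ω) ∂μ)
    {κ : Type*} (s : Finset κ) {i j : κ → ι} (hij : ∀ l ∈ s, i l ≠ j l) {c : κ → ℝ}
    (hc : ∀ l ∈ s, 0 < c l) :
    IsLimitOfStable fun x => ∫ ω, Complex.exp (∑ k, x k * e k ω) *
      ∏ l ∈ s, (1 + c l * (e (i l) ω * e (j l) ω)) ∂μ := by
  classical
  have hbdd : ∀ {T : Ω → ℂ} (k : ι), Integrable T μ → Integrable (fun ω => e k ω * T ω) μ :=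
    fun k hT => hT.bdd_mul (hem k).aestronglyMeasurable (Eventually.of_forall (he k))
  have hexp : ∀ {T : Ω → ℂ} (x : ι → ℂ), Integrable T μ →
      Integrable (fun ω => Complex.exp (∑ k, x k * e k ω) * T ω) μ := by
    intro T x hT
    have : Measurable fun ω => Complex.exp (∑ k, x k * e k ω) :=
      (Finset.measurable_sum _ fun k _ => (hem k).const_mul (x k)).cexp
    exact hT.bdd_mul this.aestronglyMeasurable
      (Eventually.of_forall fun ω => norm_exp_sum_mul_le (he · ω))
  have hstep : ∀ {T : Ω → ℂ} (l : κ), (fun ω => (1 + c l * (e (i l) ω * e (j l) ω)) * T ω) =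
      fun ω => T ω + c l * (e (j l) ω * (e (i l) ω * T ω)) := by
    intro T l; ext ω; ring
  have hinteg : ∀ s : Finset κ,
      Integrable (fun ω => ∏ l ∈ s, (1 + c l * (e (i l) ω * e (j l) ω))) μ := by
    intro s
    induction s using Finset.induction_on with
    | empty => simp
    | insert l s hl ih =>
      simp_rw [Finset.prod_insert hl]
      rw [hstep]
      exact ih.add ((hbdd _ (hbdd _ ih)).const_mul _)
  induction s using Finset.induction_on with
  | empty => simpa using hbase
  | insert l s hl ih =>
    have ih' := (ih (fun k hk => hij k (Finset.mem_insert_of_mem hk))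
      (fun k hk => hc k (Finset.mem_insert_of_mem hk))).add_partialDeriv
      (hij l (Finset.mem_insert_self _ _)) (hc l (Finset.mem_insert_self _ _))
    convert! ih' using 2 with x
    rw [partialDeriv_integral_exp hem he (hinteg s),
      partialDeriv_integral_exp hem he (hbdd _ (hinteg s)),
      ← integral_const_mul, ← integral_add (hexp x (hinteg s))
        ((hexp x (hbdd _ (hbdd _ (hinteg s)))).const_mul _)]
    refine integral_congr_ae (Eventually.of_forall fun ω => ?_)
    dsimp only
    rw [Finset.prod_insert hl]
    ring

end LaplaceTransform

section BaseCase

open Filter Topology Nat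

/-- Continuous convergence implies locally uniform convergence. -/
lemma tendstoLocallyUniformly_of_tendsto_prod {α β : Type*} [TopologicalSpace α]
    [PseudoMetricSpace β] {F : ℕ → α → β} {G : α → β}
    (h : ∀ x, Tendsto (fun p : ℕ × α => F p.1 p.2) (atTop ×ˢ 𝓝 x) (𝓝 (G x))) :
    TendstoLocallyUniformly F G atTop := by
  rw [Metric.tendstoLocallyUniformly_iff]
  intro ε hε x
  have h1 := (Metric.tendsto_nhds.mp (h x) (ε / 3) (by positivity))
  rw [eventually_prod_iff] at h1
  obtain ⟨pa, hpa, pb, hpb, hp⟩ := h1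
  refine ⟨{y | pb y}, hpb, hpa.mono fun n hn y hy => ?_⟩
  have hy' : Tendsto (fun n => F n y) atTop (𝓝 (G y)) :=
    (h y).comp (tendsto_id.prodMk (tendsto_const_pure.mono_right (pure_le_nhds y)))
  have h2 : dist (G y) (G x) ≤ ε / 3 :=
    le_of_tendsto (hy'.dist tendsto_const_nhds) (hpa.mono fun m hm => (hp hm hy).le)
  have h3 := dist_triangle_right (G y) (F n y) (G x)
  have h4 := hp hn hy
  dsimp only at h4
  linarith

variable {V : Type*}

/-- The characters `e^{±iθ_v}` of the torus, indexed by `V ⊕ V`. -/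
noncomputable def torusCharacter (k : V ⊕ V) (θ : V → ℝ) : ℂ :=
  k.elim (fun v => Complex.exp (θ v * Complex.I)) fun v => Complex.exp (-(θ v * Complex.I))

lemma norm_torusCharacter (k : V ⊕ V) (θ : V → ℝ) : ‖torusCharacter k θ‖ = 1 := by
  rcases k with v | v
  · exact Complex.norm_exp_ofReal_mul_I _
  · have := Complex.norm_exp_ofReal_mul_I (-θ v)
    simpa [torusCharacter] using this

lemma continuous_torusCharacter (k : V ⊕ V) : Continuous (torusCharacter k) := by
  unfold torusCharacter
  rcases k with v | v <;> dsimp only [Sum.elim_inl, Sum.elim_inr] <;> fun_prop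

/-- The uniform measure on the torus `(-π, π]^V`. -/
noncomputable abbrev torusMeasure (V : Type*) [Fintype V] : Measure (V → ℝ) :=
  Measure.pi fun _ : V => volume.restrict (Set.Ioc (-π) π)

variable [Fintype V]

lemma integral_exp_sum_torusCharacter (x : V ⊕ V → ℂ) :
    ∫ θ, Complex.exp (∑ k, x k * torusCharacter k θ) ∂torusMeasure V =
      ∏ v, 2 * π * besselSeries (x (.inl v) * x (.inr v)) := by
  simp_rw [← integral_exp_add_conj]
  rw [← integral_fintype_prod_eq_prod (𝕜 := ℂ)
    (fun v (θ : ℝ) => Complex.exp (x (.inl v) * Complex.exp (θ * Complex.I) +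
      x (.inr v) * Complex.exp (-(θ * Complex.I))))]
  refine integral_congr_ae (Eventually.of_forall fun θ => ?_)
  simp only [Fintype.sum_sum_type, torusCharacter, Sum.elim_inl, Sum.elim_inr,
    ← Finset.sum_add_distrib, Complex.exp_sum]

/-- A Hurwitz stable polynomial approximation to `∏_v 2π I₀(2 √(x_v y_v))`. -/
noncomputable def besselApprox (V : Type*) [Fintype V] (n : ℕ) : MvPolynomial (V ⊕ V) ℂ :=
  ∏ v, MvPolynomial.C (2 * π : ℂ) * ∑ j ∈ Finset.range (n + 1),
    MvPolynomial.C (n.choose j / (j ! * n ^ j) : ℂ) *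
      (MvPolynomial.X (.inl v) * MvPolynomial.X (.inr v)) ^ j

lemma eval_besselApprox (n : ℕ) (x : V ⊕ V → ℂ) :
    MvPolynomial.eval x (besselApprox V n) = ∏ v, 2 * π * ∑ j ∈ Finset.range (n + 1),
      (n.choose j / (j ! * n ^ j) : ℂ) * (x (.inl v) * x (.inr v)) ^ j := by
  simp [besselApprox]

lemma hurwitzStable_besselApprox {n : ℕ} (hn : n ≠ 0) : HurwitzStable (besselApprox V n) := by
  intro x hx
  rw [eval_besselApprox]
  refine Finset.prod_ne_zero_iff.mpr fun v _ => mul_ne_zero (by simp [pi_ne_zero]) ?_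
  have hn' : (0 : ℝ) < n := by exact_mod_cast Nat.pos_of_ne_zero hn
  have h := laguerre_sum_ne_zero n (u := x (.inl v) / n) (w := x (.inr v))
    (by rw [Complex.div_natCast_re]; exact div_pos (hx _) hn') (hx _)
  convert h using 2 with j
  rw [div_mul_eq_mul_div (x (.inl v)), div_pow]
  ring

lemma tendsto_eval_besselApprox (x : V ⊕ V → ℂ) :
    Tendsto (fun p : ℕ × (V ⊕ V → ℂ) => MvPolynomial.eval p.2 (besselApprox V p.1))
      (atTop ×ˢ 𝓝 x) (𝓝 (∏ v, 2 * π * besselSeries (x (.inl v) * x (.inr v)))) := by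
  have h (v : V) : Tendsto (fun p : ℕ × (V ⊕ V → ℂ) => 2 * (π : ℂ) *
      ∑ j ∈ Finset.range (p.1 + 1),
        (p.1.choose j / (j ! * p.1 ^ j) : ℂ) * (p.2 (.inl v) * p.2 (.inr v)) ^ j)
      (atTop ×ˢ 𝓝 x) (𝓝 (2 * π * besselSeries (x (.inl v) * x (.inr v)))) := by
    have hc : Continuous fun y : V ⊕ V → ℂ => y (.inl v) * y (.inr v) := by fun_prop
    have h1 : Tendsto (fun p : ℕ × (V ⊕ V → ℂ) => (p.1, p.2 (.inl v) * p.2 (.inr v)))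
        (atTop ×ˢ 𝓝 x) (atTop ×ˢ 𝓝 (x (.inl v) * x (.inr v))) :=
      tendsto_id.prodMap (hc.tendsto x)
    exact ((tendsto_laguerre_sum (x (.inl v) * x (.inr v))).comp h1).const_mul (2 * (π : ℂ))
  simp only [eval_besselApprox]
  exact tendsto_finsetProd _ fun v _ => h v

lemma isLimitOfStable_integral_exp (V : Type*) [Fintype V] :
    IsLimitOfStable fun x : V ⊕ V → ℂ =>
      ∫ θ, Complex.exp (∑ k, x k * torusCharacter k θ) ∂torusMeasure V := by
  simp_rw [integral_exp_sum_torusCharacter]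
  refine ⟨fun n => besselApprox V (n + 1), fun n => hurwitzStable_besselApprox n.succ_ne_zero, ?_⟩
  have h := fun x : V ⊕ V → ℂ => (tendsto_eval_besselApprox x).comp
    ((tendsto_add_atTop_nat 1).prodMap tendsto_id)
  exact tendstoLocallyUniformly_of_tendsto_prod h

end BaseCase

section JacobiTripleProduct

open Filter Topology

/-- The `q`-Pochhammer symbol `(q; q)_n = ∏_{i=1}^n (1 - q^i)`. -/
noncomputable def qPochhammer {K : Type*} [Field K] (q : K) (n : ℕ) : K :=
  ∏ i ∈ Finset.range n, (1 - q ^ (i + 1))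

/-- The `q`-binomial theorem. -/
lemma prod_one_add_mul_pow {K : Type*} [Field K] {q : K} (hq : ∀ i : ℕ, 1 - q ^ (i + 1) ≠ 0)
    (x : K) (n : ℕ) :
    ∏ i ∈ Finset.range n, (1 + x * q ^ i) = ∑ p ∈ Finset.HasAntidiagonal.antidiagonal n,
      qPochhammer q n / (qPochhammer q p.1 * qPochhammer q p.2) * q ^ (p.1.choose 2) * x ^ p.1 := by
  have hne : ∀ n, qPochhammer q n ≠ 0 := fun n => Finset.prod_ne_zero_iff.mpr fun i _ => hq i
  have hsucc : ∀ n, qPochhammer q (n + 1) = qPochhammer q n * (1 - q ^ (n + 1)) := fun n =>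
    Finset.prod_range_succ _ _
  induction n with
  | zero => simp [qPochhammer]
  | succ n ih =>
    set t : ℕ × ℕ → K := fun p =>
      qPochhammer q n / (qPochhammer q p.1 * qPochhammer q p.2) * q ^ (p.1.choose 2) * x ^ p.1
    have hsplit : ∀ p ∈ Finset.HasAntidiagonal.antidiagonal (n + 1),
        qPochhammer q (n + 1) / (qPochhammer q p.1 * qPochhammer q p.2) * q ^ (p.1.choose 2) *
          x ^ p.1 = t p * (1 - q ^ p.2) + t p * (q ^ p.2 * (1 - q ^ p.1)) := by
      intro p hp
      rw [Finset.HasAntidiagonal.mem_antidiagonal] at hp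
      rw [hsucc, ← hp, pow_add]
      simp only [t]
      ring
    rw [Finset.prod_range_succ, ih, Finset.sum_congr rfl hsplit, Finset.sum_add_distrib,
      Finset.Nat.sum_antidiagonal_succ', Finset.Nat.sum_antidiagonal_succ]
    simp only [pow_zero, sub_self, mul_zero, zero_add]
    rw [← Finset.sum_add_distrib, Finset.sum_mul]
    refine Finset.sum_congr rfl fun p hp => ?_
    rw [Finset.HasAntidiagonal.mem_antidiagonal] at hp
    have h1 := hne p.1
    have h2 := hne p.2
    have h3 := hq p.1
    have h4 := hq p.2
    simp only [t, hsucc, Nat.choose_succ_succ' p.1 1, Nat.choose_one_right, ← hp]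
    field_simp
    ring

/-- The finite form of the Jacobi triple product identity. -/
lemma prod_one_add_mul_one_add_inv {K : Type*} [Field K] {q w : K} (hq0 : q ≠ 0) (hw : w ≠ 0)
    (hq : ∀ i : ℕ, 1 - (q ^ 2) ^ (i + 1) ≠ 0) (N : ℕ) :
    ∏ k ∈ Finset.range N, ((1 + q ^ (2 * k + 1) * w) * (1 + q ^ (2 * k + 1) * w⁻¹)) =
      ∑ p ∈ Finset.HasAntidiagonal.antidiagonal (2 * N), qPochhammer (q ^ 2) (2 * N) /
        (qPochhammer (q ^ 2) p.1 * qPochhammer (q ^ 2) p.2) * q ^ (((p.1 : ℤ) - N) ^ 2) *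
          w ^ ((p.1 : ℤ) - N) := by
  have hodd : ∀ N : ℕ, ∏ k ∈ Finset.range N, (w * (q ^ (2 * k + 1))⁻¹) = w ^ N * (q ^ N ^ 2)⁻¹ := by
    intro N
    induction N with
    | zero => simp
    | succ N ih =>
      rw [Finset.prod_range_succ, ih]
      have : (N + 1) ^ 2 = N ^ 2 + (2 * N + 1) := by ring
      rw [this, pow_add q, mul_inv]
      ring
  have h := prod_one_add_mul_pow hq (w * q * (q ^ (2 * N))⁻¹) (2 * N)
  rw [two_mul N, Finset.prod_range_add, ← two_mul N, ← Finset.prod_range_reflect] at h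
  have h1 : ∀ k ∈ Finset.range N, 1 + w * q * (q ^ (2 * N))⁻¹ * (q ^ 2) ^ (N - 1 - k) =
      w * (q ^ (2 * k + 1))⁻¹ * (1 + q ^ (2 * k + 1) * w⁻¹) := by
    intro k hk
    rw [Finset.mem_range] at hk
    obtain ⟨m, rfl⟩ : ∃ m, N = m + k + 1 := ⟨N - k - 1, by omega⟩
    have : m + k + 1 - 1 - k = m := by omega
    rw [this, ← pow_mul, show 2 * (m + k + 1) = 2 * m + (2 * k + 1) + 1 by ring]
    simp only [pow_succ, pow_add]
    field_simp
    ring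
  have h2 : ∀ k ∈ Finset.range N, 1 + w * q * (q ^ (2 * N))⁻¹ * (q ^ 2) ^ (N + k) =
      1 + q ^ (2 * k + 1) * w := by
    intro k _
    rw [← pow_mul, mul_add, pow_add, pow_succ]
    field_simp
  rw [Finset.prod_congr rfl h1, Finset.prod_congr rfl h2, Finset.prod_mul_distrib, hodd] at h
  rw [Finset.prod_mul_distrib]
  have h3 : (w ^ N * (q ^ N ^ 2)⁻¹) ≠ 0 := by positivity
  rw [← mul_right_inj' h3, ← mul_assoc, mul_right_comm, h, Finset.mul_sum]
  refine Finset.sum_congr rfl fun p _ => ?_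
  have h4 : 2 * p.1.choose 2 + p.1 = p.1 ^ 2 := by
    generalize p.1 = a
    induction a with
    | zero => simp
    | succ a ih => rw [Nat.choose_succ_succ' a 1, Nat.choose_one_right]; linarith
  have h5 : (q ^ 2) ^ (p.1.choose 2) * (w * q * (q ^ (2 * N))⁻¹) ^ p.1 =
      w ^ N * (q ^ N ^ 2)⁻¹ * (q ^ (((p.1 : ℤ) - N) ^ 2) * w ^ ((p.1 : ℤ) - N)) := by
    have e1 : ((p.1 : ℤ) - N) ^ 2 =
        ((p.1 ^ 2 : ℕ) : ℤ) - ((2 * N * p.1 : ℕ) : ℤ) + ((N ^ 2 : ℕ) : ℤ) := by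
      push_cast; ring
    rw [e1, zpow_add₀ hq0, zpow_sub₀ hq0, zpow_sub₀ hw]
    simp only [zpow_natCast]
    rw [← h4, pow_add q, pow_mul q 2, pow_mul q (2 * N), mul_pow,
      mul_pow, inv_pow]
    field_simp
    ring
  rw [mul_assoc, h5]
  ring

lemma qPochhammer_pos {q : ℝ} (hq0 : 0 < q) (hq1 : q < 1) (n : ℕ) : 0 < qPochhammer q n :=
  Finset.prod_pos fun i _ => sub_pos.mpr (pow_lt_one₀ hq0.le hq1 i.succ_ne_zero)

lemma exists_tendsto_qPochhammer {q : ℝ} (hq0 : 0 < q) (hq1 : q < 1) :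
    ∃ L : ℝ, 0 < L ∧ (∀ n, L ≤ qPochhammer q n) ∧ Tendsto (qPochhammer q) atTop (𝓝 L) := by
  have hs : Summable fun i : ℕ => ‖-q ^ (i + 1)‖ := by
    simp_rw [norm_neg, norm_pow, norm_of_nonneg hq0.le]
    exact (summable_nat_add_iff 1).mpr (summable_geometric_of_lt_one hq0.le hq1)
  have hlim : Tendsto (qPochhammer q) atTop (𝓝 (∏' i : ℕ, (1 + -q ^ (i + 1)))) := by
    have h := (multipliable_one_add_of_summable hs).tendsto_prod_tprod_nat
    simpa only [← sub_eq_add_neg] using! h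
  have hne : ∏' i : ℕ, (1 + -q ^ (i + 1)) ≠ 0 := by
    refine tprod_one_add_ne_zero_of_summable (fun i => ?_) hs
    have : q ^ (i + 1) < 1 := pow_lt_one₀ hq0.le hq1 i.succ_ne_zero
    linarith
  have hanti : Antitone (qPochhammer q) := antitone_nat_of_succ_le fun n => by
    rw [qPochhammer, Finset.prod_range_succ]
    exact mul_le_of_le_one_right (qPochhammer_pos hq0 hq1 n).le
      (sub_le_self _ (pow_nonneg hq0.le _))
  refine ⟨_, lt_of_le_of_ne ?_ hne.symm, fun n => hanti.le_of_tendsto hlim n, hlim⟩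
  exact ge_of_tendsto' hlim fun n => (qPochhammer_pos hq0 hq1 n).le

lemma qPochhammer_le_one {q : ℝ} (hq0 : 0 < q) (hq1 : q < 1) (n : ℕ) : qPochhammer q n ≤ 1 :=
  Finset.prod_le_one (fun _ _ => sub_nonneg.mpr (pow_le_one₀ hq0.le hq1.le))
    fun _ _ => sub_le_self _ (pow_nonneg hq0.le _)

/-- The normalised coefficients of the finite Jacobi triple product. -/
noncomputable def jacobiCoeff (q : ℝ) (N : ℕ) (j : ℤ) : ℝ :=
  if j.natAbs ≤ N then qPochhammer q N ^ 2 /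
    (qPochhammer q (N + j).toNat * qPochhammer q (N - j).toNat) else 0

lemma prod_eq_tsum_jacobiCoeff {q : ℝ} (hq0 : 0 < q) (hq1 : q < 1) {w : ℂ} (hw : w ≠ 0) (N : ℕ) :
    ((qPochhammer (q ^ 2) N ^ 2 / qPochhammer (q ^ 2) (2 * N) : ℝ) : ℂ) *
      ∏ k ∈ Finset.range N, ((1 + q ^ (2 * k + 1) * w) * (1 + q ^ (2 * k + 1) * w⁻¹)) =
      ∑' j : ℤ, (jacobiCoeff (q ^ 2) N j : ℂ) * (q ^ (j ^ 2) * w ^ j) := by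
  have hcast : ∀ n, qPochhammer ((q : ℂ) ^ 2) n = (qPochhammer (q ^ 2) n : ℝ) := fun n => by
    simp [qPochhammer]
  have hpos := qPochhammer_pos (pow_pos hq0 2) (pow_lt_one₀ hq0.le hq1 two_ne_zero)
  rw [prod_one_add_mul_one_add_inv (by exact_mod_cast hq0.ne') hw, Finset.mul_sum,
    tsum_eq_sum (s := Finset.Icc (-N : ℤ) N)]
  · refine Finset.sum_bij' (fun p _ => (p.1 : ℤ) - N) (fun j _ => ((N + j).toNat, (N - j).toNat))
      ?_ ?_ ?_ ?_ ?_
    · intro p hp; rw [Finset.HasAntidiagonal.mem_antidiagonal] at hp; rw [Finset.mem_Icc]; omega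
    · intro j hj; rw [Finset.mem_Icc] at hj; rw [Finset.HasAntidiagonal.mem_antidiagonal]; omega
    · intro p hp; rw [Finset.HasAntidiagonal.mem_antidiagonal] at hp; ext <;> dsimp only <;> omega
    · intro j hj; rw [Finset.mem_Icc] at hj; dsimp only; omega
    · intro p hp
      rw [Finset.HasAntidiagonal.mem_antidiagonal] at hp
      have h1 : ((p.1 : ℤ) - N).natAbs ≤ N := by omega
      have h2 : ((N : ℤ) + (p.1 - N)).toNat = p.1 := by omega
      have h3 : ((N : ℤ) - (p.1 - N)).toNat = p.2 := by omega
      rw [jacobiCoeff, if_pos h1, h2, h3, hcast, hcast, hcast]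
      have h4 : ((qPochhammer (q ^ 2) (2 * N) : ℝ) : ℂ) ≠ 0 :=
        Complex.ofReal_ne_zero.mpr (hpos _).ne'
      push_cast
      field_simp
  · intro j hj
    rw [Finset.mem_Icc] at hj
    rw [jacobiCoeff, if_neg (by omega)]
    simp
  · intro i
    have := pow_lt_one₀ (sq_nonneg q) (pow_lt_one₀ hq0.le hq1 two_ne_zero) i.succ_ne_zero
    exact_mod_cast (sub_pos.mpr this).ne'

lemma exists_jacobiCoeff_le {q : ℝ} (hq0 : 0 < q) (hq1 : q < 1) :
    ∃ M : ℝ, ∀ N j, |jacobiCoeff q N j| ≤ M := by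
  obtain ⟨L, hL, hLle, -⟩ := exists_tendsto_qPochhammer hq0 hq1
  refine ⟨1 / (L * L), fun N j => ?_⟩
  have hpos := qPochhammer_pos hq0 hq1
  rw [jacobiCoeff]
  split_ifs
  · rw [abs_of_nonneg (div_nonneg (sq_nonneg _) (mul_pos (hpos _) (hpos _)).le)]
    exact div_le_div₀ zero_le_one (pow_le_one₀ (hpos _).le (qPochhammer_le_one hq0 hq1 _))
      (mul_pos hL hL) (mul_le_mul (hLle _) (hLle _) hL.le (hpos _).le)
  · rw [abs_zero]; positivity

lemma tendsto_jacobiCoeff {q : ℝ} (hq0 : 0 < q) (hq1 : q < 1) (j : ℤ) :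
    Tendsto (fun N => jacobiCoeff q N j) atTop (𝓝 1) := by
  obtain ⟨L, hL, -, hlim⟩ := exists_tendsto_qPochhammer hq0 hq1
  have h1 : Tendsto (fun N : ℕ => ((N : ℤ) + j).toNat) atTop atTop :=
    tendsto_atTop.mpr fun b => (eventually_ge_atTop (b + j.natAbs)).mono fun N hN => by omega
  have h2 : Tendsto (fun N : ℕ => ((N : ℤ) - j).toNat) atTop atTop :=
    tendsto_atTop.mpr fun b => (eventually_ge_atTop (b + j.natAbs)).mono fun N hN => by omega
  have h := (hlim.pow 2).div ((hlim.comp h1).mul (hlim.comp h2)) (mul_pos hL hL).ne'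
  rw [sq, div_self (mul_pos hL hL).ne'] at h
  refine h.congr' ((eventually_ge_atTop j.natAbs).mono fun N hN => ?_)
  change _ = jacobiCoeff q N j
  rw [jacobiCoeff, if_pos hN]
  rfl

/-- The **Jacobi triple product**, with uniformly bounded partial products. -/
lemma tendsto_prod_jacobi {q : ℝ} (hq0 : 0 < q) (hq1 : q < 1)
    (hsum : Summable fun j : ℤ => q ^ (j ^ 2)) :
    ∃ (κ : ℕ → ℝ) (M : ℝ), (∀ N, 0 < κ N) ∧ ∀ w : ℂ, ‖w‖ = 1 →
      (∀ N, ‖κ N * ∏ k ∈ Finset.range N,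
        ((1 + q ^ (2 * k + 1) * w) * (1 + q ^ (2 * k + 1) * w⁻¹))‖ ≤ M) ∧
      Tendsto (fun N => κ N * ∏ k ∈ Finset.range N,
        ((1 + q ^ (2 * k + 1) * w) * (1 + q ^ (2 * k + 1) * w⁻¹))) atTop
        (𝓝 (∑' j : ℤ, (q : ℂ) ^ (j ^ 2) * w ^ j)) := by
  have hQ0 : 0 < q ^ 2 := pow_pos hq0 2
  have hQ1 : q ^ 2 < 1 := pow_lt_one₀ hq0.le hq1 two_ne_zero
  obtain ⟨M, hM⟩ := exists_jacobiCoeff_le hQ0 hQ1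
  have hpos := qPochhammer_pos hQ0 hQ1
  refine ⟨fun N => qPochhammer (q ^ 2) N ^ 2 / qPochhammer (q ^ 2) (2 * N),
    ∑' j : ℤ, M * q ^ (j ^ 2), fun N => div_pos (pow_pos (hpos _) 2) (hpos _), fun w hw => ?_⟩
  have hw0 : w ≠ 0 := norm_ne_zero_iff.mp (by rw [hw]; exact one_ne_zero)
  have hnorm : ∀ (N : ℕ) (j : ℤ),
      ‖(jacobiCoeff (q ^ 2) N j : ℂ) * (q ^ (j ^ 2) * w ^ j)‖ ≤ M * q ^ (j ^ 2) := by
    intro N j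
    rw [norm_mul, norm_mul, norm_zpow, norm_zpow, hw, one_zpow, mul_one, Complex.norm_real,
      Complex.norm_real, norm_of_nonneg hq0.le]
    exact mul_le_mul_of_nonneg_right (hM N j) (zpow_nonneg hq0.le _)
  simp only [prod_eq_tsum_jacobiCoeff hq0 hq1 hw0]
  refine ⟨fun N => tsum_of_norm_bounded (hsum.mul_left M).hasSum (hnorm N),
    tendsto_tsum_of_dominated_convergence (hsum.mul_left M) (fun j => ?_)
      (Eventually.of_forall hnorm)⟩
  have h := ((Complex.continuous_ofReal.tendsto _).comp (tendsto_jacobiCoeff hQ0 hQ1 j)).mul_const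
    ((q : ℂ) ^ (j ^ 2) * w ^ j)
  rwa [Complex.ofReal_one, one_mul] at h

end JacobiTripleProduct

section VillainWeight

open Filter Topology

lemma summable_villainWeight {J : ℝ} (hJ : 0 < J) (x : ℝ) :
    Summable fun m : ℤ => Real.exp (-(J / 2) * (x + 2 * π * m) ^ 2) := by
  have hT : 0 < 2 * π * J := by positivity
  have h := summable_pow_mul_jacobiTheta₂_term_bound (J * |x|) hT 0
  refine Summable.of_nonneg_of_le (fun _ => (exp_pos _).le) (fun m => ?_) h
  rw [pow_zero, one_mul]
  refine Real.exp_le_exp.mpr ?_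
  have h1 : -(x * m) ≤ |x| * |(m : ℝ)| := by rw [← abs_mul]; exact neg_le_abs _
  have h2 : 0 ≤ J * x ^ 2 := by positivity
  have h3 := mul_le_mul_of_nonneg_left h1 hT.le
  push_cast
  nlinarith

lemma villainWeight_pos {J : ℝ} (hJ : 0 < J) (x : ℝ) : 0 < villainWeight J x :=
  (summable_villainWeight hJ x).tsum_pos (fun _ => (exp_pos _).le) 0 (exp_pos _)

lemma summable_exp_zpow_sq {J : ℝ} (hJ : 0 < J) :
    Summable fun j : ℤ => Real.exp (-(1 / (2 * J))) ^ (j ^ 2) := by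
  have hT : 0 < 1 / (2 * π * J) := by positivity
  refine (summable_pow_mul_jacobiTheta₂_term_bound 0 hT 0).congr fun j => ?_
  rw [pow_zero, one_mul, ← Real.rpow_intCast, ← Real.exp_mul]
  congr 1
  push_cast
  field_simp
  ring

/-- The Fourier expansion of the Villain weight, by Poisson summation. -/
lemma exists_tsum_eq_mul_villainWeight {J : ℝ} (hJ : 0 < J) :
    ∃ A : ℝ, 0 < A ∧ ∀ x : ℝ,
      ∑' j : ℤ, (Real.exp (-(1 / (2 * J))) : ℂ) ^ (j ^ 2) * Complex.exp (x * Complex.I) ^ j =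
        A * villainWeight J x := by
  set a : ℝ := 1 / (2 * π * J) with ha
  have ha0 : 0 < a := by positivity
  have hJ' : (J : ℂ) ≠ 0 := by exact_mod_cast hJ.ne'
  have hπ : (π : ℂ) ≠ 0 := by exact_mod_cast pi_ne_zero
  refine ⟨1 / a ^ (1 / 2 : ℝ), by positivity, fun x => ?_⟩
  have h := Complex.tsum_exp_neg_quadratic (a := a) (by simpa using ha0) (x * Complex.I / (2 * π))
  have hl (n : ℤ) : (Real.exp (-(1 / (2 * J))) : ℂ) ^ (n ^ 2) * Complex.exp (x * Complex.I) ^ n =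
      Complex.exp (-π * a * n ^ 2 + 2 * π * (x * Complex.I / (2 * π)) * n) := by
    rw [Complex.ofReal_exp, ← Complex.exp_int_mul, ← Complex.exp_int_mul, ← Complex.exp_add, ha]
    congr 1
    push_cast
    field_simp
  have hr (n : ℤ) : Complex.exp (-π / a * (n + Complex.I * (x * Complex.I / (2 * π))) ^ 2) =
      (Real.exp (-(J / 2) * (-x + 2 * π * n) ^ 2) : ℝ) := by
    rw [Complex.ofReal_exp, ha]
    congr 1
    have : (n : ℂ) + Complex.I * (x * Complex.I / (2 * π)) = n - x / (2 * π) := by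
      linear_combination (x / (2 * π) : ℂ) * Complex.I_sq
    rw [this]
    push_cast
    field_simp
    ring
  simp_rw [hl, h, hr]
  rw [← Complex.ofReal_tsum, ← villainWeight_neg, villainWeight]
  congr 1
  rw [Complex.ofReal_div 1 (a ^ (1 / 2 : ℝ)), Complex.ofReal_cpow ha0.le]
  push_cast
  rfl

/-- The Villain weight is a bounded limit of products `κ ∏_k (1 + c_k e^{ix}) (1 + c_k e^{-ix})`. -/
lemma exists_tendsto_villainWeight {J : ℝ} (hJ : 0 < J) :
    ∃ (c : ℕ → ℝ) (κ : ℕ → ℝ) (M : ℝ), (∀ k, 0 < c k) ∧ (∀ k, c k < 1) ∧ (∀ N, 0 < κ N) ∧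
      ∀ x : ℝ,
      (∀ N, ‖κ N * ∏ k ∈ Finset.range N, ((1 + c k * Complex.exp (x * Complex.I)) *
        (1 + c k * Complex.exp (-(x * Complex.I))))‖ ≤ M) ∧
      Tendsto (fun N => κ N * ∏ k ∈ Finset.range N, ((1 + c k * Complex.exp (x * Complex.I)) *
        (1 + c k * Complex.exp (-(x * Complex.I))))) atTop (𝓝 (villainWeight J x : ℂ)) := by
  set q := Real.exp (-(1 / (2 * J))) with hq
  have hq0 : 0 < q := exp_pos _
  have hq1 : q < 1 := Real.exp_lt_one_iff.mpr (by rw [neg_lt_zero]; positivity)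
  obtain ⟨A, hA, hfour⟩ := exists_tsum_eq_mul_villainWeight hJ
  obtain ⟨κ, M, hκ, h⟩ := tendsto_prod_jacobi hq0 hq1 (summable_exp_zpow_sq hJ)
  refine ⟨fun k => q ^ (2 * k + 1), fun N => A⁻¹ * κ N, A⁻¹ * M, fun k => pow_pos hq0 _,
    fun k => pow_lt_one₀ hq0.le hq1 (Nat.succ_ne_zero _), fun N => mul_pos (inv_pos.mpr hA) (hκ N),
    fun x => ?_⟩
  obtain ⟨hb, hl⟩ := h (Complex.exp (x * Complex.I)) (Complex.norm_exp_ofReal_mul_I x)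
  rw [hfour, ← Complex.exp_neg] at hl
  rw [← Complex.exp_neg] at hb
  have hA' : (A : ℂ) ≠ 0 := by exact_mod_cast hA.ne'
  push_cast
  simp only [mul_assoc (A : ℂ)⁻¹]
  refine ⟨fun N => ?_, ?_⟩
  · rw [norm_mul, norm_inv, Complex.norm_real, norm_of_nonneg hA.le]
    exact mul_le_mul_of_nonneg_left (hb N) (inv_pos.mpr hA).le
  · simpa [hA'] using hl.const_mul (A : ℂ)⁻¹

lemma one_add_mul_exp_mul_one_add_mul_exp_neg (c x : ℝ) :
    (1 + c * Complex.exp (x * Complex.I)) * (1 + c * Complex.exp (-(x * Complex.I))) =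
      ((1 + 2 * c * Real.cos x + c ^ 2 : ℝ) : ℂ) := by
  have h1 : Complex.exp (x * Complex.I) * Complex.exp (-(x * Complex.I)) = 1 := by
    rw [← Complex.exp_add]; simp
  have h2 := Complex.two_cos (x : ℂ)
  push_cast
  rw [neg_mul] at h2
  linear_combination (c : ℂ) ^ 2 * h1 - (c : ℂ) * h2

end VillainWeight

section Assembly

open Filter Topology

variable {V : Type*}

variable {κ : Type*} (s : Finset κ) (a b : κ → V) (c : κ → ℝ)

/-- A ferromagnetic weight given by a finite product of factors `|1 + c e^{i(θ_a - θ_b)}|²`. -/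
noncomputable def productWeight (θ : V → ℝ) : ℂ :=
  ∏ l ∈ s, ((1 + c l * Complex.exp ((θ (a l) - θ (b l) : ℝ) * Complex.I)) *
    (1 + c l * Complex.exp (-((θ (a l) - θ (b l) : ℝ) * Complex.I))))

lemma continuous_productWeight : Continuous (productWeight s a b c) := by
  unfold productWeight
  fun_prop

variable {s a b c}

variable [Fintype V]

/-- The transform `z ↦ ∫ exp(∑_v z_v cos θ_v) T(θ) dθ` of a weight `T` on the torus. -/
noncomputable def cosTransform (T : (V → ℝ) → ℂ) (z : V → ℂ) : ℂ :=
  ∫ θ, Complex.exp (∑ v, z v * (Real.cos (θ v) : ℂ)) * T θ ∂torusMeasure V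

lemma norm_exp_sum_mul_cos_le (z : V → ℂ) (θ : V → ℝ) :
    ‖Complex.exp (∑ v, z v * (Real.cos (θ v) : ℂ))‖ ≤ Real.exp (∑ v, ‖z v‖) :=
  norm_exp_sum_mul_le fun v => by
    rw [Complex.norm_real]; exact abs_cos_le_one _

lemma cosTransform_ofReal_ne_zero {t : (V → ℝ) → ℝ} (ht : ∀ θ, 0 < t θ)
    (hti : Integrable t (torusMeasure V)) (x : V → ℝ) :
    cosTransform (fun θ => (t θ : ℂ)) (fun v => (x v : ℂ)) ≠ 0 := by
  set g : (V → ℝ) → ℝ := fun θ => Real.exp (∑ v, x v * Real.cos (θ v)) * t θ with hg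
  have hpos : ∀ θ, 0 < g θ := fun θ => mul_pos (exp_pos _) (ht θ)
  have hgi : Integrable g (torusMeasure V) := by
    refine hti.bdd_mul (c := Real.exp (∑ v, ‖(x v : ℂ)‖)) ?_ (Eventually.of_forall fun θ => ?_)
    · exact Continuous.aestronglyMeasurable (by fun_prop)
    · have := norm_exp_sum_mul_cos_le (fun v => (x v : ℂ)) θ
      rw [← Complex.norm_real]
      exact_mod_cast this
  have hinteg : 0 < ∫ θ, g θ ∂torusMeasure V := by
    rw [integral_pos_iff_support_of_nonneg (fun θ => (hpos θ).le) hgi,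
      Set.eq_univ_of_forall (s := Function.support g) fun θ => (hpos θ).ne', Measure.pi_univ]
    simp only [Measure.restrict_apply_univ, volume_Ioc]
    exact pos_iff_ne_zero.mpr (Finset.prod_ne_zero_iff.mpr fun _ _ =>
      (ENNReal.ofReal_pos.mpr (by linarith [pi_pos])).ne')
  have h : cosTransform (fun θ => (t θ : ℂ)) (fun v => (x v : ℂ)) =
      ((∫ θ, g θ ∂torusMeasure V : ℝ) : ℂ) := by
    rw [← integral_complex_ofReal, cosTransform]
    refine integral_congr_ae (Eventually.of_forall fun θ => ?_)
    simp [hg]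
  rw [h]
  exact_mod_cast hinteg.ne'

lemma cosTransform_const_mul (A : ℂ) (T : (V → ℝ) → ℂ) (z : V → ℂ) :
    cosTransform (fun θ => A * T θ) z = A * cosTransform T z := by
  simp_rw [cosTransform, mul_left_comm _ A]
  exact integral_const_mul _ _

lemma tendsto_cosTransform {T : ℕ → (V → ℝ) → ℂ} {T' : (V → ℝ) → ℂ} {M : ℝ}
    (hT : ∀ n, Continuous (T n)) (hM : ∀ n θ, ‖T n θ‖ ≤ M)
    (hlim : ∀ θ, Tendsto (fun n => T n θ) atTop (𝓝 (T' θ))) (z : V → ℂ) :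
    Tendsto (fun p : ℕ × (V → ℂ) => cosTransform (T p.1) p.2) (atTop ×ˢ 𝓝 z)
      (𝓝 (cosTransform T' z)) := by
  refine tendsto_integral_filter_of_dominated_convergence
    (fun _ => Real.exp (∑ v, (‖z v‖ + 1)) * M) (Eventually.of_forall fun p => ?_) ?_
    (integrable_const _) (Eventually.of_forall fun θ => ?_)
  · have := hT p.1
    exact Continuous.aestronglyMeasurable (by fun_prop)
  · have hz : ∀ᶠ p : ℕ × (V → ℂ) in atTop ×ˢ 𝓝 z, p.2 ∈ Metric.ball z 1 :=
      tendsto_snd.eventually (Metric.ball_mem_nhds z one_pos)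
    refine hz.mono fun p hp => Eventually.of_forall fun θ => ?_
    rw [norm_mul]
    refine mul_le_mul ((norm_exp_sum_mul_cos_le _ _).trans (Real.exp_le_exp.mpr ?_)) (hM _ _)
      (norm_nonneg _) (exp_pos _).le
    refine Finset.sum_le_sum fun v _ => ?_
    have h1 := norm_sub_norm_le (p.2 v) (z v)
    have h2 := (dist_le_pi_dist p.2 z v).trans (Metric.mem_ball.mp hp).le
    rw [dist_eq_norm] at h2
    linarith
  · have hc : Continuous fun y : V → ℂ => Complex.exp (∑ v, y v * (Real.cos (θ v) : ℂ)) := by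
      fun_prop
    exact ((hc.tendsto z).comp tendsto_snd).mul ((hlim θ).comp tendsto_fst)

lemma exists_productWeight_eq_ofReal (hc0 : ∀ l ∈ s, 0 < c l) (hc1 : ∀ l ∈ s, c l < 1) :
    ∃ t : (V → ℝ) → ℝ, (∀ θ, 0 < t θ) ∧ Integrable t (torusMeasure V) ∧
      productWeight s a b c = fun θ => (t θ : ℂ) := by
  have hpos : ∀ θ : V → ℝ, ∀ l ∈ s,
      0 < 1 + 2 * c l * Real.cos (θ (a l) - θ (b l)) + c l ^ 2 := by
    intro θ l hl
    have h1 := mul_nonneg (hc0 l hl).le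
      (neg_le_iff_add_nonneg'.mp (neg_one_le_cos (θ (a l) - θ (b l))))
    have h2 := pow_pos (sub_pos.mpr (hc1 l hl)) 2
    nlinarith
  refine ⟨fun θ => ∏ l ∈ s, (1 + 2 * c l * Real.cos (θ (a l) - θ (b l)) + c l ^ 2),
    fun θ => Finset.prod_pos fun l hl => hpos θ l hl, ?_, ?_⟩
  · refine Integrable.of_bound (Continuous.aestronglyMeasurable (by fun_prop))
      (∏ l ∈ s, (1 + c l) ^ 2) (Eventually.of_forall fun θ => ?_)
    rw [norm_of_nonneg (Finset.prod_nonneg fun l hl => (hpos θ l hl).le)]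
    refine Finset.prod_le_prod (fun l hl => (hpos θ l hl).le) fun l hl => ?_
    have h1 := mul_le_mul_of_nonneg_left (cos_le_one (θ (a l) - θ (b l))) (hc0 l hl).le
    nlinarith
  · ext θ
    simp_rw [productWeight, one_add_mul_exp_mul_one_add_mul_exp_neg, Complex.ofReal_prod]

lemma cosTransform_productWeight_eq (z : V → ℂ) :
    cosTransform (productWeight s a b c) z =
      ∫ θ, Complex.exp (∑ k, Sum.elim (fun v => z v / 2) (fun v => z v / 2) k *
        torusCharacter k θ) * ∏ l ∈ s ×ˢ (Finset.univ : Finset Bool), (1 + c l.1 *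
          (torusCharacter (bif l.2 then .inl (a l.1) else .inr (a l.1)) θ *
            torusCharacter (bif l.2 then .inr (b l.1) else .inl (b l.1)) θ)) ∂torusMeasure V := by
  refine integral_congr_ae (Eventually.of_forall fun θ => ?_)
  dsimp only
  rw [productWeight, Finset.prod_product, Fintype.sum_sum_type, ← Finset.sum_add_distrib]
  congr 1
  · congr 1
    refine Finset.sum_congr rfl fun v _ => ?_
    have h := Complex.two_cos (θ v : ℂ)
    rw [neg_mul] at h
    simp only [torusCharacter, Sum.elim_inl, Sum.elim_inr, Complex.ofReal_cos]
    linear_combination (z v / 2) * h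
  · refine Finset.prod_congr rfl fun l _ => ?_
    simp only [Fintype.prod_bool, cond_true, cond_false, torusCharacter, Sum.elim_inl,
      Sum.elim_inr, ← Complex.exp_add]
    congr 5 <;> push_cast <;> ring

variable [DecidableEq V]

lemma isLimitOfStable_productWeight (hc0 : ∀ l ∈ s, 0 < c l) :
    IsLimitOfStable fun x : V ⊕ V → ℂ => ∫ θ, Complex.exp (∑ k, x k * torusCharacter k θ) *
      ∏ l ∈ s ×ˢ (Finset.univ : Finset Bool), (1 + c l.1 *
        (torusCharacter (bif l.2 then .inl (a l.1) else .inr (a l.1)) θ *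
          torusCharacter (bif l.2 then .inr (b l.1) else .inl (b l.1)) θ)) ∂torusMeasure V := by
  refine IsLimitOfStable.integral_exp_mul_prod
    (fun k => (continuous_torusCharacter k).measurable)
    (fun k θ => (norm_torusCharacter k θ).le) (isLimitOfStable_integral_exp V)
    (s ×ˢ (Finset.univ : Finset Bool))
    (i := fun l => bif l.2 then .inl (a l.1) else .inr (a l.1))
    (j := fun l => bif l.2 then .inr (b l.1) else .inl (b l.1)) (c := fun l => c l.1) ?_ ?_
  · rintro ⟨l, _ | _⟩ _ <;> simp
  · exact fun l hl => hc0 _ (Finset.mem_product.mp hl).1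

lemma differentiable_cosTransform_productWeight (hc0 : ∀ l ∈ s, 0 < c l) (x y : V → ℂ) :
    Differentiable ℂ fun t : ℂ => cosTransform (productWeight s a b c) fun v => x v + t * y v := by
  simp_rw [cosTransform_productWeight_eq]
  refine (isLimitOfStable_productWeight hc0).differentiable_comp
    (g := fun t => Sum.elim (fun v => (x v + t * y v) / 2) fun v => (x v + t * y v) / 2) ?_
  refine differentiable_pi.mpr ?_
  rintro (v | v) <;> change Differentiable ℂ fun t : ℂ => (x v + t * y v) / 2 <;> fun_prop

lemma cosTransform_productWeight_ne_zero (hc0 : ∀ l ∈ s, 0 < c l) (hc1 : ∀ l ∈ s, c l < 1)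
    {z : V → ℂ} (hz : ∀ v, 0 < (z v).re) : cosTransform (productWeight s a b c) z ≠ 0 := by
  obtain ⟨f, hf, hlim⟩ := isLimitOfStable_productWeight (a := a) (b := b) hc0
  set g : (V → ℂ) → V ⊕ V → ℂ := fun z => Sum.elim (fun v => z v / 2) fun v => z v / 2 with hg
  have hgc : Differentiable ℂ g := by
    refine differentiable_pi.mpr ?_
    rintro (v | v) <;> change Differentiable ℂ fun z : V → ℂ => z v / 2 <;> fun_prop
  refine ne_zero_of_tendstoLocallyUniformly (F := fun n z => MvPolynomial.eval (g z) (f n))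
    (fun n x y => ?_) (fun n z hz => hf n _ ?_) ?_ (fun x _ => ?_) hz
  · exact (MvPolynomial.differentiable_eval (f n)).comp (hgc.comp (by fun_prop))
  · rintro (v | v) <;> change 0 < (z v / 2).re <;> simpa using hz v
  · have h := hlim.comp g hgc.continuous
    rw [funext fun z => cosTransform_productWeight_eq (s := s) (a := a) (b := b) (c := c) z]
    exact h
  · obtain ⟨t, ht, hti, heq⟩ := exists_productWeight_eq_ofReal (a := a) (b := b) hc0 hc1
    rw [heq]
    exact cosTransform_ofReal_ne_zero ht hti x

end Assembly

/-- Multivariable Lee–Yang theorem for the Villain model: on a finite graph `(V, E)` with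
couplings `J_e > 0`, the multivariate moment generating function `E[exp(∑_v z_v cos Θ_v)]`
does not vanish when all `Re z_v > 0`. -/
theorem villain_model_lee_yang_multivariable {V : Type*} [Fintype V] [DecidableEq V]
    (E : Finset (Sym2 V)) (hE : ∀ e ∈ E, ¬ e.IsDiag)
    (J : Sym2 V → ℝ) (hJ : ∀ e ∈ E, 0 < J e)
    (z : V → ℂ) (hz : ∀ v, 0 < (z v).re) :
    (∫ θ : V → ℝ,
        Complex.exp (∑ v, z v * ((Real.cos (θ v) : ℝ) : ℂ)) *
          ((∏ e ∈ E, villainEdge J θ e : ℝ) : ℂ)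
        ∂(Measure.pi fun _ : V => volume.restrict (Set.Ioc (-π) π))) ≠ 0 := by
  have hmk : ∀ e : Sym2 V, ∃ p : V × V, s(p.1, p.2) = e := fun e =>
    e.ind fun u v => ⟨(u, v), rfl⟩
  choose p hp using hmk
  choose! c κ M hc0 hc1 hκ hb using fun e he => exists_tendsto_villainWeight (hJ e he)
  have hedge : ∀ θ : V → ℝ, ∀ e, villainEdge J θ e =
      villainWeight (J e) (θ (p e).1 - θ (p e).2) := by
    intro θ e
    conv_lhs => rw [← hp e]
    rw [villainEdge, Sym2.lift_mk, hp]
  have h0 : ∀ N, ∀ l ∈ E ×ˢ Finset.range N, 0 < c l.1 l.2 := fun N l hl =>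
    hc0 _ (Finset.mem_product.mp hl).1 _
  have h1 : ∀ N, ∀ l ∈ E ×ˢ Finset.range N, c l.1 l.2 < 1 := fun N l hl =>
    hc1 _ (Finset.mem_product.mp hl).1 _
  set W : ℕ → (V → ℝ) → ℂ := fun N => productWeight (E ×ˢ Finset.range N)
    (fun l => (p l.1).1) (fun l => (p l.1).2) (fun l => c l.1 l.2) with hW
  set A : ℕ → ℂ := fun N => ∏ e ∈ E, (κ e N : ℂ) with hA
  have hA0 : ∀ N, A N ≠ 0 := fun N => Finset.prod_ne_zero_iff.mpr fun e he => by
    exact_mod_cast (hκ e he N).ne'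
  have hAW : ∀ N θ, A N * W N θ = ∏ e ∈ E, (κ e N * ∏ k ∈ Finset.range N,
      ((1 + c e k * Complex.exp ((θ (p e).1 - θ (p e).2 : ℝ) * Complex.I)) *
        (1 + c e k * Complex.exp (-((θ (p e).1 - θ (p e).2 : ℝ) * Complex.I))))) := by
    intro N θ
    rw [Finset.prod_mul_distrib, hW]
    simp only [productWeight, Finset.prod_product, hA]
  have hcont : ∀ N, Continuous fun θ => A N * W N θ := fun N =>
    (continuous_productWeight _ _ _ _).const_mul (A N)
  have hbound : ∀ N θ, ‖A N * W N θ‖ ≤ ∏ e ∈ E, M e := by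
    intro N θ
    rw [hAW, norm_prod]
    exact Finset.prod_le_prod (fun _ _ => norm_nonneg _) fun e he => (hb e he _).1 N
  have hlim : ∀ θ, Filter.Tendsto (fun N => A N * W N θ) Filter.atTop
      (nhds ((∏ e ∈ E, villainEdge J θ e : ℝ) : ℂ)) := by
    intro θ
    simp_rw [hAW, hedge, Complex.ofReal_prod]
    exact tendsto_finsetProd _ fun e he => (hb e he _).2
  have hposV : ∀ θ, 0 < ∏ e ∈ E, villainEdge J θ e := fun θ => Finset.prod_pos fun e he => by
    rw [hedge]; exact villainWeight_pos (hJ e he) _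
  have hinteg : Integrable (fun θ => ∏ e ∈ E, villainEdge J θ e) (torusMeasure V) := by
    have h : Integrable (fun θ => ((∏ e ∈ E, villainEdge J θ e : ℝ) : ℂ)) (torusMeasure V) :=
      Integrable.of_bound (aestronglyMeasurable_of_tendsto_ae Filter.atTop
        (fun N => (hcont N).aestronglyMeasurable) (Filter.Eventually.of_forall hlim))
        (∏ e ∈ E, M e) (Filter.Eventually.of_forall fun θ =>
          le_of_tendsto' (hlim θ).norm fun N => hbound N θ)
    exact h.re
  exact ne_zero_of_tendstoLocallyUniformly
    (F := fun N => cosTransform fun θ => A N * W N θ)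
    (G := cosTransform fun θ => ((∏ e ∈ E, villainEdge J θ e : ℝ) : ℂ))
    (fun N x y => by
      simp_rw [cosTransform_const_mul]
      exact (differentiable_cosTransform_productWeight (h0 N) x y).const_mul _)
    (fun N z hz => by
      rw [cosTransform_const_mul]
      exact mul_ne_zero (hA0 N) (cosTransform_productWeight_ne_zero (h0 N) (h1 N) hz))
    (tendstoLocallyUniformly_of_tendsto_prod (tendsto_cosTransform hcont hbound hlim))
    (fun x _ => cosTransform_ofReal_ne_zero hposV hinteg x) hz
end

section
/- Suppose for each n ∈ ℕ, μ_n is a probability measure on ℝ of Lee–Yang type, and μ_n converges weakly to a probability measure μ. Then μ is of Lee–Yang type. In particular: μ is symmetric, ∫ exp(b x²) dμ(x) < ∞ for some b > 0 (sub-Gaussian tails), and the entire function z ↦ ∫ exp(z x) dμ(x) is nonzero at every z ∈ ℂ with Re z ≠ 0. -/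
open MeasureTheory Filter

/-- A probability measure `μ` on `ℝ` is of Lee–Yang type if (1) it is symmetric,
(2) `∫ exp(b x²) dμ < ∞` for some `b > 0`, and (3) its moment generating function
`z ↦ ∫ exp(z x) dμ(x)` is nonzero at every `z ∈ ℂ` with `Re z ≠ 0`. -/
def IsLeeYang (μ : Measure ℝ) : Prop :=
  μ.map (fun x : ℝ => -x) = μ ∧
  (∃ b : ℝ, 0 < b ∧ Integrable (fun x : ℝ => Real.exp (b * x ^ 2)) μ) ∧
  (∀ z : ℂ, z.re ≠ 0 → (∫ x : ℝ, Complex.exp (z * (x : ℂ)) ∂μ) ≠ 0)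

/-- A Borel–Carathéodory lower bound: a zero-free holomorphic function on a disc which is bounded
by `exp M` and has modulus at least one at the centre is bounded below inside the disc. -/
theorem exp_le_norm_of_ne_zero {f : ℂ → ℂ} {c z : ℂ} {R M : ℝ}
    (hf : DifferentiableOn ℂ f (Metric.ball c R)) (h0 : ∀ w ∈ Metric.ball c R, f w ≠ 0)
    (hM : 0 < M) (hfM : ∀ w ∈ Metric.ball c R, ‖f w‖ ≤ Real.exp M) (hc : 1 ≤ ‖f c‖)
    (hz : z ∈ Metric.ball c R) :
    Real.exp (-(2 * M * ‖z - c‖ / (R - ‖z - c‖))) ≤ ‖f z‖ := by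
  have hR : 0 < R := Metric.pos_of_mem_ball hz
  have hcmem : c ∈ Metric.ball c R := Metric.mem_ball_self hR
  have hd : DifferentiableOn ℂ (deriv f) (Metric.ball c R) := hf.deriv Metric.isOpen_ball
  obtain ⟨h, hh0, hh⟩ := ((hd.div hf h0).isExactOn_ball).with_val_at c 0
  -- `f = f c * exp h`
  have key : ∀ w ∈ Metric.ball c R, f w = f c * Complex.exp (h w) := by
    have hconst : ∀ w ∈ Metric.ball c R, f w * Complex.exp (-h w) = f c * Complex.exp (-h c) := by
      intro w hw
      have hder : ∀ x ∈ Metric.ball c R,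
          HasDerivAt (fun x => f x * Complex.exp (-h x)) 0 x := by
        intro x hx
        have h1 := (hf.differentiableAt (Metric.isOpen_ball.mem_nhds hx)).hasDerivAt
        have h2 := (hh x hx).neg.cexp
        refine (h1.mul h2).congr_deriv ?_
        have := h0 x hx
        simp only [Pi.div_apply]
        field_simp
        ring
      exact Metric.isOpen_ball.is_const_of_deriv_eq_zero (convex_ball c R).isPreconnected
        (fun x hx => (hder x hx).differentiableAt.differentiableWithinAt)
        (fun x hx => (hder x hx).deriv) hw hcmem
    intro w hw
    have := hconst w hw
    rw [hh0, neg_zero, Complex.exp_zero, mul_one] at this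
    rw [← this, mul_assoc, ← Complex.exp_add]
    simp
  have hc0 : 0 < ‖f c‖ := by linarith
  have hre : ∀ w ∈ Metric.ball c R, (h w).re ≤ M := by
    intro w hw
    have h1 := hfM w hw
    rw [key w hw, norm_mul, Complex.norm_exp] at h1
    have : Real.exp (h w).re ≤ Real.exp M := by
      refine le_trans ?_ h1
      nlinarith [Real.exp_pos (h w).re]
    exact Real.exp_le_exp.1 this
  have hmem : ∀ w ∈ Metric.ball (0 : ℂ) R, c + w ∈ Metric.ball c R := by
    intro w hw
    simpa using hw
  have hbc := Complex.borelCaratheodory_zero (f := fun w => h (c + w)) (z := z - c) hM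
    (fun w hw => by
      have := (hh (c + w) (hmem w hw)).differentiableAt
      exact (this.comp w (by fun_prop)).differentiableWithinAt)
    (fun w hw => hre _ (hmem w hw)) hR (by simpa [dist_eq_norm] using hz) (by simpa using hh0)
  rw [key z hz, norm_mul, Complex.norm_exp]
  simp only [add_sub_cancel] at hbc
  have h1 : -(2 * M * ‖z - c‖ / (R - ‖z - c‖)) ≤ (h z).re := by
    have := (abs_le.1 (Complex.abs_re_le_norm (h z))).1
    linarith
  have h2 := Real.exp_le_exp.2 h1
  nlinarith [Real.exp_pos (h z).re]

/-- The second coefficient estimate for typically real functions on the unit disc. -/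
theorem re_iteratedDeriv_two_le_of_im_mul_im_nonneg {g : ℂ → ℂ}
    (hg : DifferentiableOn ℂ g (Metric.ball 0 1))
    (him : ∀ z ∈ Metric.ball (0 : ℂ) 1, 0 ≤ (g z).im * z.im) :
    (iteratedDeriv 2 g 0).re ≤ 4 * (deriv g 0).re := by
  have key : ∀ ρ : ℝ, 0 < ρ → ρ < 1 → 0 ≤ 4 * (deriv g 0).re - ρ * (iteratedDeriv 2 g 0).re := by
    intro ρ h0 h1
    have hsub : Metric.closedBall (0 : ℂ) ρ ⊆ Metric.ball 0 1 := Metric.closedBall_subset_ball h1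
    have hd : DiffContOnCl ℂ g (Metric.ball 0 ρ) :=
      (hg.mono hsub).diffContOnCl_ball (Set.Subset.refl _)
    have e1 := hd.circleIntegral_one_div_sub_center_pow_smul h0 1
    have e2 := hd.circleIntegral_one_div_sub_center_pow_smul h0 2
    have hpoly : DiffContOnCl ℂ (fun z : ℂ => (2 / ρ - z / ρ ^ 2) * g z) (Metric.ball 0 ρ) :=
      (Differentiable.diffContOnCl (f := fun z : ℂ => 2 / (ρ : ℂ) - z / (ρ : ℂ) ^ 2)
        (by fun_prop)).smul hd
    have e3 := hpoly.circleIntegral_eq_zero h0.le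
    have hcont : ContinuousOn g (Metric.sphere 0 ρ) :=
      hg.continuousOn.mono (Metric.sphere_subset_closedBall.trans hsub)
    have hne : ∀ z ∈ Metric.sphere (0 : ℂ) ρ, z ≠ 0 := by
      rintro z hz rfl
      simp at hz
      exact h0.ne hz
    have hinv : ∀ k : ℕ, ContinuousOn (fun z : ℂ => 1 / (z - 0) ^ k) (Metric.sphere 0 ρ) := by
      intro k
      refine continuousOn_const.div (by fun_prop) (fun z hz => ?_)
      simpa using fun h => absurd h (hne z hz)
    have i1 : CircleIntegrable (fun z => (1 / (z - 0) ^ (1 + 1)) • g z) 0 ρ := by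
      apply ContinuousOn.circleIntegrable h0.le
      exact (hinv _).smul hcont
    have i2 : CircleIntegrable (fun z => (1 / (z - 0) ^ (2 + 1)) • g z) 0 ρ := by
      apply ContinuousOn.circleIntegrable h0.le
      exact (hinv _).smul hcont
    have i3 : CircleIntegrable (fun z : ℂ => (2 / ρ - z / ρ ^ 2) * g z) 0 ρ := by
      apply ContinuousOn.circleIntegrable h0.le
      exact ContinuousOn.mul (by fun_prop) hcont
    set F : ℂ → ℂ := fun z => (-2 * ρ : ℂ) • ((1 / (z - 0) ^ (1 + 1)) • g z)
      + ((ρ : ℂ) ^ 2 • ((1 / (z - 0) ^ (2 + 1)) • g z) + (2 / ρ - z / ρ ^ 2) * g z) with hF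
    have iF1 : CircleIntegrable (fun z => (-2 * ρ : ℂ) • ((1 / (z - 0) ^ (1 + 1)) • g z)) 0 ρ :=
      i1.const_smul
    have iF2 : CircleIntegrable (fun z => (ρ : ℂ) ^ 2 • ((1 / (z - 0) ^ (2 + 1)) • g z)) 0 ρ :=
      i2.const_smul
    have iF : CircleIntegrable F 0 ρ := iF1.add (iF2.add i3)
    have hJ : (∮ z in C(0, ρ), F z) =
        (-2 * ρ : ℂ) •
          ((2 * Real.pi * Complex.I / (Nat.factorial 1 : ℂ)) • iteratedDeriv 1 g 0)
        + (ρ : ℂ) ^ 2 •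
          ((2 * Real.pi * Complex.I / (Nat.factorial 2 : ℂ)) • iteratedDeriv 2 g 0) := by
      refine (circleIntegral.integral_add iF1 (iF2.add i3)).trans ?_
      rw [← e1, ← e2, ← circleIntegral.integral_smul, ← circleIntegral.integral_smul]
      congr 1
      refine (circleIntegral.integral_add iF2 i3).trans ?_
      rw [e3, add_zero]
    have hint : ∀ θ : ℝ, (deriv (circleMap 0 ρ) θ • F (circleMap 0 ρ θ)).im
        = -4 * (1 - Real.cos θ) * ((g (circleMap 0 ρ θ)).im * Real.sin θ) := by
      intro θ
      have hρ : (ρ : ℂ) ≠ 0 := by exact_mod_cast h0.ne'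
      have hz : circleMap 0 ρ θ = ρ * (Real.cos θ + Real.sin θ * Complex.I) := by
        simp [circleMap, Complex.exp_mul_I]
      set u : ℂ := Real.cos θ + Real.sin θ * Complex.I with hu
      have huv : u * (Real.cos θ - Real.sin θ * Complex.I) = 1 := by
        have : ((Real.sin θ : ℂ)) ^ 2 + (Real.cos θ : ℂ) ^ 2 = 1 := by
          exact_mod_cast Real.sin_sq_add_cos_sq θ
        rw [hu]; linear_combination this - (Real.sin θ : ℂ) ^ 2 * Complex.I_sq
      have hu0 : u ≠ 0 := left_ne_zero_of_mul_eq_one huv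
      have hui : u⁻¹ = Real.cos θ - Real.sin θ * Complex.I := inv_eq_of_mul_eq_one_right huv
      have : deriv (circleMap 0 ρ) θ • F (circleMap 0 ρ θ) = Complex.I *
          ((2 * (u - u⁻¹) - (u - u⁻¹) * (u + u⁻¹)) * g (circleMap 0 ρ θ)) := by
        rw [deriv_circleMap, hz, hF]
        simp only [smul_eq_mul, sub_zero]
        field_simp
        ring
      rw [this, hui, hu]
      have : 2 * (Real.cos θ + Real.sin θ * Complex.I - (Real.cos θ - Real.sin θ * Complex.I)) -
          (Real.cos θ + Real.sin θ * Complex.I - (Real.cos θ - Real.sin θ * Complex.I)) *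
          (Real.cos θ + Real.sin θ * Complex.I + (Real.cos θ - Real.sin θ * Complex.I))
          = ((4 * Real.sin θ * (1 - Real.cos θ) : ℝ) : ℂ) * Complex.I := by
        push_cast; ring
      have hreal : ∀ (t : ℝ) (w : ℂ),
          Complex.I * ((t : ℂ) * Complex.I * w) = ((-t : ℝ) : ℂ) * w := by
        intro t w
        push_cast
        linear_combination (t * w : ℂ) * Complex.I_sq
      rw [this, hreal, Complex.im_ofReal_mul]
      ring
    have him' : (∮ z in C(0, ρ), F z).im ≤ 0 := by
      rw [circleIntegral, ← Complex.imCLM_apply,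
        ← ContinuousLinearMap.intervalIntegral_comp_comm _ iF.out]
      rw [← neg_nonneg, ← intervalIntegral.integral_neg]
      apply intervalIntegral.integral_nonneg Real.two_pi_pos.le
      intro θ _
      rw [Complex.imCLM_apply, hint]
      have hm := him (circleMap 0 ρ θ) (by simp [abs_of_pos h0, h1])
      have hs : (circleMap 0 ρ θ).im = ρ * Real.sin θ := by
        simp [circleMap_zero, Complex.exp_ofReal_mul_I_im]
      rw [hs] at hm
      have : 0 ≤ (g (circleMap 0 ρ θ)).im * Real.sin θ := by
        by_contra! hneg
        nlinarith
      nlinarith [mul_nonneg (sub_nonneg.2 (Real.cos_le_one θ)) this]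
    have hval : (∮ z in C(0, ρ), F z) = ((Real.pi * ρ : ℝ) : ℂ) *
        ((((ρ : ℝ) : ℂ) * iteratedDeriv 2 g 0 - ((4 : ℝ) : ℂ) * deriv g 0) * Complex.I) := by
      rw [hJ, iteratedDeriv_one]
      simp only [smul_eq_mul, Nat.factorial]
      push_cast
      ring
    rw [hval, Complex.im_ofReal_mul, Complex.mul_I_im, Complex.sub_re, Complex.re_ofReal_mul,
      Complex.re_ofReal_mul] at him'
    by_contra! hneg
    have : 0 < Real.pi * ρ := by positivity
    nlinarith
  have hlim : Tendsto (fun ρ : ℝ => 4 * (deriv g 0).re - ρ * (iteratedDeriv 2 g 0).re)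
      (nhdsWithin 1 (Set.Iio 1)) (nhds (4 * (deriv g 0).re - 1 * (iteratedDeriv 2 g 0).re)) := by
    apply Tendsto.mono_left _ nhdsWithin_le_nhds
    apply Continuous.tendsto
    fun_prop
  have := ge_of_tendsto hlim (by
    filter_upwards [Ioo_mem_nhdsLT (show (0 : ℝ) < 1 by norm_num)] with ρ hρ
    exact key ρ hρ.1 hρ.2)
  linarith

/-- The analogue of the typically real coefficient estimate on the right half-plane, obtained by
transporting the disc to the half-plane by a Cayley map centred at `x`. -/
theorem mul_re_deriv_deriv_le_re_deriv {q : ℂ → ℂ} (hq : DifferentiableOn ℂ q {z | 0 < z.re})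
    (him : ∀ z : ℂ, 0 < z.re → 0 ≤ (q z).im * z.im) {x : ℝ} (hx : 0 < x) :
    x * (deriv (deriv q) x).re ≤ (deriv q x).re := by
  have hopen : IsOpen {z : ℂ | 0 < z.re} := isOpen_lt continuous_const Complex.continuous_re
  set c : ℂ → ℂ := fun ζ => x * ((1 + ζ) / (1 - ζ)) with hc
  have hball : ∀ ζ ∈ Metric.ball (0 : ℂ) 1, 1 - ζ ≠ 0 := by
    intro ζ hζ h
    rw [sub_eq_zero] at h
    simp [← h] at hζ
  have hns : ∀ ζ ∈ Metric.ball (0 : ℂ) 1, 0 < Complex.normSq (1 - ζ) := fun ζ hζ =>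
    Complex.normSq_pos.2 (hball ζ hζ)
  have hcre : ∀ ζ ∈ Metric.ball (0 : ℂ) 1, 0 < (c ζ).re := by
    intro ζ hζ
    have h1 : ζ.re * ζ.re + ζ.im * ζ.im < 1 := by
      rw [← Complex.normSq_apply, Complex.normSq_eq_norm_sq]
      have : ‖ζ‖ < 1 := by simpa using hζ
      nlinarith [norm_nonneg ζ]
    rw [hc, Complex.re_ofReal_mul, Complex.div_re, ← add_div]
    refine mul_pos hx (div_pos ?_ (hns ζ hζ))
    simp
    nlinarith
  have hcim : ∀ ζ ∈ Metric.ball (0 : ℂ) 1, 0 ≤ (c ζ).im * ζ.im ∧ ((c ζ).im = 0 → ζ.im = 0) := by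
    intro ζ hζ
    have : (c ζ).im = 2 * x / Complex.normSq (1 - ζ) * ζ.im := by
      rw [hc, Complex.im_ofReal_mul, Complex.div_im]
      simp
      ring
    rw [this]
    have hp : 0 < 2 * x / Complex.normSq (1 - ζ) := div_pos (by positivity) (hns ζ hζ)
    constructor
    · nlinarith [mul_nonneg hp.le (mul_self_nonneg ζ.im)]
    · intro h
      exact (mul_eq_zero.1 h).resolve_left hp.ne'
  have hcd : ∀ ζ ∈ Metric.ball (0 : ℂ) 1, HasDerivAt c (2 * x / (1 - ζ) ^ 2) ζ := by
    intro ζ hζ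
    have h1 := (((hasDerivAt_id ζ).const_add 1).div ((hasDerivAt_id ζ).const_sub 1)
      (hball ζ hζ)).const_mul (x : ℂ)
    refine h1.congr_deriv ?_
    have := hball ζ hζ
    simp only [id]
    field_simp
    ring
  have hqd : ∀ z : ℂ, 0 < z.re → HasDerivAt q (deriv q z) z := fun z hz =>
    (hq.differentiableAt (hopen.mem_nhds hz)).hasDerivAt
  have hqdd : ∀ z : ℂ, 0 < z.re → HasDerivAt (deriv q) (deriv (deriv q) z) z := fun z hz =>
    ((hq.deriv hopen).differentiableAt (hopen.mem_nhds hz)).hasDerivAt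
  have hgd : ∀ ζ ∈ Metric.ball (0 : ℂ) 1,
      HasDerivAt (fun ζ => q (c ζ)) (deriv q (c ζ) * (2 * x / (1 - ζ) ^ 2)) ζ := fun ζ hζ =>
    (hqd _ (hcre ζ hζ)).comp ζ (hcd ζ hζ)
  have h0 : (0 : ℂ) ∈ Metric.ball (0 : ℂ) 1 := by simp
  have hc0 : c 0 = x := by simp [hc]
  have key := re_iteratedDeriv_two_le_of_im_mul_im_nonneg (g := fun ζ => q (c ζ))
    (fun ζ hζ => (hgd ζ hζ).differentiableAt.differentiableWithinAt) (by
      intro ζ hζ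
      have h1 := him _ (hcre ζ hζ)
      obtain ⟨h2, h3⟩ := hcim ζ hζ
      rcases eq_or_ne (c ζ).im 0 with h | h
      · simp [h3 h]
      · rcases lt_or_gt_of_ne h with h | h <;> by_contra! hneg <;>
          rcases lt_trichotomy ζ.im 0 with h4 | h4 | h4 <;> nlinarith)
  have hg1 : deriv (fun ζ => q (c ζ)) =ᶠ[nhds 0]
      fun ζ => deriv q (c ζ) * (2 * x / (1 - ζ) ^ 2) := by
    filter_upwards [Metric.isOpen_ball.mem_nhds h0] with ζ hζ using (hgd ζ hζ).deriv
  have hw : HasDerivAt (fun ζ : ℂ => 2 * (x : ℂ) / (1 - ζ) ^ 2) (4 * (x : ℂ)) 0 := by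
    have h1 := (hasDerivAt_const (0 : ℂ) (2 * (x : ℂ) : ℂ)).div
      (((hasDerivAt_id (0 : ℂ)).const_sub 1).pow 2) (by simp)
    refine h1.congr_deriv ?_
    simp
    ring
  have hg2 : deriv (deriv fun ζ => q (c ζ)) 0
      = deriv (deriv q) x * (2 * x) * (2 * x) + deriv q x * (4 * x) := by
    rw [hg1.deriv_eq]
    have h1 := ((hqdd (c 0) (hcre 0 h0)).comp 0 (hcd 0 h0)).mul hw
    refine h1.deriv.trans ?_
    simp [hc0]
  rw [iteratedDeriv_succ, iteratedDeriv_one, hg2, hg1.eq_of_nhds, hc0] at key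
  have e1 : (deriv (deriv q) x * (2 * x) * (2 * x) + deriv q x * (4 * x)).re
      = 4 * x ^ 2 * (deriv (deriv q) x).re + 4 * x * (deriv q x).re := by
    rw [← Complex.re_ofReal_mul, ← Complex.re_ofReal_mul, ← Complex.add_re]
    congr 1; push_cast; ring
  have e2 : (deriv q x * (2 * x / (1 - 0) ^ 2)).re = 2 * x * (deriv q x).re := by
    rw [← Complex.re_ofReal_mul]
    congr 1; push_cast; ring
  rw [e1, e2] at key
  by_contra! hneg
  nlinarith

/-- Even, real, normalized entire functions of order at most two without zeros in the right
half-plane, whose modulus is controlled by their values on the real axis. These are the properties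
of the moment generating function of a Lee–Yang measure which enter the estimates. -/
structure IsLeeYangEntire (f : ℂ → ℂ) : Prop where
  differentiable : Differentiable ℂ f
  even : ∀ z, f (-z) = f z
  conj : ∀ z, f (starRingEnd ℂ z) = starRingEnd ℂ (f z)
  norm_le : ∀ (z : ℂ) (x : ℝ), |z.re| ≤ x → ‖f z‖ ≤ (f x).re
  growth : ∃ C : ℝ, 0 < C ∧ ∀ z, ‖f z‖ ≤ Real.exp (C * (1 + ‖z‖ ^ 2))
  ne_zero : ∀ z : ℂ, 0 < z.re → f z ≠ 0
  map_zero : f 0 = 1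

namespace IsLeeYangEntire

variable {f : ℂ → ℂ}

theorem one_le_re (hf : IsLeeYangEntire f) {x : ℝ} (hx : 0 ≤ x) : 1 ≤ (f x).re := by
  simpa [hf.map_zero] using hf.norm_le 0 x (by simpa using hx)

theorem one_le_norm (hf : IsLeeYangEntire f) {x : ℝ} (hx : 0 ≤ x) : 1 ≤ ‖f x‖ :=
  (hf.one_le_re hx).trans ((le_abs_self _).trans (Complex.abs_re_le_norm _))

/-- In a sector inside the right half-plane, `f` is bounded below by the inverse of a Gaussian. -/
theorem exists_sector_lower_bound (hf : IsLeeYangEntire f) {k : ℝ} (hk0 : 0 < k) (hk1 : k ≤ 1) :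
    ∃ D : ℝ, 0 ≤ D ∧ ∀ w : ℂ, 0 < w.re → k * ‖w‖ ≤ w.re →
      Real.exp (-(D * (1 + ‖w‖ ^ 2))) ≤ ‖f w‖ := by
  obtain ⟨C, hC, hgrowth⟩ := hf.growth
  set s := Real.sqrt (1 - k ^ 2) with hs
  have hs0 : 0 ≤ s := Real.sqrt_nonneg _
  have hs1 : s < 1 := by
    rw [hs, Real.sqrt_lt' one_pos]; nlinarith
  have hss : s ^ 2 = 1 - k ^ 2 := Real.sq_sqrt (by nlinarith)
  refine ⟨2 * (4 * C / k ^ 2) * (s / (1 - s)), by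
    have : 0 < 1 - s := by linarith
    positivity, fun w hw hkw => ?_⟩
  set r := ‖w‖ with hr
  have hr0 : 0 < r := lt_of_lt_of_le hw (Complex.re_le_norm w)
  set c := r / k with hc
  have hc0 : 0 < c := div_pos hr0 hk0
  have hrc : r = k * c := by rw [hc]; field_simp
  have hdist : ‖w - c‖ ≤ s * c := by
    rw [← abs_of_nonneg (norm_nonneg (w - c)), ← abs_of_nonneg (mul_nonneg hs0 hc0.le), ← sq_le_sq,
      ← Complex.normSq_eq_norm_sq, Complex.normSq_apply, mul_pow, hss]
    have : w.re * w.re + w.im * w.im = r ^ 2 := by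
      rw [hr, ← Complex.normSq_eq_norm_sq, Complex.normSq_apply]
    simp
    nlinarith [mul_le_mul_of_nonneg_right hkw hc0.le]
  have hM : ∀ v ∈ Metric.ball (c : ℂ) c, ‖f v‖ ≤ Real.exp (4 * C / k ^ 2 * (1 + r ^ 2)) := by
    intro v hv
    refine (hgrowth v).trans (Real.exp_le_exp.2 ?_)
    have h1 : ‖v‖ ≤ 2 * c := by
      have h2 : ‖v - c‖ < c := by simpa [dist_eq_norm] using hv
      have h3 := norm_add_le (v - c) (c : ℂ)
      simp [abs_of_pos hc0] at h3
      linarith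
    have h2 : ‖v‖ ^ 2 ≤ 4 * c ^ 2 := by nlinarith [norm_nonneg v]
    have h3 : 4 * C / k ^ 2 * (1 + r ^ 2) = C * (4 / k ^ 2 + 4 * c ^ 2) := by
      rw [hrc]; field_simp
    rw [h3]
    have h4 : 1 ≤ 4 / k ^ 2 := by
      rw [le_div_iff₀ (by positivity)]; nlinarith
    gcongr
  have hpos : ∀ v ∈ Metric.ball (c : ℂ) c, 0 < v.re := by
    intro v hv
    have h2 : ‖v - c‖ < c := by simpa [dist_eq_norm] using hv
    have h3 := (abs_lt.1 ((Complex.abs_re_le_norm _).trans_lt h2)).1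
    simp at h3
    linarith
  have hwb : w ∈ Metric.ball (c : ℂ) c := by
    rw [Metric.mem_ball, dist_eq_norm]
    exact hdist.trans_lt (by nlinarith)
  refine le_trans (Real.exp_le_exp.2 ?_) (exp_le_norm_of_ne_zero hf.differentiable.differentiableOn
    (fun v hv => hf.ne_zero v (hpos v hv)) (by positivity) hM (hf.one_le_norm hc0.le) hwb)
  rw [neg_le_neg_iff]
  have h5 : ‖w - c‖ / (c - ‖w - c‖) ≤ s / (1 - s) := by
    rw [div_le_div_iff₀ (by nlinarith) (by linarith)]
    nlinarith
  rw [mul_div_assoc]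
  calc _ ≤ 2 * (4 * C / k ^ 2 * (1 + r ^ 2)) * (s / (1 - s)) := by gcongr
    _ = _ := by ring

/-- On a circle centred at the origin, the modulus of `f` decreases with the angle to the real
axis. -/
theorem norm_rotate_le (hf : IsLeeYangEntire f) {θ φ r : ℝ} (hr : 0 < r) (h0 : 0 ≤ θ)
    (h1 : θ ≤ φ) (h2 : θ + φ < Real.pi) :
    ‖f (r * Complex.exp (φ * Complex.I))‖ ≤ ‖f (r * Complex.exp (θ * Complex.I))‖ := by
  rcases h1.eq_or_lt with rfl | h1
  · rfl
  set α := (θ + φ) / 2 with hα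
  have hα0 : 0 < α := by rw [hα]; linarith
  have hα1 : α < Real.pi / 2 := by rw [hα]; linarith
  have hk0 : 0 < Real.cos α := Real.cos_pos_of_mem_Ioo ⟨by linarith, hα1⟩
  have hcos : ∀ y : ℝ, 0 ≤ y → y ≤ α → Real.cos α ≤ Real.cos y := fun y hy hyα =>
    Real.cos_le_cos_of_nonneg_of_le_pi hy (by linarith) hyα
  have hre : ∀ ζ : ℂ, 0 ≤ ζ.im → ζ.im ≤ α → 0 < (Complex.exp ζ).re := by
    intro ζ h h'
    rw [Complex.exp_re]
    exact mul_pos (Real.exp_pos _) (hk0.trans_le (hcos _ h h'))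
  obtain ⟨C, hC, hgrowth⟩ := hf.growth
  obtain ⟨D, hD, hlower⟩ := hf.exists_sector_lower_bound hk0 (Real.cos_le_one α)
  set G : ℂ → ℂ := fun ζ => f (Complex.exp (ζ - 2 * α * Complex.I)) / f (Complex.exp ζ) with hG
  have hdiff : DiffContOnCl ℂ G (Complex.im ⁻¹' Set.Ioo 0 α) := by
    apply DifferentiableOn.diffContOnCl
    have hcl : closure (Complex.im ⁻¹' Set.Ioo 0 α) ⊆ Complex.im ⁻¹' Set.Icc 0 α :=
      closure_minimal (Set.preimage_mono Set.Ioo_subset_Icc_self)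
        (isClosed_Icc.preimage Complex.continuous_im)
    refine DifferentiableOn.mono ?_ hcl
    intro ζ hζ
    refine DifferentiableAt.differentiableWithinAt (DifferentiableAt.div ?_ ?_
      (hf.ne_zero _ (hre ζ hζ.1 hζ.2)))
    · exact hf.differentiable.differentiableAt.comp ζ (by fun_prop)
    · exact hf.differentiable.differentiableAt.comp ζ (by fun_prop)
  have hB : ∃ c < Real.pi / (α - 0), ∃ B, G =O[comap (abs ∘ Complex.re) atTop ⊓
      𝓟 (Complex.im ⁻¹' Set.Ioo 0 α)] fun z ↦ Real.exp (B * Real.exp (c * |z.re|)) := by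
    refine ⟨2, by rw [sub_zero, lt_div_iff₀ hα0]; linarith, 2 * (C + D), ?_⟩
    refine Asymptotics.IsBigO.of_bound 1 (mem_inf_of_right fun ζ hζ => ?_)
    have hw := hlower (Complex.exp ζ) (hre ζ hζ.1.le hζ.2.le) (by
      rw [Complex.norm_exp, Complex.exp_re, mul_comm]
      have := hcos _ hζ.1.le hζ.2.le
      gcongr)
    have hn := hgrowth (Complex.exp (ζ - 2 * α * Complex.I))
    have e1 : ‖Complex.exp (ζ - 2 * α * Complex.I)‖ = Real.exp ζ.re := by
      rw [Complex.norm_exp]; simp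
    rw [e1] at hn
    rw [Complex.norm_exp] at hw
    rw [Set.mem_ofPred_eq, one_mul, Real.norm_eq_abs, abs_of_pos (Real.exp_pos _), hG, norm_div]
    have hr1 : 1 + Real.exp ζ.re ^ 2 ≤ 2 * Real.exp (2 * |ζ.re|) := by
      have a1 : Real.exp ζ.re ^ 2 ≤ Real.exp (2 * |ζ.re|) := by
        rw [← Real.exp_nat_mul]
        apply Real.exp_le_exp.2
        push_cast
        nlinarith [le_abs_self ζ.re]
      have a2 : 1 ≤ Real.exp (2 * |ζ.re|) := Real.one_le_exp (by positivity)
      linarith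
    calc _ ≤ Real.exp (C * (1 + Real.exp ζ.re ^ 2)) /
          Real.exp (-(D * (1 + Real.exp ζ.re ^ 2))) := by
          gcongr
      _ = Real.exp ((C + D) * (1 + Real.exp ζ.re ^ 2)) := by
          rw [← Real.exp_sub]; ring_nf
      _ ≤ _ := by
          apply Real.exp_le_exp.2
          nlinarith [add_nonneg hC.le hD]
  have hbot : ∀ ζ : ℂ, ζ.im = 0 → ‖G ζ‖ ≤ 1 := by
    intro ζ hζ
    have e : Complex.exp ζ = (Real.exp ζ.re : ℝ) := by
      rw [Complex.ofReal_exp]; congr 1; apply Complex.ext <;> simp [hζ]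
    rw [hG, norm_div, e]
    refine div_le_one_of_le₀ ?_ (norm_nonneg _)
    refine (hf.norm_le _ (Real.exp ζ.re) ?_).trans (Complex.re_le_norm _)
    refine (Complex.abs_re_le_norm _).trans (le_of_eq ?_)
    rw [Complex.norm_exp]; simp
  have htop : ∀ ζ : ℂ, ζ.im = α → ‖G ζ‖ ≤ 1 := by
    intro ζ hζ
    have e : Complex.exp (ζ - 2 * α * Complex.I) = starRingEnd ℂ (Complex.exp ζ) := by
      rw [← Complex.exp_conj]; congr 1
      apply Complex.ext
      · simp
      · simp [hζ]; ring
    rw [hG, norm_div, e, hf.conj, Complex.norm_conj]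
    exact div_self_le_one _
  have key := PhragmenLindelof.horizontal_strip (z := Real.log r + θ * Complex.I) hdiff hB hbot htop
    (by simpa using h0) (by simp [hα]; linarith)
  have e1 : Complex.exp (Real.log r + θ * Complex.I) = r * Complex.exp (θ * Complex.I) := by
    rw [Complex.exp_add, ← Complex.ofReal_exp, Real.exp_log hr]
  have e2 : Complex.exp (Real.log r + θ * Complex.I - 2 * α * Complex.I)
      = starRingEnd ℂ (r * Complex.exp (φ * Complex.I)) := by
    rw [map_mul, ← Complex.exp_conj, Complex.conj_ofReal, map_mul, Complex.conj_I,
      Complex.conj_ofReal]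
    rw [show (Real.log r + θ * Complex.I - 2 * α * Complex.I : ℂ)
      = Real.log r + (φ : ℂ) * -Complex.I by rw [hα]; push_cast; ring]
    rw [Complex.exp_add, ← Complex.ofReal_exp, Real.exp_log hr]
  rw [hG, norm_div, e1, e2, hf.conj, Complex.norm_conj, div_le_one₀] at key
  · exact key
  · rw [norm_pos_iff, ← e1]
    exact hf.ne_zero _ (hre _ (by simpa using h0) (by simp [hα]; linarith))

theorem ofReal_im (hf : IsLeeYangEntire f) (x : ℝ) : (f x).im = 0 := by
  have := hf.conj x
  rw [Complex.conj_ofReal] at this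
  exact Complex.conj_eq_iff_im.1 this.symm

theorem deriv_conj (hf : IsLeeYangEntire f) (z : ℂ) :
    deriv f (starRingEnd ℂ z) = starRingEnd ℂ (deriv f z) := by
  have h := (hf.differentiable z).hasDerivAt.conj_conj
  have e : (starRingEnd ℂ ∘ f ∘ starRingEnd ℂ : ℂ → ℂ) = f := by
    ext w; simp [hf.conj]
  rw [e] at h
  exact h.deriv

theorem deriv_zero (hf : IsLeeYangEntire f) : deriv f 0 = 0 := by
  have h := deriv_comp_neg f 0
  rw [show (fun x => f (-x)) = f from funext hf.even, neg_zero] at h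
  linear_combination h / 2

theorem im_mul_logDeriv_nonneg (hf : IsLeeYangEntire f) {z : ℂ} (hre : 0 < z.re)
    (him : 0 < z.im) : 0 ≤ (z * (deriv f z / f z)).im := by
  have hz : z ≠ 0 := by rintro rfl; simp at hre
  set r := ‖z‖ with hr
  have hr0 : 0 < r := norm_pos_iff.2 hz
  set θ := z.arg with hθ
  have hθ0 : 0 < θ := by
    refine lt_of_le_of_ne (Complex.arg_nonneg_iff.2 him.le) fun h => ?_
    have := Complex.arg_eq_zero_iff.1 h.symm
    exact him.ne' this.2
  have hθ1 : θ < Real.pi / 2 := (Complex.abs_arg_lt_pi_div_two_iff.2 (Or.inl hre) |> abs_lt.1).2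
  have hzr : (r : ℂ) * Complex.exp (θ * Complex.I) = z := Complex.norm_mul_exp_arg_mul_I z
  have hanti : AntitoneOn (fun t : ℝ => ‖f (r * Complex.exp (t * Complex.I))‖ ^ 2)
      (Set.Ioo 0 (Real.pi / 2)) := by
    intro s hs t ht hst
    have := hf.norm_rotate_le hr0 hs.1.le hst (by linarith [hs.2, ht.2])
    exact pow_le_pow_left₀ (norm_nonneg _) this 2
  have hpath : HasDerivAt (fun t : ℝ => f (r * Complex.exp (t * Complex.I)))
      (deriv f z * (z * Complex.I)) θ := by
    have h1 : HasDerivAt (fun t : ℂ => (r : ℂ) * Complex.exp (t * Complex.I))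
        (z * Complex.I) (θ : ℂ) := by
      refine (((hasDerivAt_id (θ : ℂ)).mul_const Complex.I).cexp.const_mul (r : ℂ)).congr_deriv ?_
      rw [← hzr]; simp; ring
    have h2 : HasDerivAt f (deriv f z) ((r : ℂ) * Complex.exp ((θ : ℂ) * Complex.I)) := by
      rw [hzr]; exact (hf.differentiable z).hasDerivAt
    exact (h2.comp (θ : ℂ) h1).comp_ofReal
  have hd := hpath.norm_sq
  have hle := hanti.derivWithin_nonpos (x := θ)
  have hnhds : Set.Ioo 0 (Real.pi / 2) ∈ nhds θ := Ioo_mem_nhds hθ0 hθ1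
  rw [derivWithin_of_mem_nhds hnhds] at hle
  have e := hd.deriv
  rw [e, hzr, Complex.inner] at hle
  have hne := hf.ne_zero z hre
  have e2 : (starRingEnd ℂ (f z)) * (deriv f z * (z * Complex.I))
      = ((Complex.normSq (f z) : ℝ) : ℂ) * (z * (deriv f z / f z) * Complex.I) := by
    rw [← Complex.mul_conj]; field_simp
  have hns := Complex.normSq_pos.2 hne
  rw [show deriv f z * (z * Complex.I) * (starRingEnd ℂ) (f z) =
    starRingEnd ℂ (f z) * (deriv f z * (z * Complex.I)) by ring] at hle
  rw [e2, Complex.re_ofReal_mul, Complex.mul_I_re] at hle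
  by_contra! hneg
  nlinarith

/-- The function `z ↦ z * f' z / f z` is typically real on the right half-plane. -/
theorem im_mul_logDeriv_mul_im_nonneg (hf : IsLeeYangEntire f) {z : ℂ} (hre : 0 < z.re) :
    0 ≤ (z * (deriv f z / f z)).im * z.im := by
  rcases lt_trichotomy z.im 0 with h | h | h
  · have h1 := hf.im_mul_logDeriv_nonneg (z := starRingEnd ℂ z) (by simpa using hre)
      (by simpa using h)
    rw [hf.conj, hf.deriv_conj, ← map_div₀, ← map_mul, Complex.conj_im] at h1
    nlinarith
  · simp [h]
  · exact mul_nonneg (hf.im_mul_logDeriv_nonneg hre h) h.le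

theorem re_deriv_mul_logDeriv_le (hf : IsLeeYangEntire f) {x : ℝ} (hx : 0 < x) :
    (deriv (fun z => z * (deriv f z / f z)) x).re ≤ 2 * (deriv (deriv f) 0).re * x := by
  have hopen : IsOpen {z : ℂ | 0 < z.re} := isOpen_lt continuous_const Complex.continuous_re
  have hf1 : Differentiable ℂ (deriv f) := hf.differentiable.deriv
  have hqa : ∀ z, f z ≠ 0 → AnalyticAt ℂ (fun z => z * (deriv f z / f z)) z := fun z hz =>
    analyticAt_id.mul ((hf1.analyticAt z).div (hf.differentiable.analyticAt z) hz)
  set q : ℂ → ℂ := fun z => z * (deriv f z / f z) with hq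
  have hqd : DifferentiableOn ℂ q {z | 0 < z.re} := fun z hz =>
    (hqa z (hf.ne_zero z hz)).differentiableAt.differentiableWithinAt
  have hqdd : ∀ t : ℝ, 0 < t → HasDerivAt (fun t : ℝ => (deriv q t).re)
      (deriv (deriv q) t).re t := fun t ht =>
    ((hqa t (hf.ne_zero t (by simpa using ht))).deriv.differentiableAt.hasDerivAt).real_of_complex
  have hanti : AntitoneOn (fun t : ℝ => (deriv q t).re / t) (Set.Ioi 0) := by
    have hder : ∀ t : ℝ, 0 < t → HasDerivAt (fun t : ℝ => (deriv q t).re / t)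
        (((deriv (deriv q) t).re * t - (deriv q t).re * 1) / t ^ 2) t := fun t ht =>
      (hqdd t ht).div (hasDerivAt_id t) ht.ne'
    apply antitoneOn_of_deriv_nonpos (convex_Ioi 0)
    · exact fun t ht => (hder t ht).continuousAt.continuousWithinAt
    · exact fun t ht => (hder t (by simpa using ht)).differentiableAt.differentiableWithinAt
    · intro t ht
      have ht : 0 < t := by simpa using ht
      rw [(hder t ht).deriv]
      apply div_nonpos_of_nonpos_of_nonneg _ (by positivity)
      have := mul_re_deriv_deriv_le_re_deriv hqd
        (fun z hz => hf.im_mul_logDeriv_mul_im_nonneg hz) ht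
      linarith
  have h0 : f 0 ≠ 0 := by rw [hf.map_zero]; exact one_ne_zero
  -- the derivatives at `0`
  have hL : ∀ z, f z ≠ 0 → DifferentiableAt ℂ (fun z => deriv f z / f z) z := fun z hz =>
    (hf1 z).div (hf.differentiable z) hz
  have hLd : HasDerivAt (fun z => deriv f z / f z) (deriv (deriv f) 0) 0 := by
    have := (hf1 0).hasDerivAt.div (hf.differentiable 0).hasDerivAt h0
    refine this.congr_deriv ?_
    simp [hf.map_zero, hf.deriv_zero]
  have hq1 : deriv q =ᶠ[nhds 0]
      fun z => deriv f z / f z + z * deriv (fun z => deriv f z / f z) z := by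
    filter_upwards [hf.differentiable.continuous.continuousAt.eventually_ne h0] with z hz
    have := (hasDerivAt_id z).mul (hL z hz).hasDerivAt
    refine this.deriv.trans ?_
    simp
  have hLa : AnalyticAt ℂ (fun z => deriv f z / f z) 0 :=
    (hf1.analyticAt 0).div (hf.differentiable.analyticAt 0) h0
  have hq2 : HasDerivAt (deriv q) (2 * deriv (deriv f) 0) 0 := by
    refine HasDerivAt.congr_of_eventuallyEq ?_ hq1
    have := hLd.add ((hasDerivAt_id (0 : ℂ)).mul hLa.deriv.differentiableAt.hasDerivAt)
    refine this.congr_deriv ?_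
    rw [hLd.deriv]
    simp
    ring
  have hq10 : deriv q 0 = 0 := by
    rw [hq1.eq_of_nhds]; simp [hf.deriv_zero]
  have hreal : HasDerivAt (fun t : ℝ => (deriv q t).re) (2 * (deriv (deriv f) 0).re) 0 := by
    have := HasDerivAt.real_of_complex (z := 0) (by simpa using hq2)
    simpa using this
  have hlim : Tendsto (fun t : ℝ => (deriv q t).re / t) (nhdsWithin 0 (Set.Ioi 0))
      (nhds (2 * (deriv (deriv f) 0).re)) := by
    have := (hasDerivAt_iff_tendsto_slope.1 hreal).mono_left
      (nhdsWithin_mono 0 (fun t (ht : 0 < t) => (ht.ne' : t ≠ 0)))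
    refine this.congr fun t => ?_
    simp [slope_def_field, hq10]
  rw [← div_le_iff₀ hx]
  refine ge_of_tendsto hlim ?_
  filter_upwards [Ioo_mem_nhdsGT hx] with t ht
  exact hanti ht.1 hx ht.2.le

theorem re_mul_logDeriv_le (hf : IsLeeYangEntire f) {x : ℝ} (hx : 0 ≤ x) :
    ((x : ℂ) * (deriv f x / f x)).re ≤ (deriv (deriv f) 0).re * x ^ 2 := by
  have hne : ∀ t : ℝ, 0 ≤ t → f t ≠ 0 := fun t ht h => by
    have := hf.one_le_norm ht
    rw [h, norm_zero] at this
    linarith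
  have hder : ∀ t : ℝ, 0 ≤ t → HasDerivAt
      (fun t : ℝ => ((t : ℂ) * (deriv f t / f t)).re - (deriv (deriv f) 0).re * t ^ 2)
      ((deriv (fun z => z * (deriv f z / f z)) t).re - (deriv (deriv f) 0).re * (2 * t)) t := by
    intro t ht
    have h1 : DifferentiableAt ℂ (fun z => z * (deriv f z / f z)) t :=
      differentiableAt_id.mul ((hf.differentiable.deriv _).div (hf.differentiable _) (hne t ht))
    refine (h1.hasDerivAt.real_of_complex.sub ((hasDerivAt_pow 2 t).const_mul _)).congr_deriv ?_
    simp
  have hanti : AntitoneOn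
      (fun t : ℝ => ((t : ℂ) * (deriv f t / f t)).re - (deriv (deriv f) 0).re * t ^ 2)
      (Set.Ici 0) := by
    apply antitoneOn_of_deriv_nonpos (convex_Ici 0)
    · exact fun t ht => (hder t ht).continuousAt.continuousWithinAt
    · intro t ht
      rw [interior_Ici] at ht
      exact (hder t (le_of_lt ht)).differentiableAt.differentiableWithinAt
    · intro t ht
      rw [interior_Ici] at ht
      rw [(hder t (le_of_lt ht)).deriv]
      linarith [hf.re_deriv_mul_logDeriv_le ht]
  have := hanti (Set.self_mem_Ici) hx hx
  simp at this
  simpa using this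

/-- On the real axis `f` grows at most like the Gaussian with the same second derivative at `0`. -/
theorem re_le_exp (hf : IsLeeYangEntire f) {x : ℝ} (hx : 0 ≤ x) :
    (f x).re ≤ Real.exp ((deriv (deriv f) 0).re * x ^ 2 / 2) := by
  set σ := (deriv (deriv f) 0).re with hσ
  have hder : ∀ t : ℝ, HasDerivAt (fun t : ℝ => (f t).re * Real.exp (-(σ * t ^ 2 / 2)))
      ((deriv f t).re * Real.exp (-(σ * t ^ 2 / 2))
        + (f t).re * (Real.exp (-(σ * t ^ 2 / 2)) * (-(σ * t)))) t := by
    intro t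
    have h2 : HasDerivAt (fun t : ℝ => -(σ * t ^ 2 / 2)) (-(σ * t)) t := by
      refine ((((hasDerivAt_pow 2 t).const_mul σ).div_const 2).neg).congr_deriv ?_
      simp; ring
    exact (hf.differentiable t).hasDerivAt.real_of_complex.mul h2.exp
  have hanti : AntitoneOn (fun t : ℝ => (f t).re * Real.exp (-(σ * t ^ 2 / 2))) (Set.Ici 0) := by
    apply antitoneOn_of_deriv_nonpos (convex_Ici 0)
    · exact fun t _ => (hder t).continuousAt.continuousWithinAt
    · exact fun t _ => (hder t).differentiableAt.differentiableWithinAt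
    · intro t ht
      rw [interior_Ici] at ht
      have ht : 0 < t := ht
      rw [(hder t).deriv]
      have h1 := hf.re_mul_logDeriv_le ht.le
      have h2 := hf.one_le_re ht.le
      have h3 : f t = ((f t).re : ℂ) := Complex.ext (by simp) (by simp [hf.ofReal_im])
      rw [h3, Complex.re_ofReal_mul, Complex.div_ofReal_re, ← hσ] at h1
      have h4 : (deriv f t).re ≤ σ * t * (f t).re := by
        rw [← div_le_iff₀ (by linarith)]
        by_contra! hneg
        nlinarith
      have h5 := Real.exp_pos (-(σ * t ^ 2 / 2))
      nlinarith
  have := hanti (Set.self_mem_Ici) hx hx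
  simp [hf.map_zero, Real.exp_neg] at this
  rwa [← div_eq_mul_inv, div_le_one (Real.exp_pos _)] at this

/-- A lower bound for `f` on a segment of the imaginary axis extends to a disc. -/
theorem half_le_norm_of_norm_le (hf : IsLeeYangEntire f) {δ : ℝ}
    (h : ∀ y : ℝ, 0 ≤ y → y ≤ δ → 1 / 2 ≤ ‖f (y * Complex.I)‖) {z : ℂ} (hz : ‖z‖ ≤ δ) :
    1 / 2 ≤ ‖f z‖ := by
  have h1 : ∀ w : ℂ, ‖w‖ ≤ δ → 0 ≤ w.re → 0 ≤ w.im → 1 / 2 ≤ ‖f w‖ := by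
    intro w hw hre him
    rcases hre.eq_or_lt with hre | hre
    · have e : w = w.im * Complex.I := by apply Complex.ext <;> simp [← hre]
      rw [e]
      exact h _ him ((le_abs_self _).trans ((Complex.abs_im_le_norm w).trans hw))
    · have hw0 : 0 < ‖w‖ := hre.trans_le (Complex.re_le_norm w)
      have hθ1 := (Complex.abs_arg_lt_pi_div_two_iff.2 (Or.inl hre) |> abs_lt.1).2
      have := hf.norm_rotate_le (θ := w.arg) (φ := Real.pi / 2) hw0
        (Complex.arg_nonneg_iff.2 him) hθ1.le (by linarith)
      rw [Complex.norm_mul_exp_arg_mul_I] at this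
      refine le_trans ?_ this
      have e : ((Real.pi / 2 : ℝ) : ℂ) = Real.pi / 2 := by push_cast; rfl
      rw [e, Complex.exp_pi_div_two_mul_I]
      exact h _ hw0.le hw
  have h2 : ∀ w : ℂ, ‖w‖ ≤ δ → 0 ≤ w.re → 1 / 2 ≤ ‖f w‖ := by
    intro w hw hre
    rcases le_total 0 w.im with him | him
    · exact h1 w hw hre him
    · have := h1 (starRingEnd ℂ w) (by simpa using hw) (by simpa using hre) (by simpa using him)
      rwa [hf.conj, Complex.norm_conj] at this
  rcases le_total 0 z.re with hre | hre
  · exact h2 z hz hre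
  · have := h2 (-z) (by simpa using hz) (by simpa using hre)
    rwa [hf.even] at this

/-- A lower bound for `f` on a segment of the imaginary axis gives a Gaussian upper bound on the
real axis, with a constant depending only on the length of the segment. -/
theorem re_le_exp_of_half_le_norm (hf : IsLeeYangEntire f) {δ : ℝ} (hδ : 0 < δ)
    (h : ∀ y : ℝ, 0 ≤ y → y ≤ δ → 1 / 2 ≤ ‖f (y * Complex.I)‖) {x : ℝ} (hx : 0 ≤ x) :
    (f x).re ≤ Real.exp (128 / δ ^ 2 * x ^ 2) := by
  have hlow : ∀ z ∈ Metric.ball (0 : ℂ) δ, 1 / 2 ≤ ‖f z‖ := fun z hz =>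
    hf.half_le_norm_of_norm_le h (by simpa using (Metric.mem_ball.1 hz).le)
  have hne : ∀ z ∈ Metric.ball (0 : ℂ) δ, f z ≠ 0 := fun z hz h0 => by
    have := hlow z hz
    rw [h0, norm_zero] at this
    norm_num at this
  have hup : ∀ z : ℂ, ‖z‖ ≤ δ / 8 → ‖f z‖ ≤ 2 := by
    intro z hz
    have hzb : z ∈ Metric.ball (0 : ℂ) δ := by simp; linarith
    have hs := Complex.dist_le_div_mul_dist_of_mapsTo_ball (f := fun z => (f z)⁻¹) (c := 0)
      (R₁ := δ) (R₂ := 3) (z := z) (hf.differentiable.differentiableOn.inv hne) (by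
        intro w hw
        rw [Metric.mem_closedBall, dist_eq_norm, hf.map_zero, inv_one]
        have h1 : ‖(f w)⁻¹‖ ≤ 2 := by
          rw [norm_inv]
          refine (inv_anti₀ (by norm_num) (hlow w hw)).trans (by norm_num)
        have := norm_sub_le (f w)⁻¹ 1
        rw [norm_one] at this
        linarith) hzb
    rw [dist_eq_norm, dist_zero_right, hf.map_zero, inv_one] at hs
    have h2 : 3 / δ * ‖z‖ ≤ 1 / 2 := by
      rw [div_mul_eq_mul_div, div_le_iff₀ hδ]
      linarith
    have h3 : 1 / 2 ≤ ‖(f z)⁻¹‖ := by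
      have := norm_sub_norm_le (1 : ℂ) (1 - (f z)⁻¹)
      rw [norm_one, sub_sub_cancel, norm_sub_rev] at this
      linarith
    rw [norm_inv] at h3
    have h4 : 0 < ‖f z‖ := norm_pos_iff.2 (hne z hzb)
    rw [div_le_iff₀ (by norm_num), inv_mul_eq_div, le_div_iff₀ h4] at h3
    linarith
  have hc := Complex.norm_iteratedDeriv_le_of_forall_mem_sphere_norm_le (c := 0) (R := δ / 8)
    (C := 2) (f := f) 2 (by positivity) hf.differentiable.diffContOnCl
    (fun z hz => hup z (by simpa using (mem_sphere_iff_norm.1 hz).le))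
  rw [iteratedDeriv_succ, iteratedDeriv_one] at hc
  refine (hf.re_le_exp hx).trans (Real.exp_le_exp.2 ?_)
  have h5 : (deriv (deriv f) 0).re ≤ 256 / δ ^ 2 := by
    refine (Complex.re_le_norm _).trans (hc.trans (le_of_eq ?_))
    simp [Nat.factorial]
    field_simp
    norm_num
  calc _ ≤ 256 / δ ^ 2 * x ^ 2 / 2 := by gcongr
    _ = _ := by ring

/-- At a point of the right half-plane, all functions with a common Gaussian upper bound have a
common positive lower bound. -/
theorem exists_pos_le_norm {K : ℝ} (hK : 0 < K) {z : ℂ} (hz : 0 < z.re) :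
    ∃ κ : ℝ, 0 < κ ∧ ∀ f : ℂ → ℂ, IsLeeYangEntire f →
      (∀ x : ℝ, 0 ≤ x → (f x).re ≤ Real.exp (K * x ^ 2)) → κ ≤ ‖f z‖ := by
  set c : ℝ := Complex.normSq z / z.re with hc
  have hns : 0 < Complex.normSq z := Complex.normSq_pos.2 (by rintro rfl; simp at hz)
  have hc0 : 0 < c := div_pos hns hz
  have hcz : c * z.re = Complex.normSq z := by rw [hc]; field_simp
  have hzb : z ∈ Metric.ball (c : ℂ) c := by
    rw [Metric.mem_ball, dist_eq_norm, ← abs_of_nonneg (norm_nonneg (z - c))]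
    nth_rw 2 [← abs_of_pos hc0]
    rw [← sq_lt_sq, ← Complex.normSq_eq_norm_sq, Complex.normSq_apply]
    rw [Complex.normSq_apply] at hcz hns
    simp
    nlinarith
  refine ⟨_, Real.exp_pos _, fun f hf hb => exp_le_norm_of_ne_zero (M := K * (2 * c) ^ 2)
    hf.differentiable.differentiableOn ?_ (by positivity) ?_ (hf.one_le_norm hc0.le) hzb⟩
  all_goals
    intro v hv
    have h2 : ‖v - c‖ < c := by simpa [dist_eq_norm] using hv
    have h3 := abs_lt.1 ((Complex.abs_re_le_norm _).trans_lt h2)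
    simp at h3
  · exact hf.ne_zero v (by linarith)
  · exact (hf.norm_le v (2 * c) (by rw [abs_le]; constructor <;> linarith)).trans
      (hb _ (by linarith))

end IsLeeYangEntire

open ProbabilityTheory

theorem exp_mul_le_exp_mul_exp_sq {b : ℝ} (hb : 0 < b) (t x : ℝ) :
    Real.exp (t * x) ≤ Real.exp (t ^ 2 / (4 * b)) * Real.exp (b * x ^ 2) := by
  rw [← Real.exp_add]
  refine Real.exp_le_exp.2 ?_
  have h : t ^ 2 / (4 * b) + b * x ^ 2 - t * x = b * (x - t / (2 * b)) ^ 2 := by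
    field_simp
    ring
  nlinarith [mul_nonneg hb.le (sq_nonneg (x - t / (2 * b)))]

theorem integrable_exp_mul_of_integrable_exp_sq {μ : Measure ℝ} {b : ℝ} (hb : 0 < b)
    (h : Integrable (fun x : ℝ => Real.exp (b * x ^ 2)) μ) (t : ℝ) :
    Integrable (fun x : ℝ => Real.exp (t * x)) μ := by
  refine (h.const_mul (Real.exp (t ^ 2 / (4 * b)))).mono'
    (by fun_prop) (Eventually.of_forall fun x => ?_)
  rw [Real.norm_eq_abs, Real.abs_exp]
  exact exp_mul_le_exp_mul_exp_sq hb t x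

theorem complexMGF_neg_of_map_neg_eq {μ : Measure ℝ} (h : μ.map (fun x : ℝ => -x) = μ) (z : ℂ) :
    complexMGF id μ (-z) = complexMGF id μ z := by
  have h1 : ∫ x : ℝ, Complex.exp (z * (x : ℂ)) ∂μ
      = ∫ x : ℝ, Complex.exp (z * ((-x : ℝ) : ℂ)) ∂μ := by
    conv_lhs => rw [← h]
    exact integral_map (by fun_prop) (by fun_prop)
  change ∫ x : ℝ, Complex.exp (-z * (x : ℂ)) ∂μ = ∫ x : ℝ, Complex.exp (z * (x : ℂ)) ∂μ
  rw [h1]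
  congr with x
  push_cast
  ring_nf

theorem mgf_eq_integral_cosh {μ : Measure ℝ} (h : μ.map (fun x : ℝ => -x) = μ)
    (hint : ∀ t : ℝ, Integrable (fun x : ℝ => Real.exp (t * x)) μ) (t : ℝ) :
    mgf id μ t = ∫ x : ℝ, Real.cosh (t * x) ∂μ := by
  have h1 : mgf id μ (-t) = mgf id μ t := by
    rw [← re_complexMGF_ofReal, ← re_complexMGF_ofReal, Complex.ofReal_neg,
      complexMGF_neg_of_map_neg_eq h]
  have h2 : ∫ x : ℝ, Real.cosh (t * x) ∂μ = (mgf id μ t + mgf id μ (-t)) / 2 := by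
    simp only [mgf, id]
    rw [← integral_add (hint t) (hint (-t)), ← integral_div]
    congr with x
    rw [Real.cosh_eq, neg_mul]
  rw [h2, h1]
  ring

theorem IsLeeYang.isLeeYangEntire {μ : Measure ℝ} [IsProbabilityMeasure μ] (h : IsLeeYang μ) :
    IsLeeYangEntire (complexMGF id μ) := by
  obtain ⟨hsymm, ⟨b, hb, hint⟩, hne⟩ := h
  have hexp := integrable_exp_mul_of_integrable_exp_sq hb hint
  have huniv : integrableExpSet id μ = Set.univ := Set.eq_univ_of_forall hexp
  have hcosh (t : ℝ) : Integrable (fun x : ℝ => Real.cosh (t * x)) μ := by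
    refine (((hexp t).add (hexp (-t))).div_const 2).congr (Eventually.of_forall fun x => ?_)
    simp [Real.cosh_eq]
  refine ⟨?_, complexMGF_neg_of_map_neg_eq hsymm, fun z => ?_, fun z x hx => ?_, ?_,
    fun z hz => hne z hz.ne', ?_⟩
  · have := differentiableOn_complexMGF (X := id) (μ := μ)
    refine differentiableOn_univ.1 (this.mono fun z _ => ?_)
    simp [huniv]
  · change ∫ x : ℝ, Complex.exp (starRingEnd ℂ z * (x : ℂ)) ∂μ
      = starRingEnd ℂ (∫ x : ℝ, Complex.exp (z * (x : ℂ)) ∂μ)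
    rw [← integral_conj]
    congr with x
    rw [← Complex.exp_conj, map_mul, Complex.conj_ofReal]
  · rw [re_complexMGF_ofReal]
    refine norm_complexMGF_le_mgf.trans ?_
    rw [mgf_eq_integral_cosh hsymm hexp, mgf_eq_integral_cosh hsymm hexp]
    refine integral_mono (hcosh _) (hcosh _) fun y => Real.cosh_le_cosh.2 ?_
    rw [abs_mul, abs_mul]
    exact mul_le_mul_of_nonneg_right (hx.trans (le_abs_self x)) (abs_nonneg y)
  · set I := ∫ x : ℝ, Real.exp (b * x ^ 2) ∂μ
    have hI : 0 ≤ I := integral_nonneg fun x => (Real.exp_pos _).le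
    have hq : 0 < 1 / (4 * b) := by positivity
    refine ⟨I + 1 / (4 * b), by positivity, fun z => ?_⟩
    calc ‖complexMGF id μ z‖ ≤ mgf id μ z.re := norm_complexMGF_le_mgf
      _ ≤ ∫ x : ℝ, Real.exp (z.re ^ 2 / (4 * b)) * Real.exp (b * x ^ 2) ∂μ :=
          integral_mono (hexp _) (hint.const_mul _) fun x => exp_mul_le_exp_mul_exp_sq hb _ x
      _ = Real.exp (z.re ^ 2 / (4 * b)) * I := integral_const_mul _ _
      _ ≤ Real.exp (z.re ^ 2 / (4 * b)) * Real.exp I := by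
          gcongr
          linarith [Real.add_one_le_exp I]
      _ ≤ Real.exp ((I + 1 / (4 * b)) * (1 + ‖z‖ ^ 2)) := by
          rw [← Real.exp_add]
          refine Real.exp_le_exp.2 ?_
          have h1 : z.re ^ 2 ≤ ‖z‖ ^ 2 := by
            rw [← sq_abs]
            gcongr
            exact Complex.abs_re_le_norm z
          have h2 : z.re ^ 2 / (4 * b) ≤ 1 / (4 * b) * ‖z‖ ^ 2 := by
            rw [div_eq_inv_mul, one_div]
            gcongr
          nlinarith [mul_nonneg hI (sq_nonneg ‖z‖)]
  · simp [complexMGF]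

theorem lintegral_exp_mul_sub_sq {a : ℝ} (ha : 0 < a) (x : ℝ) :
    ∫⁻ t : ℝ, ENNReal.ofReal (Real.exp (t * x - a * t ^ 2))
      = ENNReal.ofReal (Real.exp (x ^ 2 / (4 * a)))
        * ∫⁻ t : ℝ, ENNReal.ofReal (Real.exp (-a * t ^ 2)) := by
  rw [← lintegral_sub_right_eq_self (fun t : ℝ => ENNReal.ofReal (Real.exp (-a * t ^ 2)))
    (x / (2 * a)), ← lintegral_const_mul _ (by fun_prop)]
  congr with t
  rw [← ENNReal.ofReal_mul (Real.exp_pos _).le, ← Real.exp_add]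
  congr 2
  field_simp
  ring

theorem lintegral_exp_neg_mul_sq_lt_top {a : ℝ} (ha : 0 < a) :
    ∫⁻ t : ℝ, ENNReal.ofReal (Real.exp (-a * t ^ 2)) < ⊤ :=
  (integrable_exp_neg_mul_sq ha).lintegral_lt_top

theorem lintegral_exp_neg_mul_sq_ne_zero (a : ℝ) :
    ∫⁻ t : ℝ, ENNReal.ofReal (Real.exp (-a * t ^ 2)) ≠ 0 := by
  refine ((lintegral_pos_iff_support (by fun_prop)).2 ?_).ne'
  have h : Function.support (fun t : ℝ => ENNReal.ofReal (Real.exp (-a * t ^ 2))) = Set.univ :=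
    Set.eq_univ_of_forall fun t => (ENNReal.ofReal_pos.2 (Real.exp_pos _)).ne'
  rw [h]
  simp

/-- A Gaussian bound on the moment generating function gives a bound on the exponential square
moment which does not depend on the measure. -/
theorem exists_lintegral_exp_sq_le {K : ℝ} (hK : 0 < K) :
    ∃ M : ENNReal, M < ⊤ ∧ ∀ μ : Measure ℝ, IsProbabilityMeasure μ →
      (∀ t, Integrable (fun x : ℝ => Real.exp (t * x)) μ) →
      (∀ t, mgf id μ t ≤ Real.exp (K * t ^ 2)) →
      ∫⁻ x, ENNReal.ofReal (Real.exp (1 / (8 * K) * x ^ 2)) ∂μ ≤ M := by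
  set c := ∫⁻ t : ℝ, ENNReal.ofReal (Real.exp (-(2 * K) * t ^ 2))
  have hc0 : c ≠ 0 := lintegral_exp_neg_mul_sq_ne_zero _
  have hc : c < ⊤ := lintegral_exp_neg_mul_sq_lt_top (by positivity)
  refine ⟨(∫⁻ t : ℝ, ENNReal.ofReal (Real.exp (-K * t ^ 2))) / c,
    ENNReal.div_lt_top (lintegral_exp_neg_mul_sq_lt_top hK).ne hc0, fun μ _ hint hmgf => ?_⟩
  rw [ENNReal.le_div_iff_mul_le (Or.inl hc0) (Or.inl hc.ne), ← lintegral_mul_const _ (by fun_prop)]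
  calc ∫⁻ x, ENNReal.ofReal (Real.exp (1 / (8 * K) * x ^ 2)) * c ∂μ
      = ∫⁻ x, (∫⁻ t : ℝ, ENNReal.ofReal (Real.exp (t * x - 2 * K * t ^ 2))) ∂μ := by
        congr with x
        rw [lintegral_exp_mul_sub_sq (by positivity)]
        congr 3
        field_simp
        ring
    _ = ∫⁻ t : ℝ, ∫⁻ x, ENNReal.ofReal (Real.exp (t * x - 2 * K * t ^ 2)) ∂μ :=
        lintegral_lintegral_swap (by fun_prop)
    _ ≤ ∫⁻ t : ℝ, ENNReal.ofReal (Real.exp (-K * t ^ 2)) := by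
        refine lintegral_mono fun t => ?_
        have h1 : Integrable (fun x : ℝ => Real.exp (t * x - 2 * K * t ^ 2)) μ := by
          simp only [Real.exp_sub]
          exact (hint t).div_const _
        change ∫⁻ x, ENNReal.ofReal (Real.exp (t * x - 2 * K * t ^ 2)) ∂μ ≤ _
        rw [← ofReal_integral_eq_lintegral_ofReal h1
          (Eventually.of_forall fun x => (Real.exp_pos _).le)]
        refine ENNReal.ofReal_le_ofReal ?_
        simp only [Real.exp_sub]
        rw [integral_div, div_le_iff₀ (Real.exp_pos _), ← Real.exp_add]
        refine (hmgf t).trans (Real.exp_le_exp.2 (le_of_eq ?_))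
        ring

/-- Square moments bounded uniformly make weak convergence extend to a continuous,
not necessarily bounded, integrand. -/
theorem tendsto_integral_of_integral_sq_le {μ : ℕ → Measure ℝ} [∀ n, IsProbabilityMeasure (μ n)]
    {ν : Measure ℝ} [IsProbabilityMeasure ν]
    (hconv : ∀ g : BoundedContinuousFunction ℝ ℝ,
      Tendsto (fun n => ∫ x, g x ∂(μ n)) atTop (nhds (∫ x, g x ∂ν)))
    {g : ℝ → ℝ} (hg : Continuous g) {B : ℝ}
    (hμi : ∀ᶠ n in atTop, Integrable (fun x => g x ^ 2) (μ n))
    (hμ : ∀ᶠ n in atTop, ∫ x, g x ^ 2 ∂(μ n) ≤ B)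
    (hνi : Integrable (fun x => g x ^ 2) ν) (hν : ∫ x, g x ^ 2 ∂ν ≤ B) :
    Tendsto (fun n => ∫ x, g x ∂(μ n)) atTop (nhds (∫ x, g x ∂ν)) := by
  have hB : 0 ≤ B := (integral_nonneg fun x => sq_nonneg (g x)).trans hν
  have trunc (m : ℝ) (hm : 0 < m) (ρ : Measure ℝ) [IsProbabilityMeasure ρ]
      (hi : Integrable (fun x => g x ^ 2) ρ) (hρ : ∫ x, g x ^ 2 ∂ρ ≤ B) :
      |(∫ x, g x ∂ρ) - ∫ x, max (-m) (min m (g x)) ∂ρ| ≤ B / m := by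
    have hgi : Integrable g ρ := by
      refine (hi.add (integrable_const 1)).mono' (by fun_prop) (Eventually.of_forall fun x => ?_)
      rw [Real.norm_eq_abs, abs_le, Pi.add_apply]
      constructor <;> nlinarith [sq_nonneg (g x - 1), sq_nonneg (g x + 1)]
    have hti : Integrable (fun x => max (-m) (min m (g x))) ρ := by
      refine (integrable_const m).mono' (by fun_prop) (Eventually.of_forall fun x => ?_)
      rw [Real.norm_eq_abs, abs_le]
      exact ⟨le_max_left _ _, max_le (by linarith) (min_le_left _ _)⟩
    rw [← integral_sub hgi hti]
    refine (abs_integral_le_integral_abs).trans ?_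
    calc ∫ x, |g x - max (-m) (min m (g x))| ∂ρ ≤ ∫ x, g x ^ 2 / m ∂ρ := by
          refine integral_mono (hgi.sub hti).abs (hi.div_const m) fun x => ?_
          change |g x - max (-m) (min m (g x))| ≤ g x ^ 2 / m
          rw [le_div_iff₀ hm]
          rcases le_total (g x) m with h1 | h1
          · rcases le_total (-m) (g x) with h2 | h2
            · rw [min_eq_right h1, max_eq_right h2]
              simpa using sq_nonneg (g x)
            · rw [min_eq_right h1, max_eq_left h2, abs_of_nonpos (by linarith)]
              nlinarith
          · rw [min_eq_left h1, max_eq_right (by linarith), abs_of_nonneg (by linarith)]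
            nlinarith
      _ ≤ B / m := by
          rw [integral_div]
          gcongr
  rw [Metric.tendsto_atTop']
  intro ε hε
  set m := 3 * (B + 1) / ε
  have hm : 0 < m := by positivity
  have hBm : B / m < ε / 3 := by
    rw [div_lt_iff₀ hm]
    simp only [m]
    field_simp
    linarith
  let G : BoundedContinuousFunction ℝ ℝ := BoundedContinuousFunction.ofNormedAddCommGroup
    (fun x => max (-m) (min m (g x))) (by fun_prop) m fun x => by
      rw [Real.norm_eq_abs, abs_le]
      exact ⟨le_max_left _ _, max_le (by linarith) (min_le_left _ _)⟩
  have hG := (Metric.tendsto_nhds.1 (hconv G)) (ε / 3) (by positivity)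
  obtain ⟨N, hN⟩ := eventually_atTop.1 (hμi.and (hμ.and hG))
  refine ⟨N, fun n hn => ?_⟩
  obtain ⟨h1, h2, h3⟩ := hN n hn.le
  have h4 := trunc m hm (μ n) h1 h2
  have h5 := trunc m hm ν hνi hν
  have h6 : |(∫ x, max (-m) (min m (g x)) ∂(μ n)) - ∫ x, max (-m) (min m (g x)) ∂ν| < ε / 3 := h3
  rw [Real.dist_eq]
  rw [abs_le] at h4 h5
  rw [abs_lt] at h6 ⊢
  constructor <;> linarith [h4.1, h4.2, h5.1, h5.2, h6.1, h6.2]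

theorem map_neg_eq_of_tendsto {μ : ℕ → Measure ℝ} {ν : Measure ℝ} [IsProbabilityMeasure ν]
    (hconv : ∀ g : BoundedContinuousFunction ℝ ℝ,
      Tendsto (fun n => ∫ x, g x ∂(μ n)) atTop (nhds (∫ x, g x ∂ν)))
    (hμ : ∀ n, (μ n).map (fun x : ℝ => -x) = μ n) :
    ν.map (fun x : ℝ => -x) = ν := by
  have : IsProbabilityMeasure (ν.map (fun x : ℝ => -x)) :=
    Measure.isProbabilityMeasure_map (by fun_prop)
  refine ext_of_forall_integral_eq_of_IsFiniteMeasure fun g => ?_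
  rw [integral_map (by fun_prop) (by fun_prop)]
  let g' : BoundedContinuousFunction ℝ ℝ := g.compContinuous ⟨fun x => -x, by fun_prop⟩
  refine tendsto_nhds_unique ((hconv g').congr fun n => ?_) (hconv g)
  conv_rhs => rw [← hμ n]
  rw [integral_map (by fun_prop) (by fun_prop)]
  rfl

/-- Along a weakly convergent sequence, the characteristic functions are eventually bounded below
on a common neighbourhood of the origin. -/
theorem exists_half_le_norm_complexMGF {μ : ℕ → Measure ℝ} [∀ n, IsProbabilityMeasure (μ n)]
    {ν : Measure ℝ} [IsProbabilityMeasure ν]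
    (hconv : ∀ g : BoundedContinuousFunction ℝ ℝ,
      Tendsto (fun n => ∫ x, g x ∂(μ n)) atTop (nhds (∫ x, g x ∂ν))) :
    ∃ δ : ℝ, 0 < δ ∧ ∀ᶠ n in atTop, ∀ y : ℝ, 0 ≤ y → y ≤ δ →
      1 / 2 ≤ ‖complexMGF id (μ n) (y * Complex.I)‖ := by
  have hnn (δ : ℝ) (hδ : 0 ≤ δ) (x : ℝ) : 0 ≤ min 2 (δ * |x|) := by positivity
  let G (δ : ℝ) (hδ : 0 ≤ δ) : BoundedContinuousFunction ℝ ℝ :=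
    BoundedContinuousFunction.ofNormedAddCommGroup (fun x => min 2 (δ * |x|)) (by fun_prop) 2
      fun x => by
        rw [Real.norm_eq_abs, abs_of_nonneg (hnn δ hδ x)]
        exact min_le_left _ _
  have hlim : Tendsto (fun k : ℕ => ∫ x, min 2 (1 / ((k : ℝ) + 1) * |x|) ∂ν) atTop
      (nhds (∫ _, (0 : ℝ) ∂ν)) := by
    refine tendsto_integral_of_dominated_convergence (fun _ => 2) (fun k => by fun_prop)
      (integrable_const 2) (fun k => Eventually.of_forall fun x => ?_)
      (Eventually.of_forall fun x => ?_)
    · rw [Real.norm_eq_abs, abs_of_nonneg (hnn _ (by positivity) x)]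
      exact min_le_left _ _
    · have h1 := (tendsto_one_div_add_atTop_nhds_zero_nat (𝕜 := ℝ)).mul_const |x|
      have h2 := (tendsto_const_nhds (x := (2 : ℝ))).min h1
      simpa using h2
  rw [integral_zero] at hlim
  obtain ⟨k, hk⟩ := (hlim.eventually (gt_mem_nhds (by norm_num : (0 : ℝ) < 1 / 2))).exists
  set δ : ℝ := 1 / ((k : ℝ) + 1)
  have hδ : 0 < δ := by positivity
  refine ⟨δ, hδ, ?_⟩
  filter_upwards [(hconv (G δ hδ.le)).eventually (gt_mem_nhds hk)] with n hn y hy0 hy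
  have hint : Integrable (fun x : ℝ => Complex.exp (y * Complex.I * x)) (μ n) := by
    refine (integrable_const (1 : ℝ)).mono' (by fun_prop) (Eventually.of_forall fun x => ?_)
    simp [Complex.norm_exp]
  have h1 : ‖complexMGF id (μ n) (y * Complex.I) - 1‖ ≤ ∫ x, min 2 (δ * |x|) ∂(μ n) := by
    have h2 : complexMGF id (μ n) (y * Complex.I) - 1
        = ∫ x : ℝ, (Complex.exp (y * Complex.I * x) - 1) ∂(μ n) := by
      rw [integral_sub hint (integrable_const 1)]
      simp [complexMGF]
    rw [h2]
    refine norm_integral_le_of_norm_le ((G δ hδ.le).integrable (μ n))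
      (Eventually.of_forall fun x => ?_)
    have h3 : (y * Complex.I * x : ℂ) = Complex.I * ((y * x : ℝ) : ℂ) := by
      push_cast
      ring
    rw [h3]
    refine le_min ?_ (Real.norm_exp_I_mul_ofReal_sub_one_le.trans ?_)
    · refine (norm_sub_le _ _).trans ?_
      rw [mul_comm, Complex.norm_exp_ofReal_mul_I]
      norm_num
    · rw [Real.norm_eq_abs, abs_mul, abs_of_nonneg hy0]
      gcongr
  have h4 : ∫ x, min 2 (δ * |x|) ∂(μ n) < 1 / 2 := hn
  have h5 := norm_sub_norm_le (1 : ℂ) (1 - complexMGF id (μ n) (y * Complex.I))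
  rw [sub_sub_cancel, norm_one, norm_sub_rev] at h5
  linarith

theorem integrable_exp_sq_of_tendsto {μ : ℕ → Measure ℝ} [∀ n, IsProbabilityMeasure (μ n)]
    {ν : Measure ℝ} [IsProbabilityMeasure ν]
    (hconv : ∀ g : BoundedContinuousFunction ℝ ℝ,
      Tendsto (fun n => ∫ x, g x ∂(μ n)) atTop (nhds (∫ x, g x ∂ν)))
    {b : ℝ} {M : ENNReal} (hM : M < ⊤)
    (h : ∀ᶠ n in atTop, ∫⁻ x, ENNReal.ofReal (Real.exp (b * x ^ 2)) ∂(μ n) ≤ M) :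
    Integrable (fun x : ℝ => Real.exp (b * x ^ 2)) ν := by
  let P (n : ℕ) : ProbabilityMeasure ℝ := ⟨μ n, inferInstance⟩
  let Q : ProbabilityMeasure ℝ := ⟨ν, inferInstance⟩
  have hPQ : Tendsto P atTop (nhds Q) :=
    ProbabilityMeasure.tendsto_iff_forall_integral_tendsto.2 hconv
  have h1 : ∫⁻ x, ENNReal.ofReal (Real.exp (b * x ^ 2)) ∂ν
      ≤ atTop.liminf fun n => ∫⁻ x, ENNReal.ofReal (Real.exp (b * x ^ 2)) ∂(μ n) :=
    lintegral_le_liminf_lintegral_of_forall_isOpen_measure_le_liminf_measure (by fun_prop)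
      (fun x => (Real.exp_pos _).le)
      fun G hG => ProbabilityMeasure.le_liminf_measure_open_of_tendsto hPQ hG
  have h2 : (atTop.liminf fun n => ∫⁻ x, ENNReal.ofReal (Real.exp (b * x ^ 2)) ∂(μ n)) ≤ M :=
    (liminf_le_liminf h).trans (liminf_const M).le
  exact (lintegral_ofReal_ne_top_iff_integrable (by fun_prop)
    (Eventually.of_forall fun x => (Real.exp_pos _).le)).1 ((h1.trans h2).trans_lt hM).ne

theorem tendsto_complexMGF {μ : ℕ → Measure ℝ} [∀ n, IsProbabilityMeasure (μ n)]
    {ν : Measure ℝ} [IsProbabilityMeasure ν]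
    (hconv : ∀ g : BoundedContinuousFunction ℝ ℝ,
      Tendsto (fun n => ∫ x, g x ∂(μ n)) atTop (nhds (∫ x, g x ∂ν)))
    (hμ : ∀ n (t : ℝ), Integrable (fun x : ℝ => Real.exp (t * x)) (μ n))
    (hν : ∀ t : ℝ, Integrable (fun x : ℝ => Real.exp (t * x)) ν) {B : ℝ → ℝ}
    (hB : ∀ᶠ n in atTop, ∀ t, mgf id (μ n) t ≤ B t) (z : ℂ) :
    Tendsto (fun n => complexMGF id (μ n) z) atTop (nhds (complexMGF id ν z)) := by
  have key (L : ℂ →L[ℝ] ℝ) (hL : ∀ w, |L w| ≤ ‖w‖) :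
      Tendsto (fun n => L (complexMGF id (μ n) z)) atTop (nhds (L (complexMGF id ν z))) := by
    have hle (x : ℝ) : L (Complex.exp (z * x)) ^ 2 ≤ Real.exp (2 * z.re * x) := by
      have h1 := hL (Complex.exp (z * x))
      rw [Complex.norm_exp, Complex.re_mul_ofReal] at h1
      calc L (Complex.exp (z * x)) ^ 2 = |L (Complex.exp (z * x))| ^ 2 := (sq_abs _).symm
        _ ≤ Real.exp (z.re * x) ^ 2 := by gcongr
        _ = Real.exp (2 * z.re * x) := by
            rw [← Real.exp_nat_mul]
            push_cast
            ring_nf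
    have hcont : Continuous fun x : ℝ => L (Complex.exp (z * x)) := by fun_prop
    have hsq (ρ : Measure ℝ) (hρ : ∀ t : ℝ, Integrable (fun x : ℝ => Real.exp (t * x)) ρ) :
        Integrable (fun x : ℝ => L (Complex.exp (z * x)) ^ 2) ρ := by
      refine (hρ (2 * z.re)).mono' (by fun_prop) (Eventually.of_forall fun x => ?_)
      rw [Real.norm_eq_abs, abs_of_nonneg (sq_nonneg _)]
      exact hle x
    have hbound (ρ : Measure ℝ) (hρ : ∀ t : ℝ, Integrable (fun x : ℝ => Real.exp (t * x)) ρ) :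
        ∫ x : ℝ, L (Complex.exp (z * x)) ^ 2 ∂ρ ≤ mgf id ρ (2 * z.re) :=
      integral_mono (hsq ρ hρ) (hρ _) hle
    have hL_integral (ρ : Measure ℝ)
        (hρ : ∀ t : ℝ, Integrable (fun x : ℝ => Real.exp (t * x)) ρ) :
        ∫ x : ℝ, L (Complex.exp (z * x)) ∂ρ = L (complexMGF id ρ z) := by
      refine L.integral_comp_comm ?_
      refine (hρ z.re).mono' (by fun_prop) (Eventually.of_forall fun x => ?_)
      rw [Complex.norm_exp, Complex.re_mul_ofReal]
    rw [← hL_integral ν hν]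
    simp only [← hL_integral (μ _) (hμ _)]
    refine tendsto_integral_of_integral_sq_le hconv hcont
      (B := max (B (2 * z.re)) (mgf id ν (2 * z.re)))
      (Eventually.of_forall fun n => hsq _ (hμ n)) ?_ (hsq ν hν)
      ((hbound ν hν).trans (le_max_right _ _))
    filter_upwards [hB] with n hn
    exact ((hbound _ (hμ n)).trans (hn _)).trans (le_max_left _ _)
  have hre := key Complex.reCLM Complex.abs_re_le_norm
  have him := key Complex.imCLM Complex.abs_im_le_norm
  have h := ((Complex.continuous_ofReal.tendsto _).comp hre).add
    (((Complex.continuous_ofReal.tendsto _).comp him).mul_const Complex.I)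
  simpa [Function.comp_def, Complex.re_add_im] using h

/-- The Lee–Yang property is preserved under weak convergence of probability measures:
if each `μ n` is a probability measure of Lee–Yang type and `μ n` converges weakly to a
probability measure `ν`, then `ν` is of Lee–Yang type. -/
theorem isLeeYang_of_weak_limit (μ : ℕ → Measure ℝ) [∀ n, IsProbabilityMeasure (μ n)]
    (hLY : ∀ n, IsLeeYang (μ n))
    (ν : Measure ℝ) [IsProbabilityMeasure ν]
    (hconv : ∀ g : BoundedContinuousFunction ℝ ℝ,
      Tendsto (fun n => ∫ x, g x ∂(μ n)) atTop (nhds (∫ x, g x ∂ν))) :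
    IsLeeYang ν := by
  have hsymm : ν.map (fun x : ℝ => -x) = ν := map_neg_eq_of_tendsto hconv fun n => (hLY n).1
  have hF (n : ℕ) : IsLeeYangEntire (complexMGF id (μ n)) := (hLY n).isLeeYangEntire
  have hμ (n : ℕ) (t : ℝ) : Integrable (fun x : ℝ => Real.exp (t * x)) (μ n) := by
    obtain ⟨b, hb, hint⟩ := (hLY n).2.1
    exact integrable_exp_mul_of_integrable_exp_sq hb hint t
  obtain ⟨δ, hδ, hhalf⟩ := exists_half_le_norm_complexMGF hconv
  set K := 128 / δ ^ 2
  have hK : 0 < K := by positivity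
  have hle : ∀ᶠ n in atTop, ∀ x : ℝ, 0 ≤ x →
      (complexMGF id (μ n) x).re ≤ Real.exp (K * x ^ 2) := by
    filter_upwards [hhalf] with n hn x hx
    exact (hF n).re_le_exp_of_half_le_norm hδ hn hx
  have hmgf : ∀ᶠ n in atTop, ∀ t, mgf id (μ n) t ≤ Real.exp (K * t ^ 2) := by
    filter_upwards [hle] with n hn t
    rw [← re_complexMGF_ofReal]
    rcases le_total 0 t with ht | ht
    · exact hn t ht
    · rw [← (hF n).even]
      simpa using hn (-t) (by linarith)
  obtain ⟨M, hM, hbound⟩ := exists_lintegral_exp_sq_le hK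
  have hb : 0 < 1 / (8 * K) := by positivity
  have hint : Integrable (fun x : ℝ => Real.exp (1 / (8 * K) * x ^ 2)) ν := by
    refine integrable_exp_sq_of_tendsto hconv hM ?_
    filter_upwards [hmgf] with n hn
    exact hbound (μ n) inferInstance (hμ n) hn
  have hpos (z : ℂ) (hz : 0 < z.re) : complexMGF id ν z ≠ 0 := by
    obtain ⟨κ, hκ, hlow⟩ := IsLeeYangEntire.exists_pos_le_norm hK hz
    have hlim := (tendsto_complexMGF hconv hμ (integrable_exp_mul_of_integrable_exp_sq hb hint)
      hmgf z).norm
    refine norm_pos_iff.1 (hκ.trans_le (ge_of_tendsto hlim ?_))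
    filter_upwards [hle] with n hn
    exact hlow _ (hF n) hn
  refine ⟨hsymm, ⟨_, hb, hint⟩, fun z hz => ?_⟩
  change complexMGF id ν z ≠ 0
  rcases lt_or_gt_of_ne hz with h | h
  · rw [← complexMGF_neg_of_map_neg_eq hsymm]
    exact hpos _ (by simpa using h)
  · exact hpos z h
end

section
/- Suppose that for each n = 1, 2, ..., X_n is a real random variable such that (1) X_n and −X_n have the same distribution, and (2) E[exp(b_n X_n²)] < ∞ for some b_n > 0. Suppose further that X_n converges in distribution to a random variable X satisfying E[exp(b X²)] = ∞ for every b > 0. Then for all but finitely many n, the entire function z ↦ E[exp(z X_n)] has a zero z with Re z ≠ 0. -/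
open MeasureTheory Filter

/-- Second order Taylor estimate for a holomorphic function bounded on a circle. -/
lemma norm_sub_taylor_two_le {f : ℂ → ℂ} {r B : ℝ} (hr : 0 < r)
    (hf : DiffContOnCl ℂ f (Metric.ball 0 r)) (hB : ∀ z ∈ Metric.sphere (0 : ℂ) r, ‖f z‖ ≤ B)
    {z : ℂ} (hz : ‖z‖ ≤ r / 2) :
    ‖f z - (f 0 + deriv f 0 * z + deriv (deriv f) 0 * z ^ 2 / 2)‖ ≤ 2 * B * (‖z‖ / r) ^ 3 := by
  have hB0 : 0 ≤ B := (norm_nonneg _).trans (hB (r : ℂ) (by simp [abs_of_pos hr]))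
  set q : ℝ := ‖z‖ / r with hq
  have hq0 : 0 ≤ q := by positivity
  have hq1 : q ≤ 1 / 2 := by rw [hq, div_le_iff₀ hr]; linarith
  have hzr : z ∈ Metric.ball (0 : ℂ) r := by simp; linarith
  have hs := Complex.hasSum_taylorSeries_on_ball hf.differentiableOn hzr
  have hterm : ∀ n : ℕ, ‖(n.factorial : ℂ)⁻¹ • (z - 0) ^ n • iteratedDeriv n f 0‖ ≤ B * q ^ n := by
    intro n
    have h := Complex.norm_iteratedDeriv_le_of_forall_mem_sphere_norm_le n hr hf hB
    have hn : (0 : ℝ) < n.factorial := by positivity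
    simp only [smul_eq_mul, sub_zero, norm_mul, norm_inv, norm_pow, Complex.norm_natCast]
    calc (n.factorial : ℝ)⁻¹ * (‖z‖ ^ n * ‖iteratedDeriv n f 0‖)
        ≤ (n.factorial : ℝ)⁻¹ * (‖z‖ ^ n * (n.factorial * B / r ^ n)) := by gcongr
      _ = B * q ^ n := by rw [hq, div_pow]; field_simp
  have hs3 := (hasSum_nat_add_iff' 3).2 hs
  have hg : HasSum (fun n : ℕ => B * q ^ (n + 3)) (B * q ^ 3 * (1 - q)⁻¹) := by
    have hg0 := (hasSum_geometric_of_lt_one hq0 (by linarith)).mul_left (B * q ^ 3)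
    have e : (fun n : ℕ => B * q ^ (n + 3)) = fun n => B * q ^ 3 * q ^ n := by
      funext n
      ring
    rwa [e]
  have := hs3.norm_le_of_bounded hg (fun n => hterm (n + 3))
  have e : ∑ i ∈ Finset.range 3, (i.factorial : ℂ)⁻¹ • (z - 0) ^ i • iteratedDeriv i f 0
      = f 0 + deriv f 0 * z + deriv (deriv f) 0 * z ^ 2 / 2 := by
    simp [Finset.sum_range_succ, iteratedDeriv_succ, iteratedDeriv_zero]
    ring
  rw [e] at this
  refine this.trans ?_
  have h2 : (1 - q)⁻¹ ≤ 2 := by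
    rw [inv_le_comm₀ (by linarith) (by norm_num)]; linarith
  calc B * q ^ 3 * (1 - q)⁻¹ ≤ B * q ^ 3 * 2 := by gcongr
    _ = _ := by ring

/-- A holomorphic function of controlled growth without zeros in a disc is close to the
exponential of a quadratic polynomial near the centre. -/
lemma norm_le_exp_of_ne_zero {h : ℂ → ℂ} {r L : ℝ} (hr : 0 < r) (hL : 0 < L)
    (hh : DifferentiableOn ℂ h (Metric.ball 0 r)) (h0 : h 0 = 1)
    (hne : ∀ z ∈ Metric.ball (0 : ℂ) r, h z ≠ 0)
    (hbd : ∀ z ∈ Metric.ball (0 : ℂ) r, ‖h z‖ ≤ Real.exp L) {z : ℂ} (hz : ‖z‖ ≤ r / 4) :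
    ‖h z‖ ≤ Real.exp ((logDeriv h 0 * z + deriv (logDeriv h) 0 * z ^ 2 / 2).re
      + 32 * L * (‖z‖ / r) ^ 3) := by
  have hmem0 : (0 : ℂ) ∈ Metric.ball (0 : ℂ) r := Metric.mem_ball_self hr
  have hopen := Metric.isOpen_ball (x := (0 : ℂ)) (ε := r)
  have hld : DifferentiableOn ℂ (logDeriv h) (Metric.ball 0 r) := (hh.deriv hopen).div hh hne
  obtain ⟨φ₀, hφ₀⟩ := hld.isExactOn_ball
  set φ : ℂ → ℂ := fun w => φ₀ w - φ₀ 0 with hφdef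
  have hφ : ∀ w ∈ Metric.ball (0 : ℂ) r, HasDerivAt φ (logDeriv h w) w :=
    fun w hw => (hφ₀ w hw).sub_const _
  have hφ0 : φ 0 = 0 := by simp [hφdef]
  have hexp : ∀ w ∈ Metric.ball (0 : ℂ) r, h w = Complex.exp (φ w) := by
    intro w hw
    have hd : ∀ u ∈ Metric.ball (0 : ℂ) r,
        HasDerivAt (fun u => h u * Complex.exp (-φ u)) 0 u := by
      intro u hu
      have h1 := ((hh u hu).differentiableAt (hopen.mem_nhds hu)).hasDerivAt
      have h2 : HasDerivAt (fun u => Complex.exp (-φ u))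
          (Complex.exp (-φ u) * -logDeriv h u) u := (hφ u hu).neg.cexp
      refine (h1.mul h2).congr_deriv ?_
      rw [logDeriv_apply]
      field_simp [hne u hu]
      ring
    have := (convex_ball (0 : ℂ) r).is_const_of_fderivWithin_eq_zero (𝕜 := ℂ)
      (f := fun u => h u * Complex.exp (-φ u))
      (fun u hu => (hd u hu).differentiableAt.differentiableWithinAt) (fun u hu => by
        rw [fderivWithin_of_isOpen hopen hu]
        ext
        simpa using (hd u hu).deriv) hw hmem0
    simp only [hφ0, h0, neg_zero, Complex.exp_zero, mul_one] at this
    rwa [Complex.exp_neg, mul_inv_eq_one₀ (Complex.exp_ne_zero _)] at this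
  have hφd : DifferentiableOn ℂ φ (Metric.ball 0 r) :=
    fun w hw => (hφ w hw).differentiableAt.differentiableWithinAt
  have hre : Set.MapsTo φ (Metric.ball 0 r) {w | w.re ≤ L} := by
    intro w hw
    have := hbd w hw
    rw [hexp w hw, Complex.norm_exp, Real.exp_le_exp] at this
    exact this
  have hsub : Metric.closedBall (0 : ℂ) (r / 2) ⊆ Metric.ball 0 r :=
    Metric.closedBall_subset_ball (by linarith)
  have hbc : ∀ w ∈ Metric.sphere (0 : ℂ) (r / 2), ‖φ w‖ ≤ 2 * L := by
    intro w hw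
    have hb := Complex.borelCaratheodory_zero hL hφd hre hr
      (hsub (Metric.sphere_subset_closedBall hw)) hφ0
    rw [mem_sphere_zero_iff_norm] at hw
    rw [hw] at hb
    refine hb.trans_eq ?_
    field_simp
    ring
  have hT := norm_sub_taylor_two_le (half_pos hr) (hφd.mono (by
    rw [closure_ball _ (half_pos hr).ne']; exact hsub)).diffContOnCl hbc (z := z) (by linarith)
  have hd1 : deriv φ =ᶠ[nhds 0] logDeriv h := by
    filter_upwards [hopen.mem_nhds hmem0] with w hw using (hφ w hw).deriv
  rw [hφ0, zero_add, hd1.eq_of_nhds, hd1.deriv_eq] at hT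
  have hzr : z ∈ Metric.ball (0 : ℂ) r := by simp; linarith
  rw [hexp z hzr, Complex.norm_exp, Real.exp_le_exp]
  have h1 := (Complex.re_le_norm _).trans hT
  rw [Complex.sub_re] at h1
  have h2 : 2 * (2 * L) * (‖z‖ / (r / 2)) ^ 3 = 32 * L * (‖z‖ / r) ^ 3 := by
    field_simp; ring
  linarith

/-- The polynomial with constant term `1` and prescribed multiset of nonzero roots. -/
noncomputable def normalizedRootProd (s : Multiset ℂ) (z : ℂ) : ℂ :=
  (s.map fun a => 1 - z / a).prod

lemma normalizedRootProd_cons (a : ℂ) (s : Multiset ℂ) (z : ℂ) :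
    normalizedRootProd (a ::ₘ s) z = (1 - z / a) * normalizedRootProd s z := by
  simp [normalizedRootProd]

lemma normalizedRootProd_zero (s : Multiset ℂ) : normalizedRootProd s 0 = 1 := by
  simp [normalizedRootProd]

lemma differentiable_normalizedRootProd (s : Multiset ℂ) :
    Differentiable ℂ (normalizedRootProd s) := by
  induction s using Multiset.induction_on with
  | empty =>
    have : normalizedRootProd 0 = fun _ => 1 := funext fun z => by simp [normalizedRootProd]
    rw [this]
    fun_prop
  | cons a s ih =>
    have : normalizedRootProd (a ::ₘ s) = fun z => (1 - z / a) * normalizedRootProd s z :=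
      funext (normalizedRootProd_cons a s)
    rw [this]
    fun_prop

lemma exists_eq_one_sub_div_mul {f : ℂ → ℂ} (hf : Differentiable ℂ f) {a : ℂ} (ha : a ≠ 0)
    (hfa : f a = 0) : ∃ g : ℂ → ℂ, Differentiable ℂ g ∧ ∀ z, f z = (1 - z / a) * g z := by
  refine ⟨fun z => -a * dslope f a z, ?_, fun z => ?_⟩
  · have : Differentiable ℂ (dslope f a) := by
      rw [← differentiableOn_univ] at hf ⊢
      exact (Complex.differentiableOn_dslope univ_mem).2 hf
    fun_prop
  · have h := sub_smul_dslope f a z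
    rw [hfa, sub_zero, smul_eq_mul] at h
    rw [← h]
    field_simp
    ring

lemma two_pow_card_le_norm_normalizedRootProd {s : Multiset ℂ} {r : ℝ}
    (hs : ∀ a ∈ s, a ≠ 0 ∧ ‖a‖ ≤ r) {z : ℂ} (hz : ‖z‖ = 3 * r) :
    2 ^ s.card ≤ ‖normalizedRootProd s z‖ := by
  induction s using Multiset.induction_on with
  | empty => simp [normalizedRootProd]
  | cons a s ih =>
    obtain ⟨ha, har⟩ := hs a (Multiset.mem_cons_self a s)
    have h1 := ih fun b hb => hs b (Multiset.mem_cons_of_mem hb)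
    have h2 : 2 ≤ ‖1 - z / a‖ := by
      have h3 : 3 ≤ ‖z / a‖ := by
        rw [norm_div, hz, le_div_iff₀ (norm_pos_iff.2 ha)]
        linarith
      have h4 := norm_sub_norm_le (z / a) 1
      rw [norm_one, norm_sub_rev] at h4
      linarith
    rw [normalizedRootProd_cons, norm_mul, Multiset.card_cons, pow_succ']
    gcongr

/-- The cofactor of a normalized product of roots obeys the bound on the function divided by
`2` for each root. -/
lemma norm_cofactor_le {f h : ℂ → ℂ} {s : Multiset ℂ} {r M : ℝ} (hr : 0 < r)
    (hs : ∀ a ∈ s, a ≠ 0 ∧ ‖a‖ ≤ r) (hh : Differentiable ℂ h)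
    (hfac : ∀ z, f z = normalizedRootProd s z * h z) (hM : ∀ z, ‖z‖ = 3 * r → ‖f z‖ ≤ M)
    {z : ℂ} (hz : ‖z‖ ≤ 3 * r) : ‖h z‖ ≤ M / 2 ^ s.card := by
  refine Complex.norm_le_of_forall_mem_frontier_norm_le (U := Metric.ball 0 (3 * r))
    Metric.isBounded_ball hh.diffContOnCl (fun w hw => ?_) ?_
  · rw [frontier_ball _ (by positivity), mem_sphere_zero_iff_norm] at hw
    have h1 := hM w hw
    have h2 := two_pow_card_le_norm_normalizedRootProd hs hw
    rw [hfac, norm_mul] at h1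
    rw [le_div_iff₀ (by positivity), mul_comm]
    exact (mul_le_mul_of_nonneg_right h2 (norm_nonneg _)).trans h1
  · rw [closure_ball _ (by positivity)]
    simpa using hz

/-- An entire function normalized at the origin is a normalized product of finitely many roots
times an entire function without zeros in a given disc. -/
lemma exists_factorization {f : ℂ → ℂ} (hf : Differentiable ℂ f) (hf0 : f 0 = 1) {r : ℝ}
    (hr : 0 < r) :
    ∃ (s : Multiset ℂ) (h : ℂ → ℂ), (∀ a ∈ s, a ≠ 0 ∧ ‖a‖ ≤ r ∧ f a = 0) ∧ Differentiable ℂ h ∧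
      (∀ z, ‖z‖ ≤ r → h z ≠ 0) ∧ ∀ z, f z = normalizedRootProd s z * h z := by
  by_contra hcon
  push Not at hcon
  have key : ∀ n : ℕ, ∃ (s : Multiset ℂ) (h : ℂ → ℂ), s.card = n ∧
      (∀ a ∈ s, a ≠ 0 ∧ ‖a‖ ≤ r ∧ f a = 0) ∧ Differentiable ℂ h ∧
      ∀ z, f z = normalizedRootProd s z * h z := by
    intro n
    induction n with
    | zero => exact ⟨0, f, rfl, by simp, hf, by simp [normalizedRootProd]⟩
    | succ n ih =>
      obtain ⟨s, h, hcard, hs, hh, hfac⟩ := ih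
      have : ¬ ∀ z, ‖z‖ ≤ r → h z ≠ 0 := fun hne => by
        obtain ⟨z, hz⟩ := hcon s h hs hh hne
        exact hz (hfac z)
      push Not at this
      obtain ⟨a, har, hha⟩ := this
      have ha0 : a ≠ 0 := by
        rintro rfl
        have := hfac 0
        simp [hf0, hha] at this
      obtain ⟨g, hg, hgfac⟩ := exists_eq_one_sub_div_mul hh ha0 hha
      refine ⟨a ::ₘ s, g, by simp [hcard], fun b hb => ?_, hg, fun z => ?_⟩
      · rcases Multiset.mem_cons.1 hb with rfl | hb
        · exact ⟨ha0, har, by simp [hfac, hha]⟩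
        · exact hs b hb
      · rw [hfac, hgfac, normalizedRootProd_cons]
        ring
  obtain ⟨M, hM⟩ := (isCompact_sphere (0 : ℂ) (3 * r)).exists_bound_of_continuousOn
    hf.continuous.continuousOn
  obtain ⟨n, hn⟩ := pow_unbounded_of_one_lt M (one_lt_two (α := ℝ))
  obtain ⟨s, h, hcard, hs, hh, hfac⟩ := key n
  have h1 := norm_cofactor_le hr (fun a ha => ⟨(hs a ha).1, (hs a ha).2.1⟩) hh hfac
    (fun z hz => hM z (by simpa using hz)) (z := 0) (by simp; positivity)
  have h2 : h 0 = 1 := by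
    have := hfac 0
    rw [hf0, normalizedRootProd_zero, one_mul] at this
    exact this.symm
  rw [h2, norm_one, le_div_iff₀ (by positivity), one_mul, hcard] at h1
  linarith

lemma logDeriv_normalizedRootProd_mul {s : Multiset ℂ} (hs : ∀ a ∈ s, a ≠ 0) {h : ℂ → ℂ}
    (hh : Differentiable ℂ h) (h0 : h 0 ≠ 0) :
    logDeriv (fun z => normalizedRootProd s z * h z) 0
        = -(s.map fun a => a⁻¹).sum + logDeriv h 0 ∧
      deriv (logDeriv fun z => normalizedRootProd s z * h z) 0
        = -(s.map fun a => (a⁻¹) ^ 2).sum + deriv (logDeriv h) 0 := by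
  induction s using Multiset.induction_on with
  | empty => simp [normalizedRootProd]
  | cons a s ih =>
    have ha := hs a (Multiset.mem_cons_self a s)
    obtain ⟨ih1, ih2⟩ := ih fun b hb => hs b (Multiset.mem_cons_of_mem hb)
    set F : ℂ → ℂ := fun z => normalizedRootProd s z * h z with hF
    have hFd : Differentiable ℂ F := (differentiable_normalizedRootProd s).mul hh
    have hF0 : F 0 ≠ 0 := by simpa [hF, normalizedRootProd_zero] using h0
    have hfun : (fun z => normalizedRootProd (a ::ₘ s) z * h z) = fun z => (1 - z / a) * F z := by
      funext z
      rw [normalizedRootProd_cons, hF]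
      ring
    have hlin : ∀ z, logDeriv (fun z => 1 - z / a) z = -a⁻¹ / (1 - z / a) := by
      intro z
      rw [logDeriv_apply]
      congr 1
      simp [div_eq_mul_inv]
    have hev : logDeriv (fun z => (1 - z / a) * F z)
        =ᶠ[nhds 0] fun z => -a⁻¹ / (1 - z / a) + logDeriv F z := by
      have c1 : ∀ᶠ z in nhds (0 : ℂ), 1 - z / a ≠ 0 :=
        ContinuousAt.eventually_ne (by fun_prop) (by simp)
      filter_upwards [c1, hFd.continuous.continuousAt.eventually_ne hF0] with z h1 h2
      rw [logDeriv_mul z h1 h2 (by fun_prop) (hFd z), hlin]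
    have hd1 : HasDerivAt (fun z : ℂ => -a⁻¹ / (1 - z / a)) (-(a⁻¹) ^ 2) 0 := by
      have h1 : HasDerivAt (fun z : ℂ => 1 - z / a) (-(1 / a)) 0 :=
        ((hasDerivAt_id (0 : ℂ)).div_const a).const_sub 1
      refine ((hasDerivAt_const (0 : ℂ) (-a⁻¹)).div h1 (by simp)).congr_deriv ?_
      field_simp
      simp
    have hd2 : DifferentiableAt ℂ (logDeriv F) 0 :=
      (hFd.contDiff (n := 2)).differentiable_deriv_two.differentiableAt.div (hFd 0) hF0
    have hd := HasDerivAt.deriv (f := fun z => -a⁻¹ / (1 - z / a) + logDeriv F z)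
      (hd1.add hd2.hasDerivAt)
    rw [hfun, hev.eq_of_nhds, hev.deriv_eq, hd, ih1, ih2]
    simp only [Multiset.map_cons, Multiset.sum_cons]
    constructor
    · simp; ring
    · ring

lemma norm_normalizedRootProd_ofReal_le {s : Multiset ℂ} (hs : ∀ a ∈ s, a.re = 0) (t : ℝ) :
    ‖normalizedRootProd s t‖ ≤ Real.exp (-(t ^ 2 / 2) * (s.map fun a => (a⁻¹) ^ 2).sum.re) := by
  induction s using Multiset.induction_on with
  | empty => simp [normalizedRootProd]
  | cons a s ih =>
    have ha := hs a (Multiset.mem_cons_self a s)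
    have ih := ih fun b hb => hs b (Multiset.mem_cons_of_mem hb)
    rw [normalizedRootProd_cons, norm_mul, Multiset.map_cons, Multiset.sum_cons, Complex.add_re,
      mul_add, Real.exp_add]
    refine mul_le_mul ?_ ih (norm_nonneg _) (Real.exp_pos _).le
    have hinv : a⁻¹ = ((-(a.im)⁻¹ : ℝ) : ℂ) * Complex.I := by
      have : a = (a.im : ℂ) * Complex.I := by apply Complex.ext <;> simp [ha]
      rw [this]
      simp [mul_comm]
    set c : ℝ := -(a.im)⁻¹
    have h1 : ((a⁻¹) ^ 2).re = - c ^ 2 := by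
      rw [hinv, mul_pow, Complex.I_sq, mul_neg_one, Complex.neg_re]
      norm_cast
    have h2 : ‖1 - (t : ℂ) / a‖ ^ 2 = 1 + t ^ 2 * c ^ 2 := by
      rw [div_eq_mul_inv, hinv, Complex.sq_norm, Complex.normSq_apply]
      simp
      ring
    rw [h1]
    refine (sq_le_sq₀ (norm_nonneg _) (Real.exp_pos _).le).1 ?_
    rw [h2, ← Real.exp_nat_mul]
    calc 1 + t ^ 2 * c ^ 2 ≤ Real.exp (t ^ 2 * c ^ 2) := by
          linarith [Real.add_one_le_exp (t ^ 2 * c ^ 2)]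
      _ = _ := by congr 1; push_cast; ring

/-- An entire function of order at most two and finite type, normalized at the origin up to first
order, whose zeros are all purely imaginary, is bounded on the real axis by the Gaussian with
the same second derivative. -/
theorem norm_le_exp_of_zeros_imaginary {f : ℂ → ℂ} (hf : Differentiable ℂ f) (hf0 : f 0 = 1)
    (hf1 : deriv f 0 = 0) {A K : ℝ} (hK : 0 ≤ K)
    (hgrowth : ∀ z, ‖f z‖ ≤ Real.exp (A + K * ‖z‖ ^ 2)) (hzeros : ∀ z, f z = 0 → z.re = 0) (t : ℝ) :
    ‖f t‖ ≤ Real.exp ((deriv (deriv f) 0).re * t ^ 2 / 2) := by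
  have hbound : ∀ r : ℝ, 0 < r → 4 * |t| ≤ r → ‖f t‖ ≤
      Real.exp ((deriv (deriv f) 0).re * t ^ 2 / 2
        + 32 * (|A| + 1 + 9 * K * r ^ 2) * (|t| / r) ^ 3) := by
    intro r hr htr
    obtain ⟨s, h, hs, hh, hne, hfac⟩ := exists_factorization hf hf0 hr
    have h0 : h 0 = 1 := by
      have := hfac 0
      rw [hf0, normalizedRootProd_zero, one_mul] at this
      exact this.symm
    have hL : 0 < |A| + 1 + 9 * K * r ^ 2 := by positivity
    have hhb : ∀ z ∈ Metric.ball (0 : ℂ) r, ‖h z‖ ≤ Real.exp (|A| + 1 + 9 * K * r ^ 2) := by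
      intro z hz
      rw [mem_ball_zero_iff] at hz
      refine (norm_cofactor_le hr (fun a ha => ⟨(hs a ha).1, (hs a ha).2.1⟩) hh hfac
        (fun z hz => ?_) (z := z) (by linarith)).trans (div_le_self (Real.exp_pos _).le
          (one_le_pow₀ one_le_two))
      refine (hgrowth z).trans (Real.exp_le_exp.2 ?_)
      rw [hz]
      have := le_abs_self A
      linarith
    have hball : ∀ z ∈ Metric.ball (0 : ℂ) r, h z ≠ 0 := fun z hz =>
      hne z (mem_ball_zero_iff.1 hz).le
    have h1 := norm_le_exp_of_ne_zero hr hL hh.differentiableOn h0 hball hhb (z := (t : ℂ)) (by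
      rw [Complex.norm_real, Real.norm_eq_abs]; linarith)
    have h2 := norm_normalizedRootProd_ofReal_le (s := s) (fun a ha => hzeros a (hs a ha).2.2) t
    obtain ⟨d1, d2⟩ := logDeriv_normalizedRootProd_mul (fun a ha => (hs a ha).1) hh
      (h0 ▸ one_ne_zero)
    rw [← funext hfac] at d1 d2
    have hd1 : logDeriv f 0 = 0 := by simp [logDeriv_apply, hf1]
    have hd2 : deriv (logDeriv f) 0 = deriv (deriv f) 0 := by
      have : DifferentiableAt ℂ (deriv f) 0 :=
        (hf.contDiff (n := 2)).differentiable_deriv_two.differentiableAt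
      have h3 := this.hasDerivAt.div (hf 0).hasDerivAt (by simp [hf0])
      have h4 : deriv (logDeriv f) 0 = _ := h3.deriv
      rw [h4]
      simp [hf0, hf1]
    have hre : (s.map fun a => a⁻¹).sum.re = 0 := by
      have : ∀ u : Multiset ℂ, (∀ a ∈ u, a.re = 0) → (u.map fun a => a⁻¹).sum.re = 0 := by
        intro u hu
        induction u using Multiset.induction_on with
        | empty => simp
        | cons a u ih =>
          simp [hu a (Multiset.mem_cons_self a u),
            ih fun b hb => hu b (Multiset.mem_cons_of_mem hb)]
      exact this s fun a ha => hzeros a (hs a ha).2.2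
    have e1 : logDeriv h 0 = (s.map fun a => a⁻¹).sum := by
      rw [hd1] at d1
      linear_combination -d1
    have e2 : deriv (logDeriv h) 0 = deriv (deriv f) 0 + (s.map fun a => (a⁻¹) ^ 2).sum := by
      rw [hd2] at d2
      linear_combination -d2
    rw [hfac, norm_mul]
    refine (mul_le_mul h2 h1 (norm_nonneg _) (Real.exp_pos _).le).trans_eq ?_
    rw [← Real.exp_add, e1, e2, Complex.norm_real, Real.norm_eq_abs, Complex.add_re,
      Complex.re_mul_ofReal, hre, ← Complex.ofReal_pow,
      show ((2 : ℂ)) = ((2 : ℝ) : ℂ) by norm_num, mul_div_assoc, ← Complex.ofReal_div,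
      Complex.re_mul_ofReal, Complex.add_re]
    congr 1
    ring
  have hlim : Tendsto (fun r : ℝ => Real.exp ((deriv (deriv f) 0).re * t ^ 2 / 2
        + 32 * (|A| + 1 + 9 * K * r ^ 2) * (|t| / r) ^ 3)) atTop
      (nhds (Real.exp ((deriv (deriv f) 0).re * t ^ 2 / 2 + 0))) := by
    refine (Real.continuous_exp.tendsto _).comp (tendsto_const_nhds.add ?_)
    have hi : Tendsto (fun r : ℝ => r⁻¹) atTop (nhds 0) := tendsto_inv_atTop_zero
    have h3 : Tendsto (fun r : ℝ => 32 * (|A| + 1) * |t| ^ 3 * (r⁻¹) ^ 3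
        + 32 * 9 * K * |t| ^ 3 * r⁻¹) atTop (nhds 0) := by
      simpa using ((hi.pow 3).const_mul (32 * (|A| + 1) * |t| ^ 3)).add
        (hi.const_mul (32 * 9 * K * |t| ^ 3))
    refine h3.congr' ?_
    filter_upwards [eventually_gt_atTop 0] with r hr
    field_simp
  rw [add_zero] at hlim
  refine ge_of_tendsto hlim ?_
  filter_upwards [eventually_gt_atTop 0, eventually_ge_atTop (4 * |t|)] with r h1 h2
    using hbound r h1 h2

section Moments

variable {Ω : Type*} [MeasurableSpace Ω] {μ : Measure Ω} {X : Ω → ℝ}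

lemma mul_le_mul_sq_add_sq_div {b : ℝ} (hb : 0 < b) (t x : ℝ) :
    t * x ≤ b * x ^ 2 + t ^ 2 / (4 * b) := by
  have h : b * x ^ 2 + t ^ 2 / (4 * b) - t * x = (2 * b * x - t) ^ 2 / (4 * b) := by
    field_simp
    ring
  have : 0 ≤ (2 * b * x - t) ^ 2 / (4 * b) := by positivity
  linarith

lemma integrable_exp_mul_of_integrable_exp_mul_sq (hX : Measurable X) {b : ℝ} (hb : 0 < b)
    (hint : Integrable (fun ω => Real.exp (b * X ω ^ 2)) μ) (t : ℝ) :
    Integrable (fun ω => Real.exp (t * X ω)) μ := by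
  refine (hint.mul_const (Real.exp (t ^ 2 / (4 * b)))).mono' (by fun_prop)
    (Eventually.of_forall fun ω => ?_)
  rw [Real.norm_eq_abs, Real.abs_exp, ← Real.exp_add]
  exact Real.exp_le_exp.2 (mul_le_mul_sq_add_sq_div hb t (X ω))

/-- A symmetric random variable with Gaussian tails, whose moment generating function has only
purely imaginary zeros, is sub-Gaussian with variance proxy equal to its variance. -/
theorem mgf_le_exp_of_zeros_imaginary [IsProbabilityMeasure μ] (hX : Measurable X)
    (hsymm : μ.map (fun ω => -(X ω)) = μ.map X) {b : ℝ} (hb : 0 < b)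
    (hint : Integrable (fun ω => Real.exp (b * X ω ^ 2)) μ)
    (hzeros : ∀ z : ℂ, z.re ≠ 0 → (∫ ω, Complex.exp (z * (X ω : ℂ)) ∂μ) ≠ 0) (t : ℝ) :
    ProbabilityTheory.mgf X μ t ≤ Real.exp ((∫ ω, X ω ^ 2 ∂μ) * t ^ 2 / 2) := by
  have hset : ProbabilityTheory.integrableExpSet X μ = Set.univ :=
    Set.eq_univ_of_forall (integrable_exp_mul_of_integrable_exp_mul_sq hX hb hint)
  have hmem : ∀ z : ℂ, z.re ∈ interior (ProbabilityTheory.integrableExpSet X μ) := by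
    simp [hset]
  set f := ProbabilityTheory.complexMGF X μ with hf
  have hfd : Differentiable ℂ f := fun z =>
    (ProbabilityTheory.hasDerivAt_complexMGF (hmem z)).differentiableAt
  have hf0 : f 0 = 1 := by simp [hf, ProbabilityTheory.complexMGF]
  have hmean : ∫ ω, X ω ∂μ = 0 := by
    have h1 : ∫ x, x ∂(μ.map X) = ∫ ω, X ω ∂μ := integral_map hX.aemeasurable (by fun_prop)
    have h2 : ∫ x, x ∂(μ.map fun ω => -(X ω)) = ∫ ω, -(X ω) ∂μ :=
      integral_map hX.neg.aemeasurable (by fun_prop)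
    rw [hsymm, h1, integral_neg] at h2
    linarith
  have hf1 : deriv f 0 = 0 := by
    have h := ProbabilityTheory.iteratedDeriv_complexMGF (hmem 0) 1
    rw [iteratedDeriv_one] at h
    rw [h]
    simp only [pow_one, zero_mul, Complex.exp_zero, mul_one]
    rw [integral_complex_ofReal, hmean, Complex.ofReal_zero]
  have hf2 : deriv (deriv f) 0 = ((∫ ω, X ω ^ 2 ∂μ : ℝ) : ℂ) := by
    have h := ProbabilityTheory.iteratedDeriv_complexMGF (hmem 0) 2
    rw [iteratedDeriv_succ, iteratedDeriv_one] at h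
    rw [h, ← integral_complex_ofReal]
    simp
  have hEpos : 0 < ∫ ω, Real.exp (b * X ω ^ 2) ∂μ := integral_exp_pos hint
  have hgrowth : ∀ z, ‖f z‖ ≤
      Real.exp (Real.log (∫ ω, Real.exp (b * X ω ^ 2) ∂μ) + (1 / (4 * b)) * ‖z‖ ^ 2) := by
    intro z
    refine ProbabilityTheory.norm_complexMGF_le_mgf.trans ?_
    rw [Real.exp_add, Real.exp_log hEpos, ProbabilityTheory.mgf, ← integral_mul_const]
    refine integral_mono (integrable_exp_mul_of_integrable_exp_mul_sq hX hb hint z.re)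
      (hint.mul_const _) fun ω => ?_
    simp only [← Real.exp_add, Real.exp_le_exp]
    refine (mul_le_mul_sq_add_sq_div hb z.re (X ω)).trans ?_
    have h1 : z.re ^ 2 ≤ ‖z‖ ^ 2 := sq_le_sq' (by
      linarith [neg_abs_le z.re, Complex.abs_re_le_norm z]) (Complex.re_le_norm z)
    rw [one_div_mul_eq_div]
    gcongr
  have h := norm_le_exp_of_zeros_imaginary hfd hf0 hf1 (by positivity) hgrowth
    (fun z hz => by_contra fun hre => hzeros z hre hz) t
  rw [hf2, Complex.ofReal_re, hf, ProbabilityTheory.complexMGF_ofReal, Complex.norm_real] at h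
  exact (Real.le_norm_self _).trans h

lemma pow_four_div_le_exp_add_exp_neg (x : ℝ) : x ^ 4 / 24 ≤ Real.exp x + Real.exp (-x) := by
  have h := Real.pow_div_factorial_le_exp |x| (abs_nonneg x) 4
  rw [Even.pow_abs (by decide)] at h
  have h2 : Real.exp |x| ≤ Real.exp x + Real.exp (-x) := by
    rcases abs_cases x with ⟨hx, _⟩ | ⟨hx, _⟩ <;> rw [hx] <;>
      linarith [Real.exp_pos x, Real.exp_pos (-x)]
  norm_num [Nat.factorial] at h
  linarith

lemma integral_pow_four_le_of_mgf_le {v : ℝ} (hv : 0 < v)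
    (hint : ∀ t : ℝ, Integrable (fun ω => Real.exp (t * X ω)) μ)
    (hmgf : ∀ t, ProbabilityTheory.mgf X μ t ≤ Real.exp (v * t ^ 2 / 2)) :
    ∫ ω, X ω ^ 4 ∂μ ≤ 96 * v ^ 2 := by
  set t : ℝ := (√v)⁻¹ with ht
  have ht2 : v * t ^ 2 = 1 := by
    rw [ht, inv_pow, Real.sq_sqrt hv.le, mul_inv_cancel₀ hv.ne']
  have ht0 : 0 < t := by positivity
  have he : Real.exp (1 / 2) ≤ 2 := by
    have h1 : Real.exp (1 / 2) ^ 2 = Real.exp 1 := by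
      rw [← Real.exp_nat_mul]
      norm_num
    nlinarith [Real.exp_one_lt_d9, Real.exp_pos (1 / 2)]
  have h1 := hmgf t
  have h2 := hmgf (-t)
  rw [neg_sq] at h2
  rw [ht2] at h1 h2
  have h3 : ∫ ω, (24 / t ^ 4) * (Real.exp (t * X ω) + Real.exp (-t * X ω)) ∂μ
      = (24 / t ^ 4) * (ProbabilityTheory.mgf X μ t + ProbabilityTheory.mgf X μ (-t)) := by
    rw [integral_const_mul, integral_add (hint t) (hint (-t))]
    rfl
  have h4 : ∫ ω, X ω ^ 4 ∂μ
      ≤ ∫ ω, (24 / t ^ 4) * (Real.exp (t * X ω) + Real.exp (-t * X ω)) ∂μ := by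
    refine integral_mono_of_nonneg (Eventually.of_forall fun ω => by positivity)
      (((hint t).add (hint (-t))).const_mul _) (Eventually.of_forall fun ω => ?_)
    have h5 := pow_four_div_le_exp_add_exp_neg (t * X ω)
    have h6 : X ω ^ 4 = (24 / t ^ 4) * ((t * X ω) ^ 4 / 24) := by field_simp
    simp only []
    rw [h6, neg_mul]
    gcongr
  have h7 : 24 / t ^ 4 = 24 * v ^ 2 := by
    rw [div_eq_iff (by positivity)]
    linear_combination (-24 * (v * t ^ 2 + 1)) * ht2
  rw [h3, h7] at h4
  nlinarith [sq_nonneg v]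

/-- The piecewise linear function of `|x|` which vanishes for `|x| ≤ K` and equals `1` for
`K + 1 ≤ |x|`. -/
def tailCutoff (K x : ℝ) : ℝ := max 0 (min 1 (|x| - K))

lemma continuous_tailCutoff (K : ℝ) : Continuous (tailCutoff K) := by
  unfold tailCutoff
  fun_prop

lemma tailCutoff_nonneg (K x : ℝ) : 0 ≤ tailCutoff K x := le_max_left _ _

lemma norm_tailCutoff_le (K x : ℝ) : ‖tailCutoff K x‖ ≤ 1 := by
  rw [Real.norm_of_nonneg (tailCutoff_nonneg K x)]
  exact max_le zero_le_one (min_le_left _ _)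

lemma tailCutoff_of_le {K x : ℝ} (h : |x| ≤ K) : tailCutoff K x = 0 :=
  max_eq_left ((min_le_right _ _).trans (by linarith))

lemma tailCutoff_of_ge {K x : ℝ} (h : K + 1 ≤ |x|) : tailCutoff K x = 1 := by
  rw [tailCutoff, min_eq_left (by linarith), max_eq_right zero_le_one]

/-- Tightness controls the variance of random variables that are sub-Gaussian with respect to
their own variance. -/
lemma integral_sq_le_of_integral_tailCutoff_le [IsProbabilityMeasure μ] (hX : Measurable X)
    (hint : ∀ t : ℝ, Integrable (fun ω => Real.exp (t * X ω)) μ)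
    (hmgf : ∀ t, ProbabilityTheory.mgf X μ t ≤ Real.exp ((∫ ω, X ω ^ 2 ∂μ) * t ^ 2 / 2))
    {K : ℝ} (hK : 0 ≤ K) (htail : ∫ ω, tailCutoff K (X ω) ∂μ ≤ 1 / 400) :
    ∫ ω, X ω ^ 2 ∂μ ≤ 2 * (K + 1) ^ 2 := by
  set v := ∫ ω, X ω ^ 2 ∂μ with hv
  rcases le_or_gt v 0 with hv0 | hv0
  · exact hv0.trans (by positivity)
  have h4 := integral_pow_four_le_of_mgf_le hv0 hint hmgf
  have hset : (0 : ℝ) ∈ interior (ProbabilityTheory.integrableExpSet X μ) := by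
    rw [Set.eq_univ_of_forall (s := ProbabilityTheory.integrableExpSet X μ) hint]
    simp
  have hi4 : Integrable (fun ω => X ω ^ 4) μ :=
    ProbabilityTheory.integrable_pow_of_mem_interior_integrableExpSet hset 4
  have hit : Integrable (fun ω => tailCutoff K (X ω)) μ :=
    Integrable.of_bound ((continuous_tailCutoff K).measurable.comp hX).aestronglyMeasurable 1
      (Eventually.of_forall fun ω => norm_tailCutoff_le K _)
  have hle : v ≤ ∫ ω, ((K + 1) ^ 2 + X ω ^ 4 / (384 * v) + 96 * v * tailCutoff K (X ω)) ∂μ := by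
    refine integral_mono_of_nonneg (Eventually.of_forall fun ω => by positivity)
      (((integrable_const _).add (hi4.div_const _)).add (hit.const_mul _))
      (Eventually.of_forall fun ω => ?_)
    have p1 : 0 ≤ X ω ^ 4 / (384 * v) := by positivity
    have p2 := mul_nonneg (by positivity : 0 ≤ 96 * v) (tailCutoff_nonneg K (X ω))
    simp only []
    rcases le_or_gt (K + 1) |X ω| with hx | hx
    · rw [tailCutoff_of_ge hx]
      have h := mul_le_mul_sq_add_sq_div (b := 1 / (384 * v)) (by positivity) 1 (X ω ^ 2)
      have e : (1 : ℝ) ^ 2 / (4 * (1 / (384 * v))) = 96 * v := by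
        field_simp
        norm_num
      have e2 : 1 / (384 * v) * (X ω ^ 2) ^ 2 = X ω ^ 4 / (384 * v) := by ring
      rw [e, e2] at h
      nlinarith [sq_nonneg (K + 1)]
    · have : X ω ^ 2 ≤ (K + 1) ^ 2 := by
        rw [← sq_abs]
        gcongr
      linarith
  have hi1 : Integrable (fun ω => (K + 1) ^ 2 + X ω ^ 4 / (384 * v)) μ :=
    (integrable_const _).add (hi4.div_const _)
  rw [integral_add hi1 (hit.const_mul _),
    integral_add (integrable_const _) (hi4.div_const _), integral_const_mul, integral_div] at hle
  simp only [integral_const, probReal_univ, one_smul] at hle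
  have h5 : (∫ ω, X ω ^ 4 ∂μ) / (384 * v) ≤ v / 4 := by
    rw [div_le_iff₀ (by positivity)]
    linarith
  have h6 := mul_le_mul_of_nonneg_left htail (by positivity : 0 ≤ 96 * v)
  linarith

lemma exists_tailCutoff_integral_lt [IsFiniteMeasure μ] (hX : Measurable X) {ε : ℝ} (hε : 0 < ε) :
    ∃ K : ℝ, 0 ≤ K ∧ ∫ ω, tailCutoff K (X ω) ∂μ < ε := by
  have hlim : Tendsto (fun n : ℕ => ∫ ω, tailCutoff n (X ω) ∂μ) atTop
      (nhds (∫ _, (0 : ℝ) ∂μ)) := by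
    refine tendsto_integral_of_dominated_convergence (fun _ => 1)
      (fun n => ((continuous_tailCutoff n).measurable.comp hX).aestronglyMeasurable)
      (integrable_const _) (fun n => Eventually.of_forall fun ω => norm_tailCutoff_le _ _)
      (Eventually.of_forall fun ω => ?_)
    refine tendsto_const_nhds.congr' ?_
    filter_upwards [eventually_ge_atTop ⌈|X ω|⌉₊] with n hn
    exact (tailCutoff_of_le (Nat.ceil_le.1 hn)).symm
  rw [integral_zero] at hlim
  obtain ⟨n, hn⟩ := (hlim.eventually_lt_const hε).exists
  exact ⟨n, n.cast_nonneg, hn⟩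

open ProbabilityTheory in
/-- A uniform sub-Gaussian bound yields a uniform bound on an exponential square moment. -/
lemma exists_lintegral_exp_mul_sq_le {S : ℝ} (hS : 0 < S) :
    ∃ b : ℝ, 0 < b ∧ ∃ C : ℝ, ∀ {Ω : Type*} [MeasurableSpace Ω] (μ : Measure Ω)
      [IsProbabilityMeasure μ] (X : Ω → ℝ), Measurable X →
      (∀ t : ℝ, Integrable (fun ω => Real.exp (t * X ω)) μ) →
      (∀ t, mgf X μ t ≤ Real.exp (S * t ^ 2 / 2)) →
      ∫⁻ ω, ENNReal.ofReal (Real.exp (b * X ω ^ 2)) ∂μ ≤ ENNReal.ofReal C := by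
  obtain ⟨β, hβ, hβint⟩ := IsGaussian.exists_integrable_exp_sq (gaussianReal 0 1)
  set c : ℝ := √(2 * β / S) with hc
  have hc2 : c ^ 2 = 2 * β / S := Real.sq_sqrt (by positivity)
  refine ⟨c ^ 2 / 2, by rw [hc2]; positivity, ∫ y, Real.exp (β * ‖y‖ ^ 2) ∂gaussianReal 0 1, ?_⟩
  intro Ω _ μ _ X hX hint hmgf
  have h1 : ∀ ω, ENNReal.ofReal (Real.exp (c ^ 2 / 2 * X ω ^ 2))
      = ∫⁻ y, ENNReal.ofReal (Real.exp (c * X ω * y)) ∂gaussianReal 0 1 := by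
    intro ω
    have h := congrFun (mgf_id_gaussianReal (μ := 0) (v := 1)) (c * X ω)
    rw [← ofReal_integral_eq_lintegral_ofReal (integrable_exp_mul_gaussianReal _)
      (Eventually.of_forall fun _ => (Real.exp_pos _).le)]
    have h' : ∫ y, Real.exp (c * X ω * y) ∂gaussianReal 0 1 = mgf id (gaussianReal 0 1) (c * X ω) :=
      rfl
    rw [h', h]
    congr 2
    simp
    ring
  simp_rw [h1]
  rw [lintegral_lintegral_swap (by fun_prop), ofReal_integral_eq_lintegral_ofReal hβint
    (Eventually.of_forall fun _ => (Real.exp_pos _).le)]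
  refine lintegral_mono fun y => ?_
  have h2 : ∀ ω, c * X ω * y = (c * y) * X ω := fun ω => by ring
  simp_rw [h2]
  rw [← ofReal_integral_eq_lintegral_ofReal (hint _)
    (Eventually.of_forall fun _ => (Real.exp_pos _).le)]
  refine ENNReal.ofReal_le_ofReal ((hmgf (c * y)).trans_eq ?_)
  rw [mul_pow, hc2, Real.norm_eq_abs, sq_abs]
  congr 1
  field_simp

lemma integrable_of_integral_min_le [IsFiniteMeasure μ] {F : Ω → ℝ} (hF : Measurable F)
    (hF0 : ∀ ω, 0 ≤ F ω) {C : ℝ}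
    (h : ∀ n : ℕ, ∫ ω, min (F ω) n ∂μ ≤ C) : Integrable F μ := by
  refine ⟨hF.aestronglyMeasurable, ?_⟩
  rw [hasFiniteIntegral_iff_ofReal (Eventually.of_forall hF0)]
  have hm : ∀ n : ℕ, Measurable fun ω => min (F ω) (n : ℝ) := fun n => hF.min measurable_const
  have h0 : ∀ n ω, 0 ≤ min (F ω) ((n : ℕ) : ℝ) := fun n ω => le_min (hF0 ω) n.cast_nonneg
  have h1 : ∀ n : ℕ, ∫⁻ ω, ENNReal.ofReal (min (F ω) n) ∂μ ≤ ENNReal.ofReal C := by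
    intro n
    rw [← ofReal_integral_eq_lintegral_ofReal _ (Eventually.of_forall (h0 n))]
    · exact ENNReal.ofReal_le_ofReal (h n)
    · refine Integrable.of_bound (hm n).aestronglyMeasurable n (Eventually.of_forall fun ω => ?_)
      rw [Real.norm_of_nonneg (h0 n ω)]
      exact min_le_right _ _
  have h2 : ∀ ω, liminf (fun n : ℕ => ENNReal.ofReal (min (F ω) n)) atTop
      = ENNReal.ofReal (F ω) := by
    intro ω
    refine Tendsto.liminf_eq (tendsto_const_nhds.congr' ?_)
    filter_upwards [eventually_ge_atTop ⌈F ω⌉₊] with n hn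
    rw [min_eq_left (Nat.ceil_le.1 hn)]
  calc ∫⁻ ω, ENNReal.ofReal (F ω) ∂μ
      = ∫⁻ ω, liminf (fun n : ℕ => ENNReal.ofReal (min (F ω) n)) atTop ∂μ := by simp_rw [h2]
    _ ≤ liminf (fun n : ℕ => ∫⁻ ω, ENNReal.ofReal (min (F ω) n) ∂μ) atTop :=
        lintegral_liminf_le fun n => (hm n).ennreal_ofReal
    _ ≤ ENNReal.ofReal C := (liminf_le_liminf (Eventually.of_forall h1)).trans (by simp)
    _ < ⊤ := ENNReal.ofReal_lt_top

end Moments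

/-- Corollary of the weak-convergence Lee–Yang theorem: if each `X n` is symmetric with
`E[exp(b_n X_n²)] < ∞` for some `b_n > 0`, `X n` converges in distribution to `X`, and
`E[exp(b X²)] = ∞` for every `b > 0`, then for all but finitely many `n` the moment
generating function `z ↦ E[exp(z X_n)]` has a zero that is not purely imaginary. -/
theorem eventually_not_pure_imaginary_zeros
    {Ω : ℕ → Type*} [∀ n, MeasurableSpace (Ω n)]
    (P : ∀ n, Measure (Ω n)) [∀ n, IsProbabilityMeasure (P n)]
    (X : ∀ n, Ω n → ℝ) (hXmeas : ∀ n, Measurable (X n))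
    {Ω' : Type*} [MeasurableSpace Ω'] (P' : Measure Ω') [IsProbabilityMeasure P']
    (Y : Ω' → ℝ) (hYmeas : Measurable Y)
    (hsymm : ∀ n, (P n).map (fun ω => -(X n ω)) = (P n).map (X n))
    (hsub : ∀ n, ∃ b : ℝ, 0 < b ∧ Integrable (fun ω => Real.exp (b * (X n ω) ^ 2)) (P n))
    (hconv : ∀ g : BoundedContinuousFunction ℝ ℝ,
      Tendsto (fun n => ∫ ω, g (X n ω) ∂(P n)) atTop (nhds (∫ ω, g (Y ω) ∂P')))
    (hinf : ∀ b : ℝ, 0 < b → ¬ Integrable (fun ω => Real.exp (b * (Y ω) ^ 2)) P') :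
    ∀ᶠ n in atTop, ∃ z : ℂ, z.re ≠ 0 ∧ (∫ ω, Complex.exp (z * (X n ω : ℂ)) ∂(P n)) = 0 := by
  by_contra hcon
  obtain ⟨K, hK, hKtail⟩ := exists_tailCutoff_integral_lt (μ := P') hYmeas
    (by norm_num : (0 : ℝ) < 1 / 400)
  obtain ⟨b, hb, C, hC⟩ := exists_lintegral_exp_mul_sq_le
    (by positivity : (0 : ℝ) < 2 * (K + 1) ^ 2)
  have htail : ∀ᶠ n in atTop, ∫ ω, tailCutoff K (X n ω) ∂(P n) < 1 / 400 :=
    (hconv (BoundedContinuousFunction.ofNormedAddCommGroup (tailCutoff K)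
      (continuous_tailCutoff K) 1 (norm_tailCutoff_le K))).eventually_lt_const hKtail
  have hfreq : ∃ᶠ n in atTop,
      ∫⁻ ω, ENNReal.ofReal (Real.exp (b * X n ω ^ 2)) ∂(P n) ≤ ENNReal.ofReal C := by
    refine ((not_eventually.1 hcon).and_eventually htail).mono fun n hn => ?_
    obtain ⟨hz, ht⟩ := hn
    push Not at hz
    obtain ⟨c, hc, hcint⟩ := hsub n
    have hint := integrable_exp_mul_of_integrable_exp_mul_sq (hXmeas n) hc hcint
    have hmgf := mgf_le_exp_of_zeros_imaginary (hXmeas n) (hsymm n) hc hcint hz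
    have hvar := integral_sq_le_of_integral_tailCutoff_le (hXmeas n) hint hmgf hK ht.le
    refine hC (P n) (X n) (hXmeas n) hint fun t => (hmgf t).trans (Real.exp_le_exp.2 ?_)
    gcongr
  refine hinf b hb (integrable_of_integral_min_le (C := max C 0) (by fun_prop)
    (fun ω => (Real.exp_pos _).le) fun M => ?_)
  have hpos : ∀ x : ℝ, 0 ≤ min (Real.exp (b * x ^ 2)) (M : ℝ) := fun x =>
    le_min (Real.exp_pos _).le M.cast_nonneg
  have hlim := hconv (BoundedContinuousFunction.ofNormedAddCommGroup
    (fun x => min (Real.exp (b * x ^ 2)) M) (by fun_prop) M fun x => by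
      rw [Real.norm_of_nonneg (hpos x)]
      exact min_le_right _ _)
  refine le_of_tendsto_of_frequently hlim (hfreq.mono fun n hn => ?_)
  simp only [BoundedContinuousFunction.coe_ofNormedAddCommGroup]
  have hm : Measurable fun ω => min (Real.exp (b * X n ω ^ 2)) (M : ℝ) := by
    have := hXmeas n
    fun_prop
  rw [integral_eq_lintegral_of_nonneg_ae (Eventually.of_forall fun ω => hpos _)
    hm.aestronglyMeasurable]
  refine ENNReal.toReal_le_of_le_ofReal (le_max_right _ _) ?_
  refine (lintegral_mono fun ω => ENNReal.ofReal_le_ofReal (min_le_left _ _)).trans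
    (hn.trans (ENNReal.ofReal_le_ofReal (le_max_left _ _)))
end
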